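/- arXiv:2303.13380 — 4 statements merged into one kernel-verified Lean document; each statement's English description precedes it below -/
import Mathlib

section
/- Let ℓ ≥ 2 be an integer, n sufficiently large compared to ℓ, C ≥ 1, and let G be an n-vertex graph with at least C·n^{3/2} edges. Then G contains a non-empty α-rich collection of 2ℓ-cycles, where α = c·C²/(2^{2ℓ}K^{2ℓ−2}) with c = (1/2)(2^{12}ℓ)^{−ℓ} and K = 640. -/
open SimpleGraph

/-- `c : ZMod m → V` is a (labelled) cycle on `m` vertices in `G`. -/
def IsCycleIn {V : Type*} (G : SimpleGraph V) {m : ℕ} (c : ZMod m → V) : Prop :=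
  Function.Injective c ∧ ∀ i : ZMod m, G.Adj (c i) (c (i + 1))

/-- Abstract cleaning lemma. -/
theorem clean_lemma {X I Y : Type*} [DecidableEq X] [Fintype I] [DecidableEq I] [DecidableEq Y]
    (H : Finset X) (key : I → X → Y) (α : ℝ)
    (h : α * (∑ i, ((H.image (key i)).card : ℝ)) < H.card) :
    ∃ S ⊆ H, S.Nonempty ∧ ∀ c ∈ S, ∀ i,
      α ≤ ((S.filter (fun c' => key i c' = key i c)).card : ℝ) := by
  let F : Finset X → ℝ := fun S => (S.card : ℝ) - α * ∑ i, ((S.image (key i)).card : ℝ)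
  obtain ⟨S, hS, hmax⟩ := Finset.exists_max_image H.powerset F ⟨H, by simp⟩
  have hSH := Finset.mem_powerset.1 hS
  refine ⟨S, hSH, ?_, ?_⟩
  · by_contra hne
    rw [Finset.not_nonempty_iff_eq_empty] at hne
    have := hmax H (by simp)
    simp only [F, hne, Finset.image_empty, Finset.card_empty, Nat.cast_zero,
      Finset.sum_const_zero, mul_zero, sub_zero] at this
    linarith
  · intro c hc i
    by_contra hlt
    push Not at hlt
    set D := S.filter (fun c' => key i c' = key i c) with hD
    have hα : 0 < α := lt_of_le_of_lt (Nat.cast_nonneg _) hlt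
    have h1 := hmax (S \ D) (Finset.mem_powerset.2 (Finset.sdiff_subset.trans hSH))
    have hcard : ((S \ D).card : ℝ) = S.card - D.card := by
      rw [Finset.card_sdiff_of_subset (Finset.filter_subset _ _),
        Nat.cast_sub (Finset.card_le_card (Finset.filter_subset _ _))]
    have hsum : (∑ j, (((S \ D).image (key j)).card : ℝ)) + 1 ≤
        ∑ j, ((S.image (key j)).card : ℝ) := by
      rw [← Finset.add_sum_erase _ _ (Finset.mem_univ i),
        ← Finset.add_sum_erase (a := i) _ (fun j => ((S.image (key j)).card : ℝ))
          (Finset.mem_univ i)]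
      have e1 : (((S \ D).image (key i)).card : ℝ) + 1 ≤ ((S.image (key i)).card : ℝ) := by
        have : (S \ D).image (key i) ⊂ S.image (key i) := by
          rw [Finset.ssubset_iff_of_subset (Finset.image_subset_image Finset.sdiff_subset)]
          refine ⟨key i c, Finset.mem_image_of_mem _ hc, ?_⟩
          intro hh
          obtain ⟨c', hc', he⟩ := Finset.mem_image.1 hh
          rw [Finset.mem_sdiff] at hc'
          exact hc'.2 (Finset.mem_filter.2 ⟨hc'.1, he⟩)
        exact_mod_cast Finset.card_lt_card this
      have e2 : ∑ j ∈ Finset.univ.erase i, (((S \ D).image (key j)).card : ℝ) ≤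
          ∑ j ∈ Finset.univ.erase i, ((S.image (key j)).card : ℝ) := by
        refine Finset.sum_le_sum fun j _ => ?_
        exact_mod_cast Finset.card_le_card (Finset.image_subset_image Finset.sdiff_subset)
      linarith
    simp only [F] at h1
    rw [hcard] at h1
    nlinarith [mul_le_mul_of_nonneg_left hsum hα.le]

set_option linter.unusedSectionVars false
set_option linter.style.haveILetI false

section spectral
variable {W : Type*} [Fintype W] [DecidableEq W]

theorem spec_pow (A : Matrix W W ℝ) (hA : A.IsHermitian) :
    ∃ (lam : W → ℝ) (U : W → W → ℝ),
      (∀ k u v, (A ^ k) u v = ∑ i, U u i * lam i ^ k * U v i) ∧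
      (∀ i, ∑ v, U v i ^ 2 = 1) := by
  refine ⟨hA.eigenvalues, fun u i => (hA.eigenvectorUnitary : Matrix W W ℝ) u i, ?_, ?_⟩
  · set U : Matrix W W ℝ := (hA.eigenvectorUnitary : Matrix W W ℝ) with hU
    have hUU : star U * U = 1 := Unitary.coe_star_mul_self hA.eigenvectorUnitary
    have hUU' : U * star U = 1 := Unitary.coe_mul_star_self hA.eigenvectorUnitary
    have hs : A = U * Matrix.diagonal hA.eigenvalues * star U := by
      have := hA.spectral_theorem
      rw [Unitary.conjStarAlgAut_apply] at this
      exact this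
    have hp : ∀ k, A ^ k = U * Matrix.diagonal (fun i => hA.eigenvalues i ^ k) * star U := by
      intro k
      induction k with
      | zero => simp [hUU']
      | succ k ih =>
        rw [pow_succ, ih]
        nth_rw 2 [hs]
        calc _ = U * Matrix.diagonal (fun i => hA.eigenvalues i ^ k) * (star U * U) *
                  Matrix.diagonal hA.eigenvalues * star U := by simp only [mul_assoc]
          _ = _ := by
            rw [hUU, mul_one, mul_assoc U, Matrix.diagonal_mul_diagonal]
            simp only [pow_succ]
    intro k u v
    rw [hp, Matrix.mul_apply]
    refine Finset.sum_congr rfl fun i _ => ?_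
    rw [Matrix.mul_diagonal]
    simp [Matrix.star_apply]
  · intro i
    have hUU : star (hA.eigenvectorUnitary : Matrix W W ℝ) * (hA.eigenvectorUnitary : Matrix W W ℝ) = 1 := Unitary.coe_star_mul_self hA.eigenvectorUnitary
    have := congrFun (congrFun hUU i) i
    rw [Matrix.mul_apply] at this
    simp only [Matrix.star_apply, star_trivial, Matrix.one_apply_eq] at this
    rw [← this]
    exact Finset.sum_congr rfl fun v _ => by ring

theorem sym_ineq (x y : ℝ) (hx : 0 ≤ x) (hy : 0 ≤ y) (a b : ℕ) :
    x ^ (a + 2) * y ^ (b + 2) + x ^ (b + 2) * y ^ (a + 2) ≤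
      x ^ 2 * y ^ (a + b + 2) + x ^ (a + b + 2) * y ^ 2 := by
  have h : 0 ≤ (x ^ a - y ^ a) * (x ^ b - y ^ b) := by
    rcases le_total x y with h | h
    · exact mul_nonneg_of_nonpos_of_nonpos (sub_nonpos.2 (pow_le_pow_left₀ hx h _))
        (sub_nonpos.2 (pow_le_pow_left₀ hx h _))
    · exact mul_nonneg (sub_nonneg.2 (pow_le_pow_left₀ hy h _))
        (sub_nonneg.2 (pow_le_pow_left₀ hy h _))
  have h2 : 0 ≤ x ^ 2 * y ^ 2 * ((x ^ a - y ^ a) * (x ^ b - y ^ b)) := by positivity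
  ring_nf at h2 ⊢
  linarith

theorem cheb_ineq (p x : W → ℝ) (hp : ∀ i, 0 ≤ p i) (hx : ∀ i, 0 ≤ x i) (a b : ℕ) :
    (∑ i, p i * x i ^ (a + 2)) * (∑ i, p i * x i ^ (b + 2)) ≤
      (∑ i, p i * x i ^ 2) * (∑ i, p i * x i ^ (a + b + 2)) := by
  have key : ∀ s t : ℕ, 2 * ((∑ i, p i * x i ^ s) * (∑ i, p i * x i ^ t)) =
      ∑ i, ∑ j, p i * p j * (x i ^ s * x j ^ t + x i ^ t * x j ^ s) := by
    intro s t
    rw [two_mul]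
    nth_rw 2 [mul_comm (∑ i, p i * x i ^ s)]
    rw [Finset.sum_mul_sum, Finset.sum_mul_sum, ← Finset.sum_add_distrib]
    refine Finset.sum_congr rfl fun i _ => ?_
    rw [← Finset.sum_add_distrib]
    exact Finset.sum_congr rfl fun j _ => by ring
  have : ∑ i, ∑ j, p i * p j * (x i ^ (a+2) * x j ^ (b+2) + x i ^ (b+2) * x j ^ (a+2)) ≤
      ∑ i, ∑ j, p i * p j * (x i ^ 2 * x j ^ (a+b+2) + x i ^ (a+b+2) * x j ^ 2) :=
    Finset.sum_le_sum fun i _ => Finset.sum_le_sum fun j _ =>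
      mul_le_mul_of_nonneg_left (sym_ineq _ _ (hx i) (hx j) a b) (mul_nonneg (hp i) (hp j))
  rw [← key, ← key] at this
  linarith

/-- All the spectral information that we need. `tr k` stands for the trace. -/
theorem spectral_main (H : SimpleGraph W) [DecidableRel H.Adj] (l : ℕ) (hl : 2 ≤ l)
    (Δ Q d : ℝ) (hΔ : 0 < Δ) (hQ : 0 < Q) (hd : 0 < d) (hdeg : ∀ v, (H.degree v : ℝ) ≤ Δ)
    (hne : Nonempty W)
    (hsum : d * Fintype.card W ≤ ∑ v, (H.degree v : ℝ)) :
    d ^ (2 * l) ≤ ∑ v, (H.adjMatrix ℝ ^ (2 * l)) v v ∧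
    ∀ a b, 1 ≤ a → 1 ≤ b → a + b = 2 * l →
      ∑ v, (H.adjMatrix ℝ ^ a) v v * (H.adjMatrix ℝ ^ b) v v ≤
        (∑ v, (H.adjMatrix ℝ ^ (2 * l)) v v) / Q + Q ^ (l - 1) * Fintype.card W * Δ ^ l := by
  have hA : (H.adjMatrix ℝ).IsHermitian := by
    rw [Matrix.IsHermitian, Matrix.conjTranspose_eq_transpose_of_trivial]
    exact H.isSymm_adjMatrix
  obtain ⟨lam, U, hpow, hU⟩ := spec_pow _ hA
  have htr : ∀ k, ∑ v, (H.adjMatrix ℝ ^ k) v v = ∑ i, lam i ^ k := by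
    intro k
    simp_rw [hpow]
    rw [Finset.sum_comm]
    refine Finset.sum_congr rfl fun i _ => ?_
    calc _ = lam i ^ k * ∑ v, U v i ^ 2 := by
          rw [Finset.mul_sum]; exact Finset.sum_congr rfl fun v _ => by ring
      _ = _ := by rw [hU, mul_one]
  have hsq : ∀ i, 0 ≤ lam i ^ (2 * l) := fun i => by rw [pow_mul]; positivity
  refine ⟨?_, ?_⟩
  · rw [htr]
    obtain ⟨i, hi⟩ : ∃ i, d ≤ |lam i| := by
      by_contra hcon
      push Not at hcon
      have e1 : ∀ k, ∑ u, ∑ v, (H.adjMatrix ℝ ^ k) u v = ∑ i, lam i ^ k * (∑ v, U v i) ^ 2 := by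
        intro k
        simp_rw [hpow]
        calc _ = ∑ u, ∑ i, ∑ v, U u i * lam i ^ k * U v i :=
              Finset.sum_congr rfl fun u _ => Finset.sum_comm
          _ = ∑ i, ∑ u, ∑ v, U u i * lam i ^ k * U v i := Finset.sum_comm
          _ = _ := by
            refine Finset.sum_congr rfl fun i _ => ?_
            rw [sq, Finset.sum_mul_sum, Finset.mul_sum]
            refine Finset.sum_congr rfl fun u _ => ?_
            rw [Finset.mul_sum]
            exact Finset.sum_congr rfl fun v _ => by ring
      have e0 := e1 0
      have e1 := e1 1
      simp only [pow_zero, pow_one, one_mul, Matrix.one_apply] at e0 e1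
      have e0' : (Fintype.card W : ℝ) = ∑ i, (∑ v, U v i) ^ 2 := by
        rw [← e0]; simp
      have e1' : ∑ v, (H.degree v : ℝ) = ∑ i, lam i * (∑ v, U v i) ^ 2 := by
        rw [← e1]
        refine Finset.sum_congr rfl fun u _ => ?_
        simp [SimpleGraph.adjMatrix_apply, ← SimpleGraph.card_neighborFinset_eq_degree,
          SimpleGraph.neighborFinset_eq_filter]
      have hpos : (0 : ℝ) < Fintype.card W := by exact_mod_cast Fintype.card_pos
      rw [e1', e0', Finset.mul_sum] at hsum
      rw [e0'] at hpos
      obtain ⟨i, _, hi⟩ := Finset.exists_lt_of_sum_lt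
        (s := Finset.univ) (f := fun _ : W => (0 : ℝ)) (g := fun i => (∑ v, U v i) ^ 2)
        (by simpa using hpos)
      have : ∑ i, lam i * (∑ v, U v i) ^ 2 < ∑ i, d * (∑ v, U v i) ^ 2 := by
        refine Finset.sum_lt_sum (fun i _ => ?_) ⟨i, Finset.mem_univ _, ?_⟩
        · exact mul_le_mul_of_nonneg_right ((le_abs_self _).trans (hcon i).le) (sq_nonneg _)
        · exact mul_lt_mul_of_pos_right ((le_abs_self _).trans_lt (hcon i)) hi
      linarith
    calc d ^ (2 * l) ≤ |lam i| ^ (2 * l) := pow_le_pow_left₀ hd.le hi _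
      _ = lam i ^ (2 * l) := by rw [pow_mul, pow_mul, sq_abs]
      _ ≤ _ := Finset.single_le_sum (f := fun i => lam i ^ (2 * l)) (fun i _ => hsq i)
          (Finset.mem_univ i)
  · intro a b ha hb hab
    have hT : Δ * ∑ i, lam i ^ (2 * l - 2) ≤
        (∑ i, lam i ^ (2 * l)) / Q + Q ^ (l - 1) * Fintype.card W * Δ ^ l := by
      have : ∀ i, Δ * lam i ^ (2 * l - 2) ≤ lam i ^ (2 * l) / Q + Q ^ (l - 1) * Δ ^ l := by
        intro i
        obtain ⟨r, rfl⟩ : ∃ r, l = r + 1 := ⟨l - 1, by omega⟩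
        have h2 : 2 * (r + 1) - 2 = 2 * r := by omega
        rw [h2, pow_mul, pow_mul, Nat.add_sub_cancel]
        set y := lam i ^ 2 with hy
        have hy0 : 0 ≤ y := sq_nonneg _
        rcases le_total y (Q * Δ) with h | h
        · have : y ^ r ≤ (Q * Δ) ^ r := pow_le_pow_left₀ hy0 h r
          have h3 : Δ * y ^ r ≤ Δ * (Q * Δ) ^ r := mul_le_mul_of_nonneg_left this hΔ.le
          have h4 : Δ * (Q * Δ) ^ r = Q ^ r * Δ ^ (r + 1) := by rw [mul_pow]; ring
          have h5 : 0 ≤ y ^ (r + 1) / Q := by positivity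
          linarith
        · have h3 : Δ ≤ y / Q := by rw [le_div_iff₀ hQ]; linarith
          have h4 : Δ * y ^ r ≤ y / Q * y ^ r := mul_le_mul_of_nonneg_right h3 (by positivity)
          have h5 : y / Q * y ^ r = y ^ (r + 1) / Q := by rw [pow_succ]; ring
          have h6 : 0 ≤ Q ^ r * Δ ^ (r + 1) := by positivity
          linarith
      calc _ = ∑ i, Δ * lam i ^ (2 * l - 2) := by rw [Finset.mul_sum]
        _ ≤ ∑ i, (lam i ^ (2 * l) / Q + Q ^ (l - 1) * Δ ^ l) := Finset.sum_le_sum fun i _ => this i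
        _ = _ := by
          rw [Finset.sum_add_distrib, Finset.sum_div]
          simp; ring
    rw [htr]
    refine le_trans ?_ hT
    have hdiag1 : ∀ v, (H.adjMatrix ℝ ^ 1) v v = 0 := by intro v; simp
    have hnn : 0 ≤ Δ * ∑ i, lam i ^ (2 * l - 2) := by
      refine mul_nonneg hΔ.le (Finset.sum_nonneg fun i _ => ?_)
      have : 2 * l - 2 = 2 * (l - 1) := by omega
      rw [this, pow_mul]; positivity
    rcases eq_or_lt_of_le ha with ha1 | ha2
    · rw [← ha1]; simp only [hdiag1, zero_mul, Finset.sum_const_zero]; exact hnn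
    rcases eq_or_lt_of_le hb with hb1 | hb2
    · rw [← hb1]; simp only [hdiag1, mul_zero, Finset.sum_const_zero]; exact hnn
    rw [← htr, Finset.mul_sum]
    refine Finset.sum_le_sum fun v _ => ?_
    obtain ⟨a, rfl⟩ : ∃ r, a = r + 2 := ⟨a - 2, by omega⟩
    obtain ⟨b, rfl⟩ : ∃ r, b = r + 2 := ⟨b - 2, by omega⟩
    have hab2 : 2 * l - 2 = a + b + 2 := by omega
    have hev : Even (a + b + 2) := ⟨l - 1, by omega⟩
    have hch := cheb_ineq (fun i => U v i ^ 2) (fun i => |lam i|) (fun i => sq_nonneg _)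
      (fun i => abs_nonneg _) a b
    have habs : ∀ k, |(H.adjMatrix ℝ ^ k) v v| ≤ ∑ i, U v i ^ 2 * |lam i| ^ k := by
      intro k
      rw [hpow]
      refine (Finset.abs_sum_le_sum_abs _ _).trans (le_of_eq ?_)
      refine Finset.sum_congr rfl fun i _ => ?_
      rw [abs_mul, abs_mul, abs_pow, ← sq_abs (U v i)]; ring
    have heq : ∀ k, Even k → ∑ i, U v i ^ 2 * |lam i| ^ k = (H.adjMatrix ℝ ^ k) v v := by
      intro k hk
      rw [hpow]
      refine Finset.sum_congr rfl fun i _ => ?_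
      rw [hk.pow_abs]; ring
    rw [heq 2 even_two, heq _ hev] at hch
    rw [hab2]
    have hd2 : (H.adjMatrix ℝ ^ 2) v v ≤ Δ := by
      rw [sq, SimpleGraph.adjMatrix_mul_self_apply_self]; exact hdeg v
    have hnn2 : 0 ≤ (H.adjMatrix ℝ ^ (a + b + 2)) v v := by
      rw [← heq _ hev]
      exact Finset.sum_nonneg fun i _ => by positivity
    calc _ ≤ |(H.adjMatrix ℝ ^ (a + 2)) v v| * |(H.adjMatrix ℝ ^ (b + 2)) v v| := by
          rw [← abs_mul]; exact le_abs_self _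
      _ ≤ _ := mul_le_mul (habs _) (habs _) (abs_nonneg _)
          (Finset.sum_nonneg fun i _ => by positivity)
      _ ≤ _ := hch
      _ ≤ _ := mul_le_mul_of_nonneg_right hd2 hnn2

end spectral

section walks
variable {W : Type*} [Fintype W] [DecidableEq W]

/-- Functional walks of length `k` in `H` from `u` to `v`. -/
def wset (H : SimpleGraph W) [DecidableRel H.Adj] (k : ℕ) (u v : W) : Finset (Fin (k + 1) → W) :=
  Finset.univ.filter (fun f => f 0 = u ∧ f (Fin.last k) = v ∧
    ∀ i : Fin k, H.Adj (f i.castSucc) (f i.succ))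

theorem wset_card (H : SimpleGraph W) [DecidableRel H.Adj] (k : ℕ) (u v : W) :
    ((wset H k u v).card : ℝ) = (H.adjMatrix ℝ ^ k) u v := by
  induction k generalizing u with
  | zero =>
    rw [pow_zero, Matrix.one_apply]
    split_ifs with h
    · subst h
      have : wset H 0 u u = {fun _ => u} := by
        ext f
        simp only [wset, Finset.mem_filter, Finset.mem_univ, true_and, Finset.mem_singleton]
        constructor
        · rintro ⟨h, -⟩
          funext i
          rw [← h]; congr 1; ext; have := i.isLt; simp only [Fin.val_zero]; omega
        · rintro rfl
          exact ⟨rfl, rfl, fun i => i.elim0⟩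
      rw [this]; simp
    · have : wset H 0 u v = ∅ := by
        ext f
        simp only [wset, Finset.mem_filter, Finset.mem_univ, true_and, Finset.notMem_empty,
          iff_false]
        rintro ⟨h1, h2, -⟩
        exact h (h1.symm.trans h2)
      rw [this]; simp
  | succ k ih =>
    have hc : (wset H (k + 1) u v).card =
        ((H.neighborFinset u).sigma (fun x => wset H k x v)).card := by
      refine Finset.card_bij' (fun f _ => ⟨f 1, Fin.tail f⟩)
        (fun p _ => (Fin.cons u p.2 : Fin (k + 2) → W)) ?_ ?_ ?_ ?_
      · intro f hf
        simp only [wset, Finset.mem_filter, Finset.mem_univ, true_and, Finset.mem_sigma,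
          SimpleGraph.mem_neighborFinset] at hf ⊢
        obtain ⟨h0, hl, ha⟩ := hf
        refine ⟨?_, rfl, hl, fun i => ?_⟩
        · have := ha 0
          rw [← h0]; exact this
        · exact ha i.succ
      · rintro ⟨x, g⟩ hp
        simp only [wset, Finset.mem_filter, Finset.mem_univ, true_and, Finset.mem_sigma,
          SimpleGraph.mem_neighborFinset] at hp ⊢
        obtain ⟨hx, h0, hl, ha⟩ := hp
        refine ⟨rfl, hl, fun i => ?_⟩
        refine Fin.cases ?_ (fun j => ?_) i
        · simp only [Fin.castSucc_zero, Fin.cons_zero, Fin.cons_succ, h0]; exact hx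
        · exact ha j
      · intro f hf
        simp only [wset, Finset.mem_filter, Finset.mem_univ, true_and] at hf
        rw [← hf.1]
        exact Fin.cons_self_tail f
      · rintro ⟨x, g⟩ hp
        simp only [wset, Finset.mem_filter, Finset.mem_univ, true_and, Finset.mem_sigma] at hp
        have h1 : (Fin.cons u g : Fin (k + 2) → W) 1 = x := hp.2.1
        simp only [h1, Fin.tail_cons]
    rw [hc, Finset.card_sigma, pow_succ', Matrix.mul_apply]
    push_cast
    simp_rw [ih, SimpleGraph.adjMatrix_apply, ite_mul, one_mul, zero_mul]
    rw [← Finset.sum_filter, SimpleGraph.neighborFinset_eq_filter]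

theorem walk_total (H : SimpleGraph W) [DecidableRel H.Adj] (Δ : ℝ) (hΔ : 0 ≤ Δ)
    (hdeg : ∀ v, (H.degree v : ℝ) ≤ Δ) (k : ℕ) (u : W) :
    ∑ v, (H.adjMatrix ℝ ^ k) u v ≤ Δ ^ k := by
  induction k generalizing u with
  | zero => simp [Matrix.one_apply]
  | succ k ih =>
    simp_rw [pow_succ' (H.adjMatrix ℝ), Matrix.mul_apply]
    rw [Finset.sum_comm]
    simp_rw [← Finset.mul_sum]
    calc _ ≤ ∑ x, H.adjMatrix ℝ u x * Δ ^ k := by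
          refine Finset.sum_le_sum fun x _ => mul_le_mul_of_nonneg_left (ih x) ?_
          rw [SimpleGraph.adjMatrix_apply]; split_ifs <;> norm_num
      _ = (H.degree u : ℝ) * Δ ^ k := by
          rw [← Finset.sum_mul]
          congr 1
          simp [SimpleGraph.adjMatrix_apply, ← SimpleGraph.card_neighborFinset_eq_degree,
            SimpleGraph.neighborFinset_eq_filter]
      _ ≤ Δ * Δ ^ k := mul_le_mul_of_nonneg_right (hdeg u) (pow_nonneg hΔ k)
      _ = _ := by ring

/-- Functional walks with any ends. -/
def wall (H : SimpleGraph W) [DecidableRel H.Adj] (k : ℕ) : Finset (Fin (k + 1) → W) :=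
  Finset.univ.filter (fun f => ∀ i : Fin k, H.Adj (f i.castSucc) (f i.succ))

theorem wall_card (H : SimpleGraph W) [DecidableRel H.Adj] (Δ : ℝ) (hΔ : 0 ≤ Δ)
    (hdeg : ∀ v, (H.degree v : ℝ) ≤ Δ) (k : ℕ) :
    ((wall H k).card : ℝ) ≤ Fintype.card W * Δ ^ k := by
  have h1 : wall H k ⊆ Finset.univ.biUnion (fun u => Finset.univ.biUnion (fun v => wset H k u v)) := by
    intro f hf
    simp only [wall, wset, Finset.mem_filter, Finset.mem_univ, true_and, Finset.mem_biUnion] at hf ⊢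
    exact ⟨f 0, f (Fin.last k), rfl, rfl, hf⟩
  have h2 : (wall H k).card ≤ ∑ u, ∑ v, (wset H k u v).card :=
    (Finset.card_le_card h1).trans (Finset.card_biUnion_le.trans
      (Finset.sum_le_sum fun u _ => Finset.card_biUnion_le))
  calc ((wall H k).card : ℝ) ≤ ∑ u, ∑ v, ((wset H k u v).card : ℝ) := by exact_mod_cast h2
    _ = ∑ u, ∑ v, (H.adjMatrix ℝ ^ k) u v := by simp_rw [wset_card]
    _ ≤ ∑ u : W, Δ ^ k := Finset.sum_le_sum fun u _ => walk_total H Δ hΔ hdeg k u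
    _ = _ := by simp

/-- Closed walks indexed by `ZMod N`. -/
def cwalks (H : SimpleGraph W) [DecidableRel H.Adj] (N : ℕ) [NeZero N] : Finset (ZMod N → W) :=
  haveI : Fintype (ZMod N) := ZMod.fintype N
  Finset.univ.filter (fun c => ∀ i, H.Adj (c i) (c (i + 1)))

theorem mem_cwalks (H : SimpleGraph W) [DecidableRel H.Adj] (N : ℕ) [NeZero N] (c : ZMod N → W) :
    c ∈ cwalks H N ↔ ∀ i, H.Adj (c i) (c (i + 1)) := by
  simp [cwalks]

theorem cwalks_lower (H : SimpleGraph W) [DecidableRel H.Adj] (N : ℕ) [NeZero N] :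
    ∑ v, (H.adjMatrix ℝ ^ N) v v ≤ ((cwalks H N).card : ℝ) := by
  simp_rw [← wset_card]
  rw [← Nat.cast_sum, ← Finset.card_sigma]
  norm_cast
  refine Finset.card_le_card_of_injOn
    (fun p => fun i : ZMod N => p.2 ⟨i.val, (ZMod.val_lt i).trans (Nat.lt_succ_self N)⟩) ?_ ?_
  · rintro ⟨v, f⟩ hp
    simp only [wset, Finset.coe_sigma, Set.mem_sigma_iff, Finset.coe_filter, Finset.mem_univ,
      true_and, Set.mem_ofPred_eq, Finset.coe_univ, Set.mem_univ] at hp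
    obtain ⟨h0, hl, ha⟩ := hp
    rw [Finset.mem_coe, mem_cwalks]
    intro i
    have h1 := ha ⟨i.val, ZMod.val_lt i⟩
    have h2 : f ⟨(i + 1).val, (ZMod.val_lt _).trans (Nat.lt_succ_self N)⟩ =
        f (Fin.succ ⟨i.val, ZMod.val_lt i⟩) := by
      by_cases hi : i.val + 1 < N
      · congr 1
        ext
        simp only [Fin.succ_mk]
        have e : i + 1 = ((i.val + 1 : ℕ) : ZMod N) := by push_cast; rw [ZMod.natCast_zmod_val]
        rw [e, ZMod.val_natCast_of_lt hi]
      · have hiN : i.val + 1 = N := by have := ZMod.val_lt i; omega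
        have hz : i + 1 = 0 := by
          have : ((i.val + 1 : ℕ) : ZMod N) = i + 1 := by push_cast; rw [ZMod.natCast_zmod_val]
          rw [← this, hiN, ZMod.natCast_self]
        have e1 : (⟨(i + 1).val, (ZMod.val_lt _).trans (Nat.lt_succ_self N)⟩ : Fin (N + 1)) = 0 := by
          ext; simp [hz]
        have e2 : (Fin.succ ⟨i.val, ZMod.val_lt i⟩ : Fin (N + 1)) = Fin.last N := by
          ext; simp [hiN]
        rw [e1, e2, h0, hl]
    show H.Adj (f _) (f _)
    rw [h2]
    exact h1
  · rintro ⟨v, f⟩ hp ⟨w, g⟩ hq h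
    simp only [wset, Finset.coe_sigma, Set.mem_sigma_iff, Finset.coe_filter, Finset.mem_univ,
      true_and, Set.mem_ofPred_eq, Finset.coe_univ, Set.mem_univ] at hp hq
    have hlt : ∀ t (ht : t < N), f ⟨t, ht.trans (Nat.lt_succ_self N)⟩ =
        g ⟨t, ht.trans (Nat.lt_succ_self N)⟩ := by
      intro t ht
      have := congrFun h (t : ZMod N)
      simpa only [ZMod.val_natCast_of_lt ht] using this
    have h0 : f 0 = g 0 := hlt 0 (Nat.pos_of_ne_zero (NeZero.ne N))
    have hvw : v = w := by rw [← hp.1, ← hq.1, h0]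
    subst hvw
    have : f = g := by
      funext t
      refine Fin.lastCases ?_ (fun s => ?_) t
      · rw [hp.2.1, hq.2.1]
      · exact hlt s.val s.isLt
    rw [this]

theorem cwalks_degenerate (H : SimpleGraph W) [DecidableRel H.Adj] (N : ℕ) [NeZero N]
    (i j : ZMod N) (hij : i ≠ j) :
    ∃ a b, 1 ≤ a ∧ 1 ≤ b ∧ a + b = N ∧
      (((cwalks H N).filter (fun c => c i = c j)).card : ℝ) ≤
        ∑ v, (H.adjMatrix ℝ ^ a) v v * (H.adjMatrix ℝ ^ b) v v := by
  have hlt := ZMod.val_lt (j - i)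
  have hpos : (j - i).val ≠ 0 := by
    rw [Ne, ZMod.val_eq_zero, sub_eq_zero]; exact fun h => hij h.symm
  obtain ⟨a, ha⟩ : ∃ a, a = (j - i).val := ⟨_, rfl⟩
  obtain ⟨b, hb⟩ : ∃ b, b = N - a := ⟨_, rfl⟩
  have hab : a + b = N := by omega
  have hja : i + (a : ZMod N) = j := by rw [ha, ZMod.natCast_zmod_val]; ring
  have hjb : j + (b : ZMod N) = i := by
    have : (a : ZMod N) + b = 0 := by rw [← Nat.cast_add, hab, ZMod.natCast_self]
    rw [← hja, add_assoc, this, add_zero]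
  refine ⟨a, b, by omega, by omega, hab, ?_⟩
  simp_rw [← wset_card, ← Nat.cast_mul, ← Finset.card_product]
  rw [← Nat.cast_sum, ← Finset.card_sigma]
  norm_cast
  refine Finset.card_le_card_of_injOn
    (fun c => ⟨c i, (fun t : Fin (a + 1) => c (i + (t.val : ZMod N)),
      fun t : Fin (b + 1) => c (j + (t.val : ZMod N)))⟩) ?_ ?_
  · intro c hc
    simp only [Finset.coe_filter, mem_cwalks, Set.mem_ofPred_eq] at hc
    obtain ⟨hc, he⟩ := hc
    simp only [wset, Finset.coe_sigma, Set.mem_sigma_iff, Finset.coe_univ, Set.mem_univ, true_and,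
      Finset.mem_coe, Finset.mem_product, Finset.mem_filter, Finset.mem_univ, Fin.val_zero,
      Nat.cast_zero, add_zero, Fin.val_last, hja, hjb, Fin.val_castSucc, Fin.val_succ,
      Nat.cast_add, Nat.cast_one, ← add_assoc, he]
    exact ⟨fun _ => hc _, fun _ => hc _⟩
  · intro c hc c' hc' h
    simp only [Sigma.mk.injEq] at h
    obtain ⟨h1, h2⟩ := h
    have h2 := eq_of_heq h2
    rw [Prod.mk.injEq] at h2
    funext x
    have hx : i + (((x - i).val : ℕ) : ZMod N) = x := by rw [ZMod.natCast_zmod_val]; ring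
    have hxl := ZMod.val_lt (x - i)
    by_cases hs : (x - i).val ≤ a
    · have := congrFun h2.1 ⟨(x - i).val, by omega⟩
      simpa only [hx] using this
    · have := congrFun h2.2 ⟨(x - i).val - a, by omega⟩
      have e : j + (((x - i).val - a : ℕ) : ZMod N) = x := by
        rw [← hja, add_assoc, ← Nat.cast_add, Nat.add_sub_cancel' (by omega), hx]
      simpa only [e] using this

/-- The key of `c` at position `i`: all entries of `c` other than the `i`-th one. -/
def ckey (N k : ℕ) (i : ZMod N) (c : ZMod N → W) : Fin (k + 1) → W :=
  fun t => c (i + 1 + (t.val : ZMod N))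

theorem ckey_mem (H : SimpleGraph W) [DecidableRel H.Adj] (N k : ℕ) [NeZero N]
    (i : ZMod N) (c : ZMod N → W) (hc : c ∈ cwalks H N) : ckey N k i c ∈ wall H k := by
  rw [mem_cwalks] at hc
  simp only [wall, ckey, Finset.mem_filter, Finset.mem_univ, true_and, Fin.val_castSucc,
    Fin.val_succ, Nat.cast_add, Nat.cast_one, ← add_assoc]
  exact fun _ => hc _

theorem ckey_eq (N k : ℕ) [NeZero N] (hN : N = k + 2) (i : ZMod N) (c c' : ZMod N → W)
    (h : ckey N k i c' = ckey N k i c) : Function.update c i (c' i) = c' := by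
  funext x
  by_cases hx : x = i
  · subst hx; simp
  · rw [Function.update_of_ne hx]
    have hlt := ZMod.val_lt (x - i)
    have hne : (x - i).val ≠ 0 := by
      rw [Ne, ZMod.val_eq_zero, sub_eq_zero]; exact hx
    have := congrFun h ⟨(x - i).val - 1, by omega⟩
    have e : i + 1 + (((x - i).val - 1 : ℕ) : ZMod N) = x := by
      rw [Nat.cast_sub (by omega), ZMod.natCast_zmod_val]; push_cast; ring
    simp only [ckey, e] at this
    exact this.symm

end walks


theorem core {W : Type*} [Fintype W] [DecidableEq W] [Nonempty W]
    (H : SimpleGraph W) [DecidableRel H.Adj] (l : ℕ) (hl : 2 ≤ l)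
    (K d α : ℝ) (hK : 0 < K) (hd : 0 < d) (hα0 : 0 ≤ α)
    (hdeg : ∀ v, (H.degree v : ℝ) ≤ K * d)
    (hsum : d * Fintype.card W ≤ ∑ v, (H.degree v : ℝ))
    (hbig : Fintype.card W * (16 * (l : ℝ) ^ 2 * K) ^ l ≤ d ^ l)
    (hα : α * (2 * l * (Fintype.card W * (K * d) ^ (2 * l - 2))) < d ^ (2 * l) / 2) :
    ∃ Cs : Set (ZMod (2 * l) → W), Cs.Nonempty ∧ (∀ c ∈ Cs, IsCycleIn H c) ∧
      ∀ c ∈ Cs, ∀ i : ZMod (2 * l), α ≤ ({v | Function.update c i v ∈ Cs}.ncard : ℝ) := by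
  classical
  haveI : NeZero (2 * l) := ⟨by omega⟩
  letI : Fintype (ZMod (2 * l)) := ZMod.fintype (2 * l)
  have hl0 : (0 : ℝ) < l := by exact_mod_cast (by omega : 0 < l)
  have hcardZ : Fintype.card (ZMod (2 * l)) = 2 * l := ZMod.card _
  obtain ⟨hlow, hdegn⟩ := spectral_main H l hl (K * d) (16 * (l : ℝ) ^ 2) d (by positivity)
    (by positivity) hd hdeg inferInstance hsum
  set T := ∑ v, (H.adjMatrix ℝ ^ (2 * l)) v v with hT
  have hcw : T ≤ ((cwalks H (2 * l)).card : ℝ) := cwalks_lower H (2 * l)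
  set m : ℝ := (Fintype.card W : ℝ) with hm
  set Inj := (cwalks H (2 * l)).filter (fun c => Function.Injective c) with hInj
  -- non-injective closed walks
  have hbad : (((cwalks H (2 * l)).filter (fun c => ¬ Function.Injective c)).card : ℝ) ≤ T / 2 := by
    have hsub : (cwalks H (2 * l)).filter (fun c => ¬ Function.Injective c) ⊆
        ((Finset.univ : Finset (ZMod (2 * l) × ZMod (2 * l))).filter (fun p => p.1 ≠ p.2)).biUnion
          (fun p => (cwalks H (2 * l)).filter (fun c => c p.1 = c p.2)) := by
      intro c hc
      rw [Finset.mem_filter] at hc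
      obtain ⟨hc, hni⟩ := hc
      simp only [Function.Injective] at hni
      push Not at hni
      obtain ⟨i, j, he, hne⟩ := hni
      simp only [Finset.mem_biUnion, Finset.mem_filter, Finset.mem_univ, true_and]
      exact ⟨(i, j), hne, hc, he⟩
    have h1 := (Finset.card_le_card hsub).trans Finset.card_biUnion_le
    set B : ℝ := T / (16 * (l : ℝ) ^ 2) + (16 * (l : ℝ) ^ 2) ^ (l - 1) * m * (K * d) ^ l with hB
    have hT0 : 0 ≤ T := (by positivity : (0:ℝ) ≤ d ^ (2 * l)).trans hlow
    have hB0 : 0 ≤ B := by positivity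
    have h2 : ∀ p ∈ ((Finset.univ : Finset (ZMod (2 * l) × ZMod (2 * l))).filter
        (fun p => p.1 ≠ p.2)),
        (((cwalks H (2 * l)).filter (fun c => c p.1 = c p.2)).card : ℝ) ≤ B := by
      intro p hp
      rw [Finset.mem_filter] at hp
      obtain ⟨a, b, ha, hb, hab, hle⟩ := cwalks_degenerate H (2 * l) p.1 p.2 hp.2
      exact hle.trans (hdegn a b ha hb hab)
    have h3 : (((cwalks H (2 * l)).filter (fun c => ¬ Function.Injective c)).card : ℝ) ≤
        (2 * l) ^ 2 * B := by
      calc _ ≤ ∑ p ∈ ((Finset.univ : Finset (ZMod (2 * l) × ZMod (2 * l))).filter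
            (fun p => p.1 ≠ p.2)),
              (((cwalks H (2 * l)).filter (fun c => c p.1 = c p.2)).card : ℝ) := by
            exact_mod_cast h1
        _ ≤ ∑ p ∈ ((Finset.univ : Finset (ZMod (2 * l) × ZMod (2 * l))).filter
            (fun p => p.1 ≠ p.2)), B := Finset.sum_le_sum h2
        _ ≤ ∑ p : ZMod (2 * l) × ZMod (2 * l), B :=
            Finset.sum_le_sum_of_subset_of_nonneg (Finset.filter_subset _ _) fun _ _ _ => hB0
        _ = _ := by
            rw [Finset.sum_const, Finset.card_univ, Fintype.card_prod, hcardZ, nsmul_eq_mul]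
            push_cast; ring
    refine h3.trans ?_
    have h4 : (16 * (l : ℝ) ^ 2) * ((16 * (l : ℝ) ^ 2) ^ (l - 1) * m * (K * d) ^ l) ≤ T := by
      calc _ = (m * (16 * (l : ℝ) ^ 2 * K) ^ l) * d ^ l := by
            have : (16 * (l : ℝ) ^ 2) ^ l = (16 * (l : ℝ) ^ 2) ^ (l - 1) * (16 * (l : ℝ) ^ 2) := by
              rw [← pow_succ]; congr 1; omega
            rw [mul_pow K d, mul_pow (16 * (l : ℝ) ^ 2) K, this]; ring
        _ ≤ d ^ l * d ^ l := mul_le_mul_of_nonneg_right hbig (by positivity)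
        _ = d ^ (2 * l) := by rw [← pow_add]; congr 1; omega
        _ ≤ T := hlow
    have h5 : (2 * (l : ℝ)) ^ 2 * (T / (16 * (l : ℝ) ^ 2)) = T / 4 := by
      field_simp; ring
    rw [hB, mul_add, h5]
    nlinarith
  have hInjcard : d ^ (2 * l) / 2 ≤ (Inj.card : ℝ) := by
    have := Finset.card_filter_add_card_filter_not (s := cwalks H (2 * l))
      (fun c => Function.Injective c)
    have h' : (Inj.card : ℝ) + (((cwalks H (2 * l)).filter
      (fun c => ¬ Function.Injective c)).card : ℝ) = (cwalks H (2 * l)).card := by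
      exact_mod_cast this
    linarith
  have hkeys : ∑ i : ZMod (2 * l), ((Inj.image (ckey (2 * l) (2 * l - 2) i)).card : ℝ) ≤
      2 * l * (m * (K * d) ^ (2 * l - 2)) := by
    calc _ ≤ ∑ i : ZMod (2 * l), (m * (K * d) ^ (2 * l - 2)) := by
          refine Finset.sum_le_sum fun i _ => ?_
          refine le_trans ?_ (wall_card H (K * d) (by positivity) hdeg (2 * l - 2))
          norm_cast
          refine Finset.card_le_card fun f hf => ?_
          obtain ⟨c, hc, rfl⟩ := Finset.mem_image.1 hf
          exact ckey_mem H _ _ i c (Finset.mem_filter.1 hc).1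
      _ = _ := by
          rw [Finset.sum_const, Finset.card_univ, hcardZ, nsmul_eq_mul]; push_cast; ring
  obtain ⟨S, hSI, hne, hrich⟩ := clean_lemma Inj (ckey (2 * l) (2 * l - 2)) α
    ((mul_le_mul_of_nonneg_left hkeys hα0).trans_lt (hα.trans_le hInjcard))
  refine ⟨↑S, hne, ?_, ?_⟩
  · intro c hc
    have := Finset.mem_filter.1 (hSI hc)
    exact ⟨this.2, (mem_cwalks H _ c).1 this.1⟩
  · intro c hc i
    refine (hrich c hc i).trans ?_
    rw [← Set.ncard_coe_finset]
    refine Nat.cast_le.2 ?_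
    refine Set.ncard_le_ncard_of_injOn (fun c' => c' i) ?_ ?_ (Set.toFinite _)
    · intro c' hc'
      have hc' := Finset.mem_filter.1 (Finset.mem_coe.1 hc')
      have := ckey_eq (2 * l) (2 * l - 2) (by omega) i c c' hc'.2
      simp only [Set.mem_ofPred_eq, this]
      exact hc'.1
    · intro c1 h1 c2 h2 he
      have h1 := Finset.mem_filter.1 (Finset.mem_coe.1 h1)
      have h2 := Finset.mem_filter.1 (Finset.mem_coe.1 h2)
      rw [← ckey_eq (2 * l) (2 * l - 2) (by omega) i c c1 h1.2,
        ← ckey_eq (2 * l) (2 * l - 2) (by omega) i c c2 h2.2]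
      simp only at he
      rw [he]

section regular

/-- Number of ordered adjacent pairs in `T`. -/
def epairs {V : Type*} (G : SimpleGraph V) [DecidableRel G.Adj] (T : Finset V) : ℕ :=
  ((T ×ˢ T).filter (fun p => G.Adj p.1 p.2)).card

theorem epairs_eq {V : Type*} (G : SimpleGraph V) [DecidableRel G.Adj] (T : Finset V) :
    epairs G T = ∑ v ∈ T, (T.filter (G.Adj v)).card := by
  rw [epairs, Finset.card_filter, Finset.sum_product]
  simp_rw [Finset.card_filter]

theorem regularize {n : ℕ} (G : SimpleGraph (Fin n)) [DecidableRel G.Adj] (C : ℝ) (hC : 1 ≤ C)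
    (hn : 2 ^ 42 ≤ n) (he : 16 * C ^ 4 * (n : ℝ) ^ 6 ≤ (epairs G Finset.univ : ℝ) ^ 4) :
    ∃ (S' : Finset (Fin n)) (d : ℝ), S'.Nonempty ∧ 0 < d ∧ C ^ 2 * (S'.card : ℝ) ≤ d ^ 2 ∧
      (n : ℝ) ≤ d ^ 4 ∧ (∀ v ∈ S', ((S'.filter (G.Adj v)).card : ℝ) ≤ 2 ^ 15 * d) ∧
      d * (S'.card : ℝ) ≤ epairs G S' := by
  classical
  have hn0 : (0 : ℝ) < n := by exact_mod_cast (by omega : 0 < n)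
  haveI : NeZero n := ⟨by omega⟩
  obtain ⟨S, hS, hmax⟩ := Finset.exists_max_image
    (Finset.univ.filter (fun T : Finset (Fin n) => T.Nonempty))
    (fun T => (epairs G T : ℝ) ^ 4 / (T.card : ℝ) ^ 5)
    ⟨Finset.univ, by simp⟩
  have hSne : S.Nonempty := (Finset.mem_filter.1 hS).2
  obtain ⟨m, hm⟩ : ∃ m : ℝ, m = S.card := ⟨_, rfl⟩
  obtain ⟨M, hM⟩ : ∃ M : ℝ, M = epairs G S := ⟨_, rfl⟩
  have hm0 : 0 < m := by rw [hm]; exact_mod_cast hSne.card_pos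
  have hM0 : 0 ≤ M := by rw [hM]; positivity
  have hmax' : ∀ T : Finset (Fin n), T.Nonempty →
      (epairs G T : ℝ) ^ 4 * m ^ 5 ≤ M ^ 4 * (T.card : ℝ) ^ 5 := by
    intro T hT
    have h := hmax T (by simp [hT])
    have hT0 : (0 : ℝ) < T.card := by exact_mod_cast hT.card_pos
    simp only [← hm, ← hM] at h
    rw [div_le_div_iff₀ (by positivity) (by positivity)] at h
    exact h
  have hMbig : 16 * C ^ 4 * n * m ^ 5 ≤ M ^ 4 := by
    have h := hmax' Finset.univ (by simp)
    rw [Finset.card_univ, Fintype.card_fin] at h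
    have h2 : 16 * C ^ 4 * (n : ℝ) ^ 6 * m ^ 5 ≤ M ^ 4 * (n : ℝ) ^ 5 :=
      (mul_le_mul_of_nonneg_right he (by positivity)).trans h
    have h3 : (16 * C ^ 4 * n * m ^ 5) * (n : ℝ) ^ 5 ≤ M ^ 4 * (n : ℝ) ^ 5 := by
      calc _ = 16 * C ^ 4 * (n : ℝ) ^ 6 * m ^ 5 := by ring
        _ ≤ _ := h2
    exact le_of_mul_le_mul_right h3 (by positivity)
  have hC4 : 1 ≤ C ^ 4 := one_le_pow₀ hC
  have hMpos : 0 < M := by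
    rcases hM0.eq_or_lt with h | h
    · rw [← h] at hMbig
      have : 0 < 16 * C ^ 4 * n * m ^ 5 := by positivity
      norm_num at hMbig
      linarith
    · exact h
  have hMm : M ≤ m ^ 2 := by
    rw [hM, hm, sq]
    have : epairs G S ≤ S.card * S.card := by
      rw [epairs, ← Finset.card_product]; exact Finset.card_filter_le _ _
    exact_mod_cast this
  have hm14 : 2 ^ 14 ≤ S.card := by
    by_contra hlt
    push Not at hlt
    have hmlt : m < 2 ^ 14 := by rw [hm]; exact_mod_cast hlt
    have h1 : (n : ℝ) * m ^ 5 ≤ m ^ 3 * m ^ 5 := by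
      calc (n : ℝ) * m ^ 5 ≤ 16 * C ^ 4 * n * m ^ 5 := by
            have : 0 < (n : ℝ) * m ^ 5 := by positivity
            nlinarith
        _ ≤ M ^ 4 := hMbig
        _ ≤ (m ^ 2) ^ 4 := pow_le_pow_left₀ hM0 hMm 4
        _ = _ := by ring
    have h2 : (n : ℝ) ≤ m ^ 3 := le_of_mul_le_mul_right h1 (by positivity)
    have h3 : m ^ 3 < (2 ^ 14) ^ 3 := pow_lt_pow_left₀ hmlt hm0.le (by norm_num)
    have h4 : (n : ℝ) < 2 ^ 42 := by
      refine (h2.trans_lt h3).trans_le (le_of_eq ?_)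
      rw [← pow_mul]
    have h5 : n < 2 ^ 42 := by exact_mod_cast h4
    exact absurd hn (not_le.2 h5)
  have hm14' : (2 : ℝ) ^ 14 ≤ m := by rw [hm]; exact_mod_cast hm14
  have hmn : m ≤ n := by
    rw [hm]; exact_mod_cast (Finset.card_le_univ S).trans (by simp)
  set d := M / (2 * m) with hd
  have hd0 : 0 < d := by positivity
  have hd4 : C ^ 4 * n * m ≤ d ^ 4 := by
    rw [hd, div_pow, le_div_iff₀ (by positivity)]
    calc _ = 16 * C ^ 4 * n * m ^ 5 := by ring
      _ ≤ _ := hMbig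
  have hm1 : 1 ≤ m := by linarith
  set B := S.filter (fun v => 2 ^ 14 * M < m * ((S.filter (G.Adj v)).card : ℝ)) with hB
  have hBcard : (B.card : ℝ) * 2 ^ 14 ≤ m := by
    have h1 : (B.card : ℝ) * (2 ^ 14 * M) ≤ m * M := by
      calc (B.card : ℝ) * (2 ^ 14 * M) = ∑ v ∈ B, 2 ^ 14 * M := by
            rw [Finset.sum_const, nsmul_eq_mul]
        _ ≤ ∑ v ∈ B, m * ((S.filter (G.Adj v)).card : ℝ) :=
            Finset.sum_le_sum fun v hv => (Finset.mem_filter.1 hv).2.le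
        _ ≤ ∑ v ∈ S, m * ((S.filter (G.Adj v)).card : ℝ) :=
            Finset.sum_le_sum_of_subset_of_nonneg (Finset.filter_subset _ _)
              fun _ _ _ => by positivity
        _ = m * M := by rw [← Finset.mul_sum, hM, epairs_eq]; push_cast; rfl
    rw [← mul_assoc] at h1
    exact le_of_mul_le_mul_right h1 hMpos
  obtain ⟨P, hP, hPc⟩ := Finpartition.exists_equipartition_card_eq S
    (n := 2 ^ 14) (by norm_num) hm14
  have hpart : ∀ p ∈ P.parts, (epairs G (B ∪ p) : ℝ) ≤ M / 2 ^ 15 := by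
    intro p hp
    have hpne := P.nonempty_of_mem_parts hp
    have hpc := hP.card_part_le_average_add_one hp
    rw [hPc] at hpc
    have hpc' : (p.card : ℝ) ≤ m / 2 ^ 14 + 1 := by
      calc (p.card : ℝ) ≤ ((S.card / 2 ^ 14 + 1 : ℕ) : ℝ) := by exact_mod_cast hpc
        _ ≤ _ := by
          rw [hm]; push_cast
          have := Nat.cast_div_le (α := ℝ) (m := S.card) (n := 2 ^ 14)
          push_cast at this
          linarith
    have hc : ((B ∪ p).card : ℝ) ≤ m / 2 ^ 12 := by
      have : ((B ∪ p).card : ℝ) ≤ B.card + p.card := by exact_mod_cast Finset.card_union_le _ _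
      norm_num at *
      linarith
    have h1 := hmax' (B ∪ p) (hpne.mono Finset.subset_union_right)
    have h2 : ((B ∪ p).card : ℝ) ^ 5 ≤ (m / 2 ^ 12) ^ 5 := pow_le_pow_left₀ (by positivity) hc 5
    have h3 : (epairs G (B ∪ p) : ℝ) ^ 4 * m ^ 5 ≤ (M / 2 ^ 15) ^ 4 * m ^ 5 := by
      calc _ ≤ M ^ 4 * ((B ∪ p).card : ℝ) ^ 5 := h1
        _ ≤ M ^ 4 * (m / 2 ^ 12) ^ 5 := mul_le_mul_of_nonneg_left h2 (by positivity)
        _ = _ := by ring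
    have h4 := le_of_mul_le_mul_right h3 (by positivity)
    exact le_of_pow_le_pow_left₀ (by norm_num) (by positivity) h4
  have hrem : M / 2 ≤ (epairs G (S \ B) : ℝ) := by
    have hsub : (S ×ˢ S).filter (fun p => G.Adj p.1 p.2) ⊆
        (((S \ B) ×ˢ (S \ B)).filter (fun p => G.Adj p.1 p.2)) ∪
        P.parts.biUnion (fun p => ((B ∪ p) ×ˢ (B ∪ p)).filter (fun p => G.Adj p.1 p.2)) := by
      rintro ⟨u, v⟩ huv
      simp only [Finset.mem_filter, Finset.mem_product] at huv
      obtain ⟨⟨hu, hv⟩, ha⟩ := huv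
      simp only [Finset.mem_union, Finset.mem_filter, Finset.mem_product, Finset.mem_sdiff,
        Finset.mem_biUnion]
      obtain ⟨p, hp, hup⟩ := P.exists_mem hu
      obtain ⟨q, hq, hvq⟩ := P.exists_mem hv
      by_cases huB : u ∈ B
      · exact Or.inr ⟨q, hq, ⟨Or.inl huB, Or.inr hvq⟩, ha⟩
      · by_cases hvB : v ∈ B
        · exact Or.inr ⟨p, hp, ⟨Or.inr hup, Or.inl hvB⟩, ha⟩
        · exact Or.inl ⟨⟨⟨hu, huB⟩, hv, hvB⟩, ha⟩
    have h1 : epairs G S ≤ epairs G (S \ B) + ∑ p ∈ P.parts, epairs G (B ∪ p) :=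
      (Finset.card_le_card hsub).trans ((Finset.card_union_le _ _).trans
        (Nat.add_le_add_left Finset.card_biUnion_le _))
    have h2 : M ≤ (epairs G (S \ B) : ℝ) + ∑ p ∈ P.parts, (epairs G (B ∪ p) : ℝ) := by
      rw [hM]; exact_mod_cast h1
    have h3 : ∑ p ∈ P.parts, (epairs G (B ∪ p) : ℝ) ≤ ∑ p ∈ P.parts, M / 2 ^ 15 :=
      Finset.sum_le_sum hpart
    rw [Finset.sum_const, hPc, nsmul_eq_mul] at h3
    norm_num at h3
    linarith
  have hScard : ((S \ B).card : ℝ) ≤ m := by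
    rw [hm]; exact_mod_cast Finset.card_le_card Finset.sdiff_subset
  refine ⟨S \ B, d, ?_, hd0, ?_, ?_, ?_, ?_⟩
  · by_contra hcon
    rw [Finset.not_nonempty_iff_eq_empty] at hcon
    rw [hcon] at hrem
    simp [epairs] at hrem
    linarith
  · have h1 : (C ^ 2 * m) ^ 2 ≤ (d ^ 2) ^ 2 := by
      calc (C ^ 2 * m) ^ 2 = C ^ 4 * m * m := by ring
        _ ≤ C ^ 4 * n * m := by gcongr
        _ ≤ d ^ 4 := hd4
        _ = _ := by ring
    have h2 : C ^ 2 * m ≤ d ^ 2 := le_of_pow_le_pow_left₀ (by norm_num) (by positivity) h1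
    exact (mul_le_mul_of_nonneg_left hScard (by positivity)).trans h2
  · refine le_trans ?_ hd4
    have : 1 ≤ C ^ 4 * m := by nlinarith
    nlinarith
  · intro v hv
    rw [Finset.mem_sdiff] at hv
    have h1 : ¬ (2 ^ 14 * M < m * ((S.filter (G.Adj v)).card : ℝ)) := fun h =>
      hv.2 (Finset.mem_filter.2 ⟨hv.1, h⟩)
    push Not at h1
    have h2 : (((S \ B).filter (G.Adj v)).card : ℝ) ≤ ((S.filter (G.Adj v)).card : ℝ) := by
      exact_mod_cast Finset.card_le_card (Finset.filter_subset_filter _ Finset.sdiff_subset)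
    refine h2.trans ?_
    have h3 : 2 ^ 15 * d = 2 ^ 14 * M / m := by rw [hd]; field_simp
    rw [h3, le_div_iff₀ hm0]
    linarith
  · refine le_trans ?_ hrem
    calc d * ((S \ B).card : ℝ) ≤ d * m := mul_le_mul_of_nonneg_left hScard hd0.le
      _ = M / 2 := by rw [hd]; field_simp

end regular

theorem exists_c4 {n : ℕ} (G : SimpleGraph (Fin n)) [DecidableRel G.Adj] (hn : 1 ≤ n)
    (he : 4 * (n : ℝ) ^ 3 ≤ (∑ v, (G.degree v : ℝ)) ^ 2) :
    ∃ u w v v', u ≠ w ∧ v ≠ v' ∧ G.Adj v u ∧ G.Adj v w ∧ G.Adj v' u ∧ G.Adj v' w := by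
  by_contra hcon
  push Not at hcon
  set D := ∑ v, (G.degree v : ℝ) with hD
  have hn1 : (1 : ℝ) ≤ n := by exact_mod_cast hn
  let a : Fin n → Fin n → ℝ := fun u v => if G.Adj u v then 1 else 0
  have hdeg : ∀ v, (G.degree v : ℝ) = ∑ u, a v u := by
    intro v
    simp [a, ← SimpleGraph.card_neighborFinset_eq_degree, SimpleGraph.neighborFinset_eq_filter]
  have h1 : ∑ v, (G.degree v : ℝ) ^ 2 = ∑ u, ∑ w, ∑ v, a v u * a v w := by
    calc _ = ∑ v, ∑ u, ∑ w, a v u * a v w := by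
          refine Finset.sum_congr rfl fun v _ => ?_
          rw [hdeg, sq, Finset.sum_mul_sum]
      _ = ∑ u, ∑ v, ∑ w, a v u * a v w := Finset.sum_comm
      _ = _ := Finset.sum_congr rfl fun u _ => Finset.sum_comm
  have h2 : ∀ u w, ∑ v, a v u * a v w ≤ (if u = w then (G.degree u : ℝ) else 0) + 1 := by
    intro u w
    split_ifs with h
    · subst h
      have : ∑ v, a v u * a v u = G.degree u := by
        rw [hdeg]
        refine Finset.sum_congr rfl fun v _ => ?_
        simp [a, G.adj_comm]
      linarith
    · have : ∑ v, a v u * a v w =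
          ((Finset.univ.filter (fun v => G.Adj v u ∧ G.Adj v w)).card : ℝ) := by
        rw [Finset.card_filter]
        push_cast
        refine Finset.sum_congr rfl fun v _ => ?_
        simp only [a]
        split_ifs <;> simp_all
      rw [this, zero_add]
      have : (Finset.univ.filter (fun v => G.Adj v u ∧ G.Adj v w)).card ≤ 1 := by
        rw [Finset.card_le_one]
        intro v hv v' hv'
        simp only [Finset.mem_filter, Finset.mem_univ, true_and] at hv hv'
        by_contra hne
        exact hcon u w v v' h hne hv.1 hv.2 hv'.1 hv'.2
      exact_mod_cast this
  have h3 : ∑ v, (G.degree v : ℝ) ^ 2 ≤ D + (n : ℝ) ^ 2 := by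
    rw [h1]
    calc _ ≤ ∑ u, ∑ w, ((if u = w then (G.degree u : ℝ) else 0) + 1) :=
          Finset.sum_le_sum fun u _ => Finset.sum_le_sum fun w _ => h2 u w
      _ = _ := by
        simp only [Finset.sum_add_distrib, Finset.sum_ite_eq, Finset.mem_univ, if_true]
        simp [hD]; ring
  have h4 : D ^ 2 ≤ n * ∑ v, (G.degree v : ℝ) ^ 2 := by
    have := sq_sum_le_card_mul_sum_sq (s := Finset.univ) (f := fun v => (G.degree v : ℝ))
    simpa using this
  have hD0 : 0 ≤ D := Finset.sum_nonneg fun _ _ => by positivity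
  have h5 : 2 * n ≤ D := by
    refine le_of_pow_le_pow_left₀ (n := 2) (by norm_num) hD0 (le_trans ?_ he)
    nlinarith [sq_nonneg (n : ℝ)]
  have h6 : D ^ 2 ≤ n * (D + (n : ℝ) ^ 2) := h4.trans (mul_le_mul_of_nonneg_left h3 (by positivity))
  nlinarith

theorem rich_cycle_collection (l : ℕ) (hl : 2 ≤ l) :
    ∃ n₀ : ℕ, ∀ n ≥ n₀, ∀ C : ℝ, 1 ≤ C →
      ∀ G : SimpleGraph (Fin n),
        C * (n : ℝ) ^ ((3 : ℝ) / 2) ≤ (G.edgeSet.ncard : ℝ) →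
        ∃ Cs : Set (ZMod (2 * l) → Fin n), Cs.Nonempty ∧
          (∀ c ∈ Cs, IsCycleIn G c) ∧
          ∀ c ∈ Cs, ∀ i : ZMod (2 * l),
            (1 / 2) * ((2 ^ 12 * (l : ℝ)) ^ l)⁻¹ * C ^ 2 /
                (2 ^ (2 * l) * (640 : ℝ) ^ (2 * l - 2)) ≤
              ({v | Function.update c i v ∈ Cs}.ncard : ℝ) := by
  classical
  refine ⟨2 ^ 42 + ((16 * l ^ 2 * 2 ^ 15) ^ l) ^ 4, fun n hn C hC G hG => ?_⟩
  obtain ⟨α, hαdef⟩ : ∃ α, α = (1 / 2) * ((2 ^ 12 * (l : ℝ)) ^ l)⁻¹ * C ^ 2 /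
                (2 ^ (2 * l) * (640 : ℝ) ^ (2 * l - 2)) := ⟨_, rfl⟩
  rw [← hαdef]
  have hn42 : 2 ^ 42 ≤ n := le_trans (Nat.le_add_right _ _) hn
  have hnD : ((16 * l ^ 2 * 2 ^ 15) ^ l) ^ 4 ≤ n := le_trans (Nat.le_add_left _ _) hn
  have hl0 : (0 : ℝ) < l := by exact_mod_cast (by omega : 0 < l)
  have hC0 : 0 < C := by linarith
  have hα0 : 0 ≤ α := by rw [hαdef]; positivity
  -- edges
  have hsumdeg : ∑ v, (G.degree v : ℝ) = 2 * (G.edgeSet.ncard : ℝ) := by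
    have h := G.sum_degrees_eq_twice_card_edges
    have h2 : G.edgeSet.ncard = G.edgeFinset.card := by
      rw [← SimpleGraph.coe_edgeFinset, Set.ncard_coe_finset]
    rw [h2]; exact_mod_cast h
  have hsq : C ^ 2 * (n : ℝ) ^ 3 ≤ (G.edgeSet.ncard : ℝ) ^ 2 := by
    calc C ^ 2 * (n : ℝ) ^ 3 = (C * (n : ℝ) ^ ((3 : ℝ) / 2)) ^ 2 := by
          rw [mul_pow, ← Real.rpow_natCast ((n : ℝ) ^ ((3 : ℝ) / 2)) 2,
            ← Real.rpow_mul (by positivity), ← Real.rpow_natCast (n : ℝ) 3]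
          norm_num
      _ ≤ _ := pow_le_pow_left₀ (by positivity) hG 2
  have hC2 : 1 ≤ C ^ 2 := one_le_pow₀ hC
  by_cases hcase : l = 2 ∧ C ^ 2 ≤ 2 ^ 42
  · -- one four-cycle is enough
    obtain ⟨rfl, hCs⟩ := hcase
    obtain ⟨u, w, v, v', huw, hvv, h1, h2, h3, h4⟩ := exists_c4 G (by omega) (by
      rw [hsumdeg]
      have : (n : ℝ) ^ 3 ≤ C ^ 2 * (n : ℝ) ^ 3 := le_mul_of_one_le_left (by positivity) hC2
      nlinarith)
    have hα1 : α ≤ 1 := by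
      rw [hαdef]; norm_num at hCs ⊢; linarith
    let c : ZMod (2 * 2) → Fin n := (![u, v, w, v'] : Fin 4 → Fin n)
    refine ⟨{c}, ⟨c, rfl⟩, ?_, ?_⟩
    · rintro _ rfl
      have key : Function.Injective (![u, v, w, v'] : Fin 4 → Fin n) ∧
          ∀ i : Fin 4, G.Adj ((![u, v, w, v'] : Fin 4 → Fin n) i)
            ((![u, v, w, v'] : Fin 4 → Fin n) (i + 1)) := by
        constructor
        · intro i j hij
          have e1 := h1.ne
          have e2 := h2.ne
          have e3 := h3.ne
          have e4 := h4.ne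
          fin_cases i <;> fin_cases j <;> simp_all
        · intro i
          fin_cases i
          · exact h1.symm
          · exact h2
          · exact h4.symm
          · exact h3
      exact key
    · rintro _ rfl i
      refine hα1.trans ?_
      have : 0 < {x | Function.update c i x ∈ ({c} : Set (ZMod (2 * 2) → Fin n))}.ncard := by
        rw [Set.ncard_pos (Set.toFinite _)]
        exact ⟨c i, by simp⟩
      exact_mod_cast this
  · have hep : (epairs G Finset.univ : ℝ) = 2 * (G.edgeSet.ncard : ℝ) := by
      rw [← hsumdeg, epairs_eq]
      push_cast
      refine Finset.sum_congr rfl fun v _ => ?_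
      rw [← SimpleGraph.card_neighborFinset_eq_degree, SimpleGraph.neighborFinset_eq_filter]
    obtain ⟨S, d, hSne, hd0, hdS, hdn, hSdeg, hSsum⟩ := regularize G C hC hn42 (by
      rw [hep]
      have := pow_le_pow_left₀ (by positivity) hsq 2
      calc _ = 16 * (C ^ 2 * (n : ℝ) ^ 3) ^ 2 := by ring
        _ ≤ 16 * ((G.edgeSet.ncard : ℝ) ^ 2) ^ 2 := by linarith
        _ = _ := by ring)
    let H : SimpleGraph {x // x ∈ S} := G.comap Subtype.val
    have hne : Nonempty {x // x ∈ S} := hSne.coe_sort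
    have hcard : Fintype.card {x // x ∈ S} = S.card := Fintype.card_coe S
    have hHdeg : ∀ v : {x // x ∈ S}, H.degree v = (S.filter (G.Adj v.1)).card := by
      intro v
      rw [← SimpleGraph.card_neighborFinset_eq_degree, SimpleGraph.neighborFinset_eq_filter,
        Finset.card_filter, Finset.card_filter,
        ← Finset.sum_coe_sort S (fun x => if G.Adj v.1 x then 1 else 0)]
      rfl
    have hdm : (S.card : ℝ) ≤ d ^ 2 := by
      refine le_trans ?_ hdS
      exact le_mul_of_one_le_left (by positivity) hC2
    have hbig : (S.card : ℝ) * (16 * (l : ℝ) ^ 2 * 2 ^ 15) ^ l ≤ d ^ l := by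
      by_cases hl2 : l = 2
      · subst hl2
        have hCs : (2 : ℝ) ^ 42 ≤ C ^ 2 := by
          by_contra h
          exact hcase ⟨rfl, (not_le.1 h).le⟩
        calc (S.card : ℝ) * (16 * ((2 : ℕ) : ℝ) ^ 2 * 2 ^ 15) ^ 2 = 2 ^ 42 * S.card := by
              push_cast; ring
          _ ≤ C ^ 2 * S.card := mul_le_mul_of_nonneg_right hCs (by positivity)
          _ ≤ _ := hdS
      · have hD : ((16 * (l : ℝ) ^ 2 * 2 ^ 15) ^ l) ≤ d := by
          refine le_of_pow_le_pow_left₀ (n := 4) (by norm_num) hd0.le (le_trans ?_ hdn)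
          exact_mod_cast hnD
        have hd1 : 1 ≤ d := by
          refine le_trans ?_ hD
          refine one_le_pow₀ ?_
          have : (2 : ℝ) ≤ l := by exact_mod_cast hl
          nlinarith
        calc _ ≤ d ^ 2 * d := mul_le_mul hdm hD (by positivity) (by positivity)
          _ = d ^ 3 := by ring
          _ ≤ d ^ l := pow_le_pow_right₀ hd1 (by omega)
    have hα : α * (2 * l * (S.card * (2 ^ 15 * d) ^ (2 * l - 2))) < d ^ (2 * l) / 2 := by
      have hS0 : (0 : ℝ) < S.card := by exact_mod_cast hSne.card_pos
      have h1 : α * (4 * l * (2 ^ 15) ^ (2 * l - 2)) < C ^ 2 := by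
        have hK : ((2 : ℝ) ^ 15) ^ (2 * l - 2) ≤ 640 ^ (2 * l - 2) * 2 ^ (12 * l) := by
          calc ((2 : ℝ) ^ 15) ^ (2 * l - 2) ≤ (640 * 64) ^ (2 * l - 2) :=
                pow_le_pow_left₀ (by norm_num) (by norm_num) _
            _ = 640 ^ (2 * l - 2) * 64 ^ (2 * l - 2) := mul_pow _ _ _
            _ ≤ 640 ^ (2 * l - 2) * 64 ^ (2 * l) := by
                refine mul_le_mul_of_nonneg_left ?_ (by positivity)
                exact pow_le_pow_right₀ (by norm_num) (by omega)
            _ = _ := by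
                rw [show (64 : ℝ) = 2 ^ 6 by norm_num, ← pow_mul]; congr 2; ring
        have hll : (l : ℝ) ≤ (l : ℝ) ^ l := by
          refine le_self_pow₀ ?_ (by omega)
          exact_mod_cast (by omega : 1 ≤ l)
        have h4l : (16 : ℝ) ≤ 2 ^ (2 * l) := by
          calc (16 : ℝ) = 2 ^ 4 := by norm_num
            _ ≤ _ := pow_le_pow_right₀ (by norm_num) (by omega)
        have hα2 : α * (2 * (2 ^ (12 * l) * (l : ℝ) ^ l) * (2 ^ (2 * l) * 640 ^ (2 * l - 2))) =
            C ^ 2 := by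
          rw [hαdef, mul_pow, ← pow_mul]
          field_simp
        rw [← hα2]
        have hαpos : 0 < α := by rw [hαdef]; positivity
        refine mul_lt_mul_of_pos_left ?_ hαpos
        have hX : (0 : ℝ) < 640 ^ (2 * l - 2) * 2 ^ (12 * l) := by positivity
        calc 4 * (l : ℝ) * (2 ^ 15) ^ (2 * l - 2) ≤
              4 * l * (640 ^ (2 * l - 2) * 2 ^ (12 * l)) := by gcongr
          _ < 2 * (l * 16) * (640 ^ (2 * l - 2) * 2 ^ (12 * l)) := by
              refine mul_lt_mul_of_pos_right ?_ hX
              linarith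
          _ ≤ 2 * ((l : ℝ) ^ l * 2 ^ (2 * l)) * (640 ^ (2 * l - 2) * 2 ^ (12 * l)) := by gcongr
          _ = _ := by ring
      have hdd : d ^ (2 * l) = d ^ (2 * l - 2) * d ^ 2 := by
        rw [← pow_add]; congr 1; omega
      have hY : 0 < (S.card : ℝ) * d ^ (2 * l - 2) := by positivity
      calc _ = α * (4 * l * (2 ^ 15) ^ (2 * l - 2)) * (S.card * d ^ (2 * l - 2)) / 2 := by
            rw [mul_pow]; ring
        _ < C ^ 2 * (S.card * d ^ (2 * l - 2)) / 2 := by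
            exact div_lt_div_of_pos_right (mul_lt_mul_of_pos_right h1 hY) two_pos
        _ = d ^ (2 * l - 2) * (C ^ 2 * S.card) / 2 := by ring
        _ ≤ d ^ (2 * l - 2) * d ^ 2 / 2 := by gcongr
        _ = _ := by rw [hdd]
    obtain ⟨Cs, hCsne, hcyc, hrich⟩ := core H l hl (2 ^ 15) d α (by norm_num) hd0 hα0
      (fun v => by rw [hHdeg]; exact hSdeg v.1 v.2)
      (by
        rw [hcard]
        refine hSsum.trans (le_of_eq ?_)
        rw [epairs_eq]
        simp_rw [hHdeg]
        push_cast
        exact (Finset.sum_coe_sort S (fun v => ((S.filter (G.Adj v)).card : ℝ))).symm)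
      (by rw [hcard]; exact hbig) (by rw [hcard]; exact hα)
    refine ⟨(fun c => Subtype.val ∘ c) '' Cs, hCsne.image _, ?_, ?_⟩
    · rintro _ ⟨c, hc, rfl⟩
      exact ⟨Subtype.val_injective.comp (hcyc c hc).1, fun i => (hcyc c hc).2 i⟩
    · rintro _ ⟨c, hc, rfl⟩ i
      refine (hrich c hc i).trans ?_
      norm_cast
      refine Set.ncard_le_ncard_of_injOn Subtype.val ?_ Subtype.val_injective.injOn (Set.toFinite _)
      intro x hx
      exact ⟨Function.update c i x, hx, Function.comp_update _ _ _ _⟩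
end

section
/- Let k ≥ 2 and ℓ ≥ 2 be integers with k even, let G be an n-vertex bipartite graph, and let 𝒞 be a non-empty α-rich collection of 2ℓ-cycles in G with α/ℓ² > 2^{20}(k/2)³(ℓ log n)⁴ n^{2ℓ/k}. Then G contains the torus quadrangulation T_{k,ℓ} as a subgraph. -/
open SimpleGraph

/-- `F` has an (injective) copy in `G`. -/
def Contains {W V : Type*} (F : SimpleGraph W) (G : SimpleGraph V) : Prop :=
  ∃ f : W → V, Function.Injective f ∧ ∀ a b, F.Adj a b → G.Adj (f a) (f b)

/-- The quadrangulation `T_{k,ℓ}` of the torus (rows modulo `k`, columns modulo `ℓ`,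
`k` even): row `i` is joined to row `i+1` vertically, and diagonally according to the
parity of `i`. -/
def torusGraph (k l : ℕ) : SimpleGraph (Fin k × ZMod l) :=
  SimpleGraph.fromRel (fun a b => (a.1.val + 1) % k = b.1.val ∧
    (a.2 = b.2 ∨ (Even a.1.val ∧ a.2 = b.2 + 1) ∨ (Odd a.1.val ∧ b.2 = a.2 + 1)))

section TorusAux
open Finset
set_option linter.unusedSectionVars false

variable {V : Type*} [Fintype V] [DecidableEq V]

/-- Weight of an open walk. -/
def tpw (S : Matrix V V ℝ) {r : ℕ} (p : Fin (r + 1) → V) : ℝ :=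
  ∏ i : Fin r, S (p i.castSucc) (p i.succ)

theorem tpw_cons (S : Matrix V V ℝ) {r : ℕ} (a : V) (p : Fin (r + 1) → V) :
    tpw S (Fin.cons a p : Fin (r + 1 + 1) → V) = S a (p 0) * tpw S p := by
  unfold tpw
  rw [Fin.prod_univ_succ]
  simp [Fin.castSucc_zero]

theorem tpw_nonneg (S : Matrix V V ℝ) (hS : ∀ x y, 0 ≤ S x y) {r : ℕ} (p : Fin (r + 1) → V) :
    0 ≤ tpw S p := Finset.prod_nonneg fun _ _ => hS _ _

theorem pow_nonneg_entry (S : Matrix V V ℝ) (hS : ∀ x y, 0 ≤ S x y) (r : ℕ) :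
    ∀ x y, 0 ≤ (S ^ r) x y := by
  induction r with
  | zero => intro x y; rw [pow_zero, Matrix.one_apply]; split_ifs <;> norm_num
  | succ r ih =>
    intro x y
    rw [pow_succ, Matrix.mul_apply]
    exact Finset.sum_nonneg fun z _ => mul_nonneg (ih _ _) (hS _ _)

theorem sum_tpw (S : Matrix V V ℝ) (r : ℕ) : ∀ F : V → V → ℝ,
    ∑ p : Fin (r + 1) → V, tpw S p * F (p 0) (p (Fin.last r)) =
      ∑ x, ∑ y, (S ^ r) x y * F x y := by
  induction r with
  | zero =>
    intro F
    rw [← (Equiv.funUnique (Fin 1) V).symm.sum_comp]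
    simp [tpw, Matrix.one_apply]
  | succ r ih =>
    intro F
    rw [← (Fin.consEquiv (fun _ : Fin (r + 1 + 1) => V)).sum_comp, Fintype.sum_prod_type]
    refine Finset.sum_congr rfl fun a _ => ?_
    have := ih (fun x y => S a x * F a y)
    simp only [Fin.consEquiv, Equiv.coe_fn_mk, tpw_cons, Fin.cons_zero]
    rw [pow_succ']
    simp only [Matrix.mul_apply, Finset.sum_mul]
    rw [Finset.sum_comm]
    refine Eq.trans ?_ (this.trans ?_)
    · refine Finset.sum_congr rfl fun p _ => ?_
      rw [← Fin.succ_last, Fin.cons_succ]; ring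
    · refine Finset.sum_congr rfl fun p _ => Finset.sum_congr rfl fun q _ => ?_
      ring

theorem tpw_le (S : Matrix V V ℝ) (hS : ∀ x y, 0 ≤ S x y) {r : ℕ} (p : Fin (r + 1) → V) :
    tpw S p ≤ (S ^ r) (p 0) (p (Fin.last r)) := by
  have h := sum_tpw S r (fun x y => if x = p 0 ∧ y = p (Fin.last r) then 1 else 0)
  have h2 : ∑ x, ∑ y, (S ^ r) x y * (if x = p 0 ∧ y = p (Fin.last r) then (1:ℝ) else 0)
      = (S ^ r) (p 0) (p (Fin.last r)) := by
    rw [Finset.sum_eq_single (p 0), Finset.sum_eq_single (p (Fin.last r))]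
    · simp
    · intro b _ hb; simp [hb]
    · simp
    · intro b _ hb; simp [hb]
    · simp
  rw [← h2, ← h]
  have := Finset.single_le_sum (s := Finset.univ)
    (f := fun q : Fin (r + 1) → V => tpw S q *
      (if q 0 = p 0 ∧ q (Fin.last r) = p (Fin.last r) then (1:ℝ) else 0))
    (fun q _ => mul_nonneg (tpw_nonneg S hS q) (by split_ifs <;> norm_num))
    (Finset.mem_univ p)
  simpa using this

/-- squared Frobenius norm of the `r`-th power -/
def thh (S : Matrix V V ℝ) (r : ℕ) : ℝ := ∑ x, ∑ y, ((S ^ r) x y) ^ 2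

theorem thh_nonneg (S : Matrix V V ℝ) (r : ℕ) : 0 ≤ thh S r :=
  Finset.sum_nonneg fun _ _ => Finset.sum_nonneg fun _ _ => sq_nonneg _

theorem pow_symm_entry (S : Matrix V V ℝ) (hsym : ∀ x y, S x y = S y x) (r : ℕ) (x y : V) :
    (S ^ r) x y = (S ^ r) y x := by
  have h : S.transpose = S := by ext x y; exact hsym y x
  have h2 : (S ^ r).transpose = S ^ r := by rw [Matrix.transpose_pow, h]
  exact (congrFun (congrFun h2 y) x)

theorem thh_eq (S : Matrix V V ℝ) (hsym : ∀ x y, S x y = S y x) (a b r : ℕ)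
    (hab : a + b = r + r) : thh S r = ∑ x, ∑ y, (S ^ a) x y * (S ^ b) x y := by
  have key : ∀ c d : ℕ, ∑ x, ∑ y, (S ^ c) x y * (S ^ d) x y = Matrix.trace (S ^ (c + d)) := by
    intro c d
    rw [pow_add, Matrix.trace]
    refine Finset.sum_congr rfl fun x _ => ?_
    rw [Matrix.diag_apply, Matrix.mul_apply]
    exact Finset.sum_congr rfl fun y _ => by rw [pow_symm_entry S hsym d x y]
  rw [key, hab, ← key]
  unfold thh
  simp only [sq]

theorem thh_log_convex (S : Matrix V V ℝ) (hsym : ∀ x y, S x y = S y x) (r : ℕ) :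
    thh S (r + 1) ^ 2 ≤ thh S r * thh S (r + 2) := by
  rw [thh_eq S hsym r (r + 2) (r + 1) (by ring)]
  unfold thh
  simp only [← Fintype.sum_prod_type']
  exact Finset.sum_mul_sq_le_sq_mul_sq _ _ _

theorem thh_zero (S : Matrix V V ℝ) : thh S 0 = Fintype.card V := by
  simp [thh, Matrix.one_apply]

theorem thh_ge_one (S : Matrix V V ℝ) (e : V → ℝ) (he : ∃ x, e x ≠ 0)
    (hS : ∀ x, ∑ y, S x y * e y = e x) (r : ℕ) : 1 ≤ thh S r := by
  have hr : ∀ r : ℕ, ∀ x, ∑ y, (S ^ r) x y * e y = e x := by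
    intro r
    induction r with
    | zero => intro x; simp [Matrix.one_apply]
    | succ r ih =>
      intro x
      rw [pow_succ']
      simp only [Matrix.mul_apply, Finset.sum_mul]
      rw [Finset.sum_comm]
      simp only [mul_assoc, ← Finset.mul_sum, ih, hS]
  set D : ℝ := ∑ x, e x ^ 2 with hD
  have hDpos : 0 < D := by
    obtain ⟨x, hx⟩ := he
    exact Finset.sum_pos' (fun _ _ => sq_nonneg _) ⟨x, Finset.mem_univ _, by positivity⟩
  have h1 : D = ∑ z : V × V, (S ^ r) z.1 z.2 * (e z.1 * e z.2) := by
    rw [Fintype.sum_prod_type, hD]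
    refine Finset.sum_congr rfl fun x _ => ?_
    calc e x ^ 2 = e x * ∑ y, (S ^ r) x y * e y := by rw [hr]; ring
      _ = _ := by rw [Finset.mul_sum]; exact Finset.sum_congr rfl fun y _ => by ring
  have h2 := Finset.sum_mul_sq_le_sq_mul_sq (Finset.univ : Finset (V × V))
    (fun z => (S ^ r) z.1 z.2) (fun z => e z.1 * e z.2)
  rw [← h1] at h2
  have h3 : ∑ z : V × V, (e z.1 * e z.2) ^ 2 = D * D := by
    rw [Fintype.sum_prod_type, hD, Finset.sum_mul_sum]
    simp only [mul_pow]
  have h4 : ∑ z : V × V, ((S ^ r) z.1 z.2) ^ 2 = thh S r := by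
    rw [Fintype.sum_prod_type]; rfl
  rw [h3, h4] at h2
  have : 0 < D * D := by positivity
  nlinarith

theorem thh_ratio (S : Matrix V V ℝ) (hsym : ∀ x y, S x y = S y x)
    (h1 : ∀ r, 1 ≤ thh S r) (r : ℕ) :
    thh S r ^ (r + 1) ≤ Fintype.card V * thh S (r + 1) ^ r := by
  induction r with
  | zero => simp [thh_zero]
  | succ r ih =>
    have a := h1 r; have b := h1 (r + 1); have c := h1 (r + 2)
    have hl := thh_log_convex S hsym r
    set A := thh S r
    set B := thh S (r + 1)
    set C := thh S (r + 2)
    have hp : (B ^ 2) ^ (r + 1) ≤ (A * C) ^ (r + 1) := pow_le_pow_left₀ (by positivity) hl _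
    have : B ^ r * B ^ (r + 2) ≤ B ^ r * (Fintype.card V * C ^ (r + 1)) := by
      calc B ^ r * B ^ (r + 2) = (B ^ 2) ^ (r + 1) := by ring
        _ ≤ A ^ (r + 1) * C ^ (r + 1) := by rw [← mul_pow]; exact hp
        _ ≤ (Fintype.card V * B ^ r) * C ^ (r + 1) := by gcongr
        _ = _ := by ring
    exact le_of_mul_le_mul_left this (by positivity)

/-- The key Cauchy–Schwarz bound. -/
theorem bad_bound (S : Matrix V V ℝ) (hS : ∀ x y, 0 ≤ S x y)
    (s : V → ℝ) (hs : ∀ x, 0 < s x) (r : ℕ) (B : ℝ)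
    (χ : (Fin (r + 1) → V) → V → ℝ) (hχ0 : ∀ p x, 0 ≤ χ p x) (hχ1 : ∀ p x, χ p x ≤ 1)
    (h1 : ∀ p, ∑ x, χ p x * S x (p 0) * s x ≤ B * s (p 0))
    (h2 : ∀ x, ∑ y, S x y * s y ≤ s x) :
    (∑ p : Fin (r + 1) → V, ∑ x, tpw S p * S x (p 0) * (S ^ (r + 1)) (p (Fin.last r)) x * χ p x) ^ 2
      ≤ (B * thh S r) * thh S (r + 1) := by
  rw [← Fintype.sum_prod_type']
  set f : V → V → ℝ := fun x z => (S ^ (r + 1)) z x with hf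
  set g : V → V → ℝ := fun a z => (S ^ r) a z with hg
  have hg0 : ∀ a z, 0 ≤ g a z := pow_nonneg_entry S hS r
  have hpw := fun p : Fin (r + 1) → V => tpw_nonneg S hS p
  refine (Finset.sum_sq_le_sum_mul_sum_of_sq_le_mul Finset.univ
    (f := fun q : (Fin (r + 1) → V) × V => tpw S q.1 * g (q.1 0) (q.1 (Fin.last r)) / s (q.1 0) *
      (χ q.1 q.2 * S q.2 (q.1 0) * s q.2))
    (g := fun q : (Fin (r + 1) → V) × V => tpw S q.1 * (1 / g (q.1 0) (q.1 (Fin.last r)) *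
      (f q.2 (q.1 (Fin.last r)) ^ 2 * (S q.2 (q.1 0) * s (q.1 0) / s q.2)))) ?_ ?_ ?_).trans ?_
  · rintro ⟨p, x⟩ _
    have := hs (p 0); have := hs x; have := hpw p; have := hg0 (p 0) (p (Fin.last r))
    have := hχ0 p x; have := hS x (p 0)
    dsimp only; positivity
  · rintro ⟨p, x⟩ _
    have := hs (p 0); have := hs x; have := hpw p; have := hg0 (p 0) (p (Fin.last r))
    have := hχ0 p x; have := hS x (p 0)
    dsimp only; positivity
  · rintro ⟨p, x⟩ _
    have i1 := hs (p 0); have i2 := hs x; have i3 := hpw p; have i4 := hg0 (p 0) (p (Fin.last r))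
    have i5 := hχ0 p x; have i6 := hS x (p 0); have i7 := hχ1 p x
    have i8 : tpw S p ≤ g (p 0) (p (Fin.last r)) := tpw_le S hS p
    dsimp only
    rcases eq_or_lt_of_le i4 with h | h
    · have : tpw S p = 0 := le_antisymm (h ▸ i8) i3
      simp [this]
    · have e : tpw S p * g (p 0) (p (Fin.last r)) / s (p 0) *
          (χ p x * S x (p 0) * s x) * (tpw S p * (1 / g (p 0) (p (Fin.last r)) *
      (f x (p (Fin.last r)) ^ 2 * (S x (p 0) * s (p 0) / s x)))) =
        (tpw S p * S x (p 0) * f x (p (Fin.last r))) ^ 2 * χ p x := by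
        field_simp
      rw [e]
      rw [mul_pow]
      gcongr
      nlinarith
  · have hB : ∑ q : (Fin (r + 1) → V) × V, tpw S q.1 * g (q.1 0) (q.1 (Fin.last r)) / s (q.1 0) *
      (χ q.1 q.2 * S q.2 (q.1 0) * s q.2) ≤ B * thh S r := by
      rw [Fintype.sum_prod_type]
      calc _ ≤ ∑ p : Fin (r + 1) → V, tpw S p * (fun a z => B * g a z) (p 0) (p (Fin.last r)) := by
            refine Finset.sum_le_sum fun p _ => ?_
            dsimp only
            rw [← Finset.mul_sum]
            have i1 := hs (p 0); have i3 := hpw p; have i4 := hg0 (p 0) (p (Fin.last r))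
            calc _ ≤ tpw S p * g (p 0) (p (Fin.last r)) / s (p 0) * (B * s (p 0)) := by
                  gcongr; exact h1 p
              _ = _ := by field_simp
        _ = B * thh S r := by
            rw [sum_tpw S r (fun a z => B * g a z), thh, Finset.mul_sum]
            refine Finset.sum_congr rfl fun x _ => ?_
            rw [Finset.mul_sum]
            exact Finset.sum_congr rfl fun y _ => by simp only [hg]; ring
    have hG : ∑ q : (Fin (r + 1) → V) × V, tpw S q.1 * (1 / g (q.1 0) (q.1 (Fin.last r)) *
      (f q.2 (q.1 (Fin.last r)) ^ 2 * (S q.2 (q.1 0) * s (q.1 0) / s q.2))) ≤ thh S (r + 1) := by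
      rw [Fintype.sum_prod_type]
      simp only [← Finset.mul_sum]
      have := sum_tpw S r (fun a z => 1 / g a z * ∑ x, (f x z ^ 2 * (S x a * s a / s x)))
      rw [this]
      calc _ ≤ ∑ a, ∑ z, ∑ x, (f x z ^ 2 * (S x a * s a / s x)) := by
            refine Finset.sum_le_sum fun a _ => Finset.sum_le_sum fun z _ => ?_
            have nn : 0 ≤ ∑ x, (f x z ^ 2 * (S x a * s a / s x)) :=
              Finset.sum_nonneg fun x _ => by
                have := hs a; have := hs x; have := hS x a
                positivity
            rw [← mul_assoc]
            refine mul_le_of_le_one_left nn ?_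
            rw [mul_one_div]
            exact div_self_le_one _
        _ = ∑ z, ∑ x, f x z ^ 2 * ((∑ a, S x a * s a) / s x) := by
            rw [Finset.sum_comm]
            refine Finset.sum_congr rfl fun z _ => ?_
            rw [Finset.sum_comm]
            refine Finset.sum_congr rfl fun x _ => ?_
            rw [Finset.sum_div, Finset.mul_sum]
        _ ≤ ∑ z, ∑ x, f x z ^ 2 := by
            refine Finset.sum_le_sum fun z _ => Finset.sum_le_sum fun x _ => ?_
            refine mul_le_of_le_one_right (sq_nonneg _) ?_
            rw [div_le_one (hs x)]
            exact h2 x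
        _ = thh S (r + 1) := rfl
    refine mul_le_mul hB hG ?_ (le_trans ?_ hB)
    all_goals
      refine Finset.sum_nonneg ?_
      rintro ⟨p, x⟩ _
      have := hs (p 0); have := hs x; have := hpw p; have := hg0 (p 0) (p (Fin.last r))
      have := hχ0 p x; have := hS x (p 0)
      dsimp only; positivity

/-- Weight of a closed walk. -/
def tcw (S : Matrix V V ℝ) {r : ℕ} (x : Fin (r + 1 + (r + 1)) → V) : ℝ :=
  ∏ i, S (x i) (x (i + 1))

theorem fin_castAdd_castSucc_add (r : ℕ) (i : Fin r) :
    (Fin.castAdd (r + 1) i.castSucc : Fin (r + 1 + (r + 1))) + 1 = Fin.castAdd (r + 1) i.succ := by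
  apply Fin.ext
  rw [Fin.val_add_one_of_lt']
  · simp
  · simp; omega

theorem fin_natAdd_castSucc_add (r : ℕ) (i : Fin r) :
    (Fin.natAdd (r + 1) i.castSucc : Fin (r + 1 + (r + 1))) + 1 = Fin.natAdd (r + 1) i.succ := by
  apply Fin.ext
  rw [Fin.val_add_one_of_lt']
  · simp; omega
  · simp; omega

theorem fin_castAdd_last_add (r : ℕ) :
    (Fin.castAdd (r + 1) (Fin.last r) : Fin (r + 1 + (r + 1))) + 1 = Fin.natAdd (r + 1) 0 := by
  apply Fin.ext
  rw [Fin.val_add_one_of_lt']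
  · simp
  · simp

theorem fin_natAdd_last_add (r : ℕ) :
    (Fin.natAdd (r + 1) (Fin.last r) : Fin (r + 1 + (r + 1))) + 1 = Fin.castAdd (r + 1) 0 := by
  apply Fin.ext
  simp

theorem tcw_append (S : Matrix V V ℝ) {r : ℕ} (p q : Fin (r + 1) → V) :
    tcw S (Fin.append p q) =
      tpw S p * S (p (Fin.last r)) (q 0) * (tpw S q * S (q (Fin.last r)) (p 0)) := by
  unfold tcw tpw
  rw [Fin.prod_univ_add, Fin.prod_univ_castSucc, Fin.prod_univ_castSucc]
  simp only [fin_castAdd_castSucc_add, fin_natAdd_castSucc_add, fin_castAdd_last_add,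
    fin_natAdd_last_add, Fin.append_left, Fin.append_right]

theorem sum_tcw (S : Matrix V V ℝ) {r : ℕ} (Φ : (Fin (r + 1) → V) → V → ℝ) :
    ∑ x : Fin (r + 1 + (r + 1)) → V, tcw S x *
        Φ (fun i => x (Fin.castAdd (r + 1) i)) (x (Fin.natAdd (r + 1) (Fin.last r))) =
      ∑ p : Fin (r + 1) → V, ∑ x,
        tpw S p * S x (p 0) * (S ^ (r + 1)) (p (Fin.last r)) x * Φ p x := by
  rw [← (Fin.appendEquiv (r + 1) (r + 1)).sum_comp, Fintype.sum_prod_type]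
  refine Finset.sum_congr rfl fun p _ => ?_
  simp only [Fin.appendEquiv, Equiv.coe_fn_mk, Fin.append_left, Fin.append_right, tcw_append]
  have := sum_tpw S r (fun u v => tpw S p * S (p (Fin.last r)) u * S v (p 0) * Φ p v)
  refine Eq.trans ?_ (this.trans ?_)
  · exact Finset.sum_congr rfl fun q _ => by ring
  · rw [Finset.sum_comm]
    refine Finset.sum_congr rfl fun x _ => ?_
    rw [pow_succ', Matrix.mul_apply, Finset.mul_sum, Finset.sum_mul]
    exact Finset.sum_congr rfl fun q _ => by ring

theorem sum_tcw_total (S : Matrix V V ℝ) (hsym : ∀ x y, S x y = S y x) (r : ℕ) :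
    ∑ x : Fin (r + 1 + (r + 1)) → V, tcw S x = thh S (r + 1) := by
  have := sum_tcw S (r := r) (fun _ _ => 1)
  simp only [mul_one] at this
  rw [this]
  have h := sum_tpw S r (fun a z => ∑ x, S x a * (S ^ (r + 1)) z x)
  simp only [mul_assoc, ← Finset.mul_sum]
  rw [h, thh]
  simp only [Finset.mul_sum]
  rw [Finset.sum_comm, ]
  refine Finset.sum_congr rfl fun z _ => ?_
  rw [Finset.sum_comm]
  refine Finset.sum_congr rfl fun x _ => ?_
  rw [sq]
  nth_rw 2 [pow_symm_entry S hsym (r + 1) z x]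
  have e1 : (S ^ (r + 1)) x z = ∑ a, S x a * (S ^ r) a z := by
    rw [pow_succ', Matrix.mul_apply]
  rw [e1, Finset.sum_mul]
  refine Finset.sum_congr rfl fun a _ => ?_
  ring

theorem tcw_shift (S : Matrix V V ℝ) {r : ℕ} (x : Fin (r + 1 + (r + 1)) → V)
    (a : Fin (r + 1 + (r + 1))) : tcw S (fun i => x (i + a)) = tcw S x := by
  unfold tcw
  rw [← Equiv.prod_comp (Equiv.addRight a) (fun i => S (x i) (x (i + 1)))]
  refine Finset.prod_congr rfl fun i _ => ?_
  simp only [Equiv.coe_addRight]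
  rw [add_right_comm i a 1]

theorem fin_dist_aux (r : ℕ) (i j : Fin (r + 1 + (r + 1))) (hij : i ≠ j)
    (h : ¬ (j - i - 1).val < r + 1) : (i - j - 1).val < r + 1 := by
  have hs : (j - i - 1) + 1 + ((i - j - 1) + 1) = 0 := by abel
  have hne : j - i - 1 + 1 ≠ 0 := by
    rw [sub_add_cancel, sub_ne_zero]; exact hij.symm
  generalize j - i - 1 = t at *
  generalize i - j - 1 = u at *
  have ht := t.2
  have hu := u.2
  have h1 : t.val + 1 < r + 1 + (r + 1) := by
    by_contra hc
    apply hne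
    apply Fin.ext
    have : t.val + 1 = r + 1 + (r + 1) := by omega
    simp [Fin.val_add, this]
  have h2 := congrArg Fin.val hs
  have h3 : (t.val + 1 + (u.val + 1)) % (r + 1 + (r + 1)) = 0 := by
    simpa [Fin.val_add] using h2
  obtain ⟨c, hc⟩ := Nat.dvd_of_mod_eq_zero h3
  have : c < 2 := by
    by_contra hc2
    have : (r + 1 + (r + 1)) * 2 ≤ (r + 1 + (r + 1)) * c := Nat.mul_le_mul_left _ (by omega)
    omega
  interval_cases c <;> omega

open Classical in
/-- Conflict-free cycle lemma, abstract weighted form. -/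
theorem conflict_free_abstract (S : Matrix V V ℝ) (hS : ∀ x y, 0 ≤ S x y)
    (hsym : ∀ x y, S x y = S y x)
    (s : V → ℝ) (hs : ∀ x, 0 < s x) (r : ℕ) (β : ℝ) (hβ : 0 ≤ β) (R : V → V → Prop)
    (hR : ∀ x y, R x y → R y x)
    (h1 : ∀ u v, ∑ x, (if R x u then 1 else 0) * S x v * s x ≤ β * s v)
    (h2 : ∀ x, ∑ y, S x y * s y ≤ s x)
    (e : V → ℝ) (he : ∃ x, e x ≠ 0) (hSe : ∀ x, ∑ y, S x y * e y = e x)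
    (hN : (4 * (r + 1 : ℝ) ^ 3 * β) ^ (r + 1) * Fintype.card V < 1) :
    ∃ x : Fin (r + 1 + (r + 1)) → V, (∀ i, 0 < S (x i) (x (i + 1))) ∧
      ∀ i j, i ≠ j → ¬ R (x i) (x j) := by
  set χ : (Fin (r + 1) → V) → V → ℝ := fun p x => if ∃ i, R x (p i) then 1 else 0 with hχ
  have hb := bad_bound S hS s hs r ((r + 1) * β) χ
    (fun p x => by simp only [hχ]; split_ifs <;> norm_num)
    (fun p x => by simp only [hχ]; split_ifs <;> norm_num)
    (by
      intro p
      calc _ ≤ ∑ x, ∑ i : Fin (r + 1), (if R x (p i) then 1 else 0) * S x (p 0) * s x := by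
            refine Finset.sum_le_sum fun x _ => ?_
            rw [← Finset.sum_mul, ← Finset.sum_mul]
            have := hS x (p 0); have := hs x
            gcongr
            simp only [hχ]
            split_ifs with h
            · obtain ⟨i, hi⟩ := h
              have := Finset.single_le_sum (s := Finset.univ)
                (f := fun i => if R x (p i) then (1:ℝ) else 0)
                (fun i _ => by split_ifs <;> norm_num) (Finset.mem_univ i)
              simpa [hi] using this
            · exact Finset.sum_nonneg fun i _ => by split_ifs <;> norm_num
        _ ≤ ∑ i : Fin (r + 1), β * s (p 0) := by
            rw [Finset.sum_comm]
            exact Finset.sum_le_sum fun i _ => h1 _ _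
        _ = _ := by simp; ring) h2
  rw [← sum_tcw] at hb
  have hge := thh_ge_one S e he hSe
  have hrat := thh_ratio S hsym hge r
  have hA := hge r
  have hB := hge (r + 1)
  have htot := sum_tcw_total S hsym r
  set A := thh S r
  set B := thh S (r + 1)
  set bad := ∑ x : Fin (r + 1 + (r + 1)) → V, tcw S x *
        χ (fun i => x (Fin.castAdd (r + 1) i)) (x (Fin.natAdd (r + 1) (Fin.last r))) with hbad
  have hcw : ∀ x : Fin (r + 1 + (r + 1)) → V, 0 ≤ tcw S x := fun x =>
    Finset.prod_nonneg fun _ _ => hS _ _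
  have hsmall : 4 * (r + 1 : ℝ) ^ 3 * β * A < B := by
    by_contra hcon
    push Not at hcon
    have h3 : B ^ (r + 1) ≤ (4 * (r + 1 : ℝ) ^ 3 * β) ^ (r + 1) * A ^ (r + 1) := by
      rw [← mul_pow]; exact pow_le_pow_left₀ (by positivity) hcon _
    have h4 : B ^ (r + 1) ≤ ((4 * (r + 1 : ℝ) ^ 3 * β) ^ (r + 1) * Fintype.card V) * B ^ r := by
      calc _ ≤ _ := h3
        _ ≤ (4 * (r + 1 : ℝ) ^ 3 * β) ^ (r + 1) * (Fintype.card V * B ^ r) := by gcongr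
        _ = _ := by ring
    have h5 : ((4 * (r + 1 : ℝ) ^ 3 * β) ^ (r + 1) * Fintype.card V) * B ^ r < 1 * B ^ r := by
      have : 0 < B ^ r := by positivity
      gcongr
    have h6 : B ^ r ≤ B ^ (r + 1) := pow_le_pow_right₀ hB (Nat.le_succ r)
    linarith
  have hbadlt : (2 * (r + 1 : ℝ)) * bad < B := by
    refine lt_of_pow_lt_pow_left₀ 2 (by linarith) ?_
    calc ((2 * (r + 1 : ℝ)) * bad) ^ 2 = 4 * (r + 1) ^ 2 * bad ^ 2 := by ring
      _ ≤ 4 * (r + 1) ^ 2 * ((r + 1) * β * A * B) := by gcongr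
      _ = (4 * (r + 1 : ℝ) ^ 3 * β * A) * B := by ring
      _ < B * B := by gcongr
      _ = B ^ 2 := by ring
  by_contra hno
  push Not at hno
  -- bad event at a general position
  set K := r + 1 + (r + 1) with hK
  let E : Fin K → (Fin K → V) → ℝ := fun a x =>
    χ (fun i => x (Fin.castAdd (r + 1) i + a)) (x (Fin.natAdd (r + 1) (Fin.last r) + a))
  have hEsum : ∀ a, ∑ x : Fin K → V, tcw S x * E a x = bad := by
    intro a
    symm
    rw [hbad, ← (Equiv.arrowCongr (Equiv.addRight (-a)) (Equiv.refl V)).sum_comp]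
    refine Finset.sum_congr rfl fun x _ => ?_
    have : ∀ i, (Equiv.arrowCongr (Equiv.addRight (-a)) (Equiv.refl V)) x i = x (i + a) := by
      intro i; simp [Equiv.arrowCongr]
    have h' : (Equiv.arrowCongr (Equiv.addRight (-a)) (Equiv.refl V)) x = fun i => x (i + a) :=
      funext this
    rw [h', tcw_shift]
  have hle : B ≤ ∑ a : Fin K, bad := by
    rw [← htot]
    calc _ ≤ ∑ x : Fin K → V, ∑ a, tcw S x * E a x := by
          refine Finset.sum_le_sum fun x _ => ?_
          rw [← Finset.mul_sum]
          by_cases hx : ∀ i, 0 < S (x i) (x (i + 1))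
          · obtain ⟨i, j, hij, hRij⟩ := hno x hx
            have main : ∃ a, E a x = 1 := by
              have aux : ∀ i j : Fin K, R (x i) (x j) → (j - i - 1).val < r + 1 →
                  ∃ a, E a x = 1 := by
                intro i j hr' hlt
                refine ⟨i - Fin.natAdd (r + 1) (Fin.last r), ?_⟩
                simp only [E, hχ, add_sub_cancel]
                rw [if_pos]
                refine ⟨⟨(j - i - 1).val, hlt⟩, ?_⟩
                have e1 : (Fin.castAdd (r + 1) ⟨(j - i - 1).val, hlt⟩ : Fin K) = j - i - 1 := by
                  apply Fin.ext; simp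
                have e2 : (Fin.natAdd (r + 1) (Fin.last r) : Fin K) = -1 := by
                  have := fin_natAdd_last_add r
                  rw [eq_neg_iff_add_eq_zero]
                  rw [this]
                  rfl
                rw [e1, e2]
                convert hr' using 2
                abel
              by_cases hlt : (j - i - 1).val < r + 1
              · exact aux i j hRij hlt
              · refine aux j i (hR _ _ hRij) ?_
                exact fin_dist_aux r i j hij hlt
            obtain ⟨a, ha⟩ := main
            have hE0 : ∀ a, 0 ≤ E a x := fun a => by simp only [E, hχ]; split_ifs <;> norm_num
            have : 1 ≤ ∑ a, E a x := by
              rw [← ha]; exact Finset.single_le_sum (fun a _ => hE0 a) (Finset.mem_univ a)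
            nlinarith [hcw x]
          · have : tcw S x = 0 := by
              push Not at hx
              obtain ⟨i, hi⟩ := hx
              exact Finset.prod_eq_zero (Finset.mem_univ i) (le_antisymm hi (hS _ _))
            simp [this]
      _ = ∑ a : Fin K, bad := by
          rw [Finset.sum_comm]
          exact Finset.sum_congr rfl fun a _ => hEsum a
  have : ∑ a : Fin K, bad = (2 * (r + 1 : ℝ)) * bad := by
    rw [Finset.sum_const, Finset.card_univ, Fintype.card_fin, nsmul_eq_mul, hK]
    push_cast; ring
  linarith

open Classical in
/-- Conflict-free homomorphic cycle lemma. -/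
theorem conflict_free_graph (A R : V → V → Prop) (hA : ∀ x y, A x y → A y x)
    (hR : ∀ x y, R x y → R y x) (r : ℕ) (β : ℝ) (hβ : 0 ≤ β)
    (hne : ∃ x y, A x y)
    (hdeg : ∀ u v, ((univ.filter fun w => A v w ∧ R w u).card : ℝ)
      ≤ β * (univ.filter fun w => A v w).card)
    (hN : (4 * (r + 1 : ℝ) ^ 3 * β) ^ (r + 1) * Fintype.card V < 1) :
    ∃ x : Fin (r + 1 + (r + 1)) → V, (∀ i, A (x i) (x (i + 1))) ∧
      ∀ i j, i ≠ j → ¬ R (x i) (x j) := by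
  set d : V → ℝ := fun v => ((univ.filter fun w => A v w).card : ℝ) with hd
  set s : V → ℝ := fun v => √(max (d v) 1) with hs
  have hs0 : ∀ v, 0 < s v := fun v => Real.sqrt_pos.2 (lt_max_of_lt_right one_pos)
  have hss : ∀ v, s v * s v = max (d v) 1 := fun v =>
    Real.mul_self_sqrt (le_trans zero_le_one (le_max_right _ _))
  set S : Matrix V V ℝ := fun x y => if A x y then 1 / (s x * s y) else 0 with hS
  have hAs : ∀ x y, A x y ↔ A y x := fun x y => ⟨hA x y, hA y x⟩
  have hd1 : ∀ x y, A x y → 1 ≤ d x := by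
    intro x y h
    have : 0 < (univ.filter fun w => A x w).card := Finset.card_pos.2 ⟨y, by simp [h]⟩
    simp only [hd]
    exact_mod_cast this
  obtain ⟨x, hx1, hx2⟩ := conflict_free_abstract S
    (fun x y => by
      have := hs0 x; have := hs0 y
      simp only [hS]; split_ifs
      · positivity
      · exact le_rfl)
    (fun x y => by simp only [hS]; rw [hAs x y, mul_comm]) s hs0 r β hβ R hR
    (by
      intro u v
      have e1 : ∀ x, (if R x u then (1:ℝ) else 0) * S x v * s x =
          if A v x ∧ R x u then 1 / s v else 0 := by
        intro x
        have := hs0 x; have := hs0 v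
        simp only [hS, hAs x v]
        by_cases h1 : R x u <;> by_cases h2 : A v x <;> simp [h1, h2]
        field_simp
      simp only [e1]
      rw [← Finset.sum_filter, Finset.sum_const, nsmul_eq_mul, mul_one_div, div_le_iff₀ (hs0 v),
        mul_assoc, hss]
      refine (hdeg u v).trans ?_
      gcongr
      exact le_max_left _ _)
    (by
      intro x
      have e1 : ∀ y, S x y * s y = if A x y then 1 / s x else 0 := by
        intro y
        have := hs0 x; have := hs0 y
        simp only [hS]
        by_cases h2 : A x y <;> simp [h2]
        field_simp
      simp only [e1]
      rw [← Finset.sum_filter, Finset.sum_const, nsmul_eq_mul, mul_one_div, div_le_iff₀ (hs0 x),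
        hss]
      exact le_max_left _ _)
    (fun v => √(d v))
    (by
      obtain ⟨x, y, h⟩ := hne
      exact ⟨x, (Real.sqrt_pos.2 (lt_of_lt_of_le one_pos (hd1 x y h))).ne'⟩)
    (by
      intro x
      have e1 : ∀ y, S x y * √(d y) = if A x y then 1 / s x else 0 := by
        intro y
        have := hs0 x; have h0 := hs0 y
        simp only [hS]
        by_cases h2 : A x y <;> simp only [h2, if_true, if_false, zero_mul]
        have : √(d y) = s y := by simp only [hs]; rw [max_eq_left (hd1 y x (hA _ _ h2))]
        rw [this]
        field_simp
      simp only [e1]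
      rw [← Finset.sum_filter, Finset.sum_const, nsmul_eq_mul, mul_one_div, div_eq_iff (hs0 x).ne']
      by_cases h : ∃ y, A x y
      · obtain ⟨y, hy⟩ := h
        have : s x = √(d x) := by simp only [hs]; rw [max_eq_left (hd1 x y hy)]
        rw [this, Real.mul_self_sqrt (by linarith [hd1 x y hy])]
      · push Not at h
        have : d x = 0 := by simp [hd, h]
        rw [this, Real.sqrt_zero, zero_mul]
        exact this) hN
  refine ⟨x, fun i => ?_, hx2⟩
  by_contra h
  have := hx1 i
  simp [hS, h] at this

end TorusAux

section TorusMain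

/-- positions in the cycle -/
def tpos (l : ℕ) (b : Bool) (j : ZMod l) : ZMod (2 * l) := ((2 * j.val + b.toNat : ℕ) : ZMod (2 * l))

theorem tpos_inj (l : ℕ) [NeZero l] (b b' : Bool) (j j' : ZMod l) (h : tpos l b j = tpos l b' j') :
    b = b' ∧ j = j' := by
  have hj := ZMod.val_lt j
  have hj' := ZMod.val_lt j'
  have hb : b.toNat ≤ 1 := Bool.toNat_le b
  have hb' : b'.toNat ≤ 1 := Bool.toNat_le b'
  have h2 := congrArg ZMod.val h
  unfold tpos at h2
  rw [ZMod.val_cast_of_lt (by omega), ZMod.val_cast_of_lt (by omega)] at h2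
  constructor
  · have : b.toNat = b'.toNat := by omega
    cases b <;> cases b' <;> simp_all
  · apply ZMod.val_injective; omega

theorem tpos_true (l : ℕ) (j : ZMod l) : tpos l true j = tpos l false j + 1 := by
  simp [tpos]

theorem tpos_false_succ (l : ℕ) [NeZero l] (j : ZMod l) :
    tpos l false (j + 1) = tpos l true j + 1 := by
  have h : ((2 * (j + 1).val : ℕ) : ZMod (2 * l)) = ((2 * (j.val + 1) : ℕ) : ZMod (2 * l)) := by
    rw [ZMod.natCast_eq_natCast_iff, ZMod.val_add]
    unfold Nat.ModEq
    have e : (j.val + (1 : ZMod l).val) % l = (j.val + 1) % l := by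
      rw [ZMod.val_one_eq_one_mod]; simp
    rw [e, Nat.mul_mod_mul_left, Nat.mod_mod, Nat.mul_mod_mul_left]
  unfold tpos
  simp only [Bool.toNat_false, Bool.toNat_true, add_zero]
  rw [h]; push_cast; ring

/-- half of the cycle -/
def tpart {n l : ℕ} (b : Bool) (c : ZMod (2 * l) → Fin n) : ZMod l → Fin n := fun j => c (tpos l b j)

theorem tpart_update_same {n l : ℕ} [NeZero l] (b : Bool) (c : ZMod (2 * l) → Fin n) (i : ZMod l)
    (v : Fin n) : tpart b (Function.update c (tpos l b i) v) = Function.update (tpart b c) i v := by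
  funext j
  unfold tpart
  by_cases h : j = i
  · subst h; simp
  · rw [Function.update_of_ne h, Function.update_of_ne]
    exact fun h' => h (tpos_inj l _ _ _ _ h').2

theorem tpart_update_other {n l : ℕ} [NeZero l] (b b' : Bool) (hb : b ≠ b')
    (c : ZMod (2 * l) → Fin n) (i : ZMod l)
    (v : Fin n) : tpart b (Function.update c (tpos l b' i) v) = tpart b c := by
  funext j
  unfold tpart
  rw [Function.update_of_ne]
  exact fun h' => hb (tpos_inj l _ _ _ _ h').1

/-- the auxiliary graph -/
def TAux {n l : ℕ} (Cs : Set (ZMod (2 * l) → Fin n)) (a b : Bool × (ZMod l → Fin n)) : Prop :=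
  a.1 ≠ b.1 ∧ ∃ c ∈ Cs, a.2 = tpart a.1 c ∧ b.2 = tpart b.1 c

/-- the conflict relation -/
def TRel {n l : ℕ} (a b : Bool × (ZMod l → Fin n)) : Prop := ∃ i j, a.2 i = b.2 j

open Classical in
theorem taux_fixed {n l : ℕ} [NeZero l] (Cs : Set (ZMod (2 * l) → Fin n)) (α : ℝ)
    (hrich : ∀ c ∈ Cs, ∀ i : ZMod (2 * l),
      α ≤ ({v | Function.update c i v ∈ Cs}.ncard : ℝ))
    (v : Bool × (ZMod l → Fin n)) (i : ZMod l) (z : Fin n) :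
    ((Finset.univ.filter fun w => TAux Cs v w ∧ w.2 i = z).card : ℝ) * α ≤
      (Finset.univ.filter fun w => TAux Cs v w).card := by
  set T := (Finset.univ.filter fun w => TAux Cs v w ∧ w.2 i = z) with hT
  let Q : Bool × (ZMod l → Fin n) → Finset (Fin n) := fun w =>
    Finset.univ.filter fun y => TAux Cs v (w.1, Function.update w.2 i y)
  have hQ : ∀ w ∈ T, α ≤ ((Q w).card : ℝ) := by
    intro w hw
    simp only [hT, Finset.mem_filter, Finset.mem_univ, true_and] at hw
    obtain ⟨⟨hne, c, hc, h1, h2⟩, -⟩ := hw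
    refine (hrich c hc (tpos l w.1 i)).trans ?_
    rw [← Set.ncard_coe_finset]
    refine Nat.cast_le.2 (Set.ncard_le_ncard ?_ (Finset.finite_toSet (Q w)))
    intro y hy
    simp only [Q, Finset.coe_filter, Finset.mem_univ, true_and, Set.mem_setOf_eq]
    exact ⟨hne, _, hy, by rw [tpart_update_other _ _ hne]; exact h1,
      by dsimp only; rw [tpart_update_same, h2]⟩
  have hcard : (T.sigma Q).card ≤ (Finset.univ.filter fun w => TAux Cs v w).card := by
    refine Finset.card_le_card_of_injOn (fun q => (q.1.1, Function.update q.1.2 i q.2)) ?_ ?_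
    · rintro ⟨w, y⟩ h
      simp only [Finset.coe_sigma, Set.mem_sigma_iff, Finset.mem_coe, Q, Finset.mem_filter,
        Finset.mem_univ, true_and] at h
      simpa using h.2
    · rintro ⟨⟨b, w⟩, y⟩ h ⟨⟨b', w'⟩, y'⟩ h' heq
      simp only [Finset.coe_sigma, Set.mem_sigma_iff, Finset.mem_coe, hT, Finset.mem_filter,
        Finset.mem_univ, true_and] at h h'
      simp only [Prod.mk.injEq] at heq
      obtain ⟨rfl, heq⟩ := heq
      have hy : y = y' := by simpa using congrFun heq i
      have hw : w = w' := by
        funext j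
        by_cases hj : j = i
        · subst hj; rw [h.1.2, h'.1.2]
        · simpa [hj] using congrFun heq j
      subst hy; subst hw; rfl
  calc (T.card : ℝ) * α = ∑ w ∈ T, α := by simp
    _ ≤ ∑ w ∈ T, ((Q w).card : ℝ) := Finset.sum_le_sum hQ
    _ = ((T.sigma Q).card : ℝ) := by rw [Finset.card_sigma]; push_cast; rfl
    _ ≤ _ := by exact_mod_cast hcard

open Classical in
theorem taux_deg {n l : ℕ} [NeZero l] (Cs : Set (ZMod (2 * l) → Fin n)) (α : ℝ) (hα : 0 < α)
    (hrich : ∀ c ∈ Cs, ∀ i : ZMod (2 * l),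
      α ≤ ({v | Function.update c i v ∈ Cs}.ncard : ℝ))
    (u v : Bool × (ZMod l → Fin n)) :
    ((Finset.univ.filter fun w => TAux Cs v w ∧ TRel w u).card : ℝ) ≤
      ((l : ℝ) ^ 2 / α) * (Finset.univ.filter fun w => TAux Cs v w).card := by
  have hsub : (Finset.univ.filter fun w => TAux Cs v w ∧ TRel w u) ⊆
      (Finset.univ : Finset (ZMod l × ZMod l)).biUnion
        (fun ij => Finset.univ.filter fun w => TAux Cs v w ∧ w.2 ij.1 = u.2 ij.2) := by
    intro w hw
    simp only [Finset.mem_filter, Finset.mem_univ, true_and] at hw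
    obtain ⟨h, i, j, hij⟩ := hw
    simp only [Finset.mem_biUnion, Finset.mem_filter, Finset.mem_univ, true_and]
    exact ⟨(i, j), h, hij⟩
  have h1 := (Finset.card_le_card hsub).trans Finset.card_biUnion_le
  have h2 : ((Finset.univ.filter fun w => TAux Cs v w ∧ TRel w u).card : ℝ) ≤
      ∑ ij : ZMod l × ZMod l,
        ((Finset.univ.filter fun w => TAux Cs v w ∧ w.2 ij.1 = u.2 ij.2).card : ℝ) := by
    exact_mod_cast h1
  refine h2.trans ?_
  calc _ ≤ ∑ ij : ZMod l × ZMod l,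
        ((Finset.univ.filter fun w => TAux Cs v w).card : ℝ) / α := by
        refine Finset.sum_le_sum fun ij _ => ?_
        rw [le_div_iff₀ hα]
        exact taux_fixed Cs α hrich v ij.1 (u.2 ij.2)
    _ = _ := by
        rw [Finset.sum_const, Finset.card_univ, Fintype.card_prod, ZMod.card, nsmul_eq_mul]
        push_cast; ring

theorem torus_embed {n r l : ℕ} [NeZero l] (G : SimpleGraph (Fin n))
    (Cs : Set (ZMod (2 * l) → Fin n)) (hcyc : ∀ c ∈ Cs, IsCycleIn G c)
    (x : Fin (r + 1 + (r + 1)) → Bool × (ZMod l → Fin n))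
    (hx : ∀ i, TAux Cs (x i) (x (i + 1))) (hR : ∀ i j, i ≠ j → ¬ TRel (x i) (x j))
    (h0 : (x 0).1 = false) : Contains (torusGraph (r + 1 + (r + 1)) l) G := by
  have hpar : ∀ t : ℕ, ∀ h : t < r + 1 + (r + 1), (x ⟨t, h⟩).1 = decide (t % 2 = 1) := by
    intro t
    induction t with
    | zero => intro h; simpa using h0
    | succ t ih =>
      intro h
      have h1 := ih (by omega)
      have h2 := (hx ⟨t, by omega⟩).1
      have h3 : (⟨t, by omega⟩ : Fin (r + 1 + (r + 1))) + 1 = ⟨t + 1, h⟩ := by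
        apply Fin.ext
        rw [Fin.val_add_one_of_lt']
        simpa using h
      rw [h3, h1] at h2
      rcases Nat.mod_two_eq_zero_or_one t with ht | ht
      · have : (t + 1) % 2 = 1 := by omega
        simp only [this, ht] at h2 ⊢
        simpa using h2
      · have : (t + 1) % 2 = 0 := by omega
        simp only [this, ht] at h2 ⊢
        simpa using h2
  refine ⟨fun a => (x a.1).2 a.2, ?_, ?_⟩
  · rintro ⟨i, j⟩ ⟨i', j'⟩ h
    dsimp only at h
    by_cases hi : i = i'
    · subst hi
      obtain ⟨_, c, hc, h1, _⟩ := hx i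
      rw [h1] at h
      have := (tpos_inj l _ _ _ _ ((hcyc c hc).1 h)).2
      rw [this]
    · exact absurd ⟨j, j', h⟩ (hR i i' hi)
  · have key : ∀ a b : Fin (r + 1 + (r + 1)) × ZMod l, ((a.1.val + 1) % (r + 1 + (r + 1)) = b.1.val ∧
        (a.2 = b.2 ∨ (Even a.1.val ∧ a.2 = b.2 + 1) ∨ (Odd a.1.val ∧ b.2 = a.2 + 1))) →
        G.Adj ((x a.1).2 a.2) ((x b.1).2 b.2) := by
      rintro ⟨i, j⟩ ⟨i', j'⟩ ⟨h1, h2⟩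
      dsimp only at h1 h2 ⊢
      have e : i' = i + 1 := by
        apply Fin.ext; rw [← h1]; simp [Fin.val_add]
      subst e
      obtain ⟨hne, c, hc, e1, e2⟩ := hx i
      have hp := hpar i.val i.2
      rw [e1, e2]
      unfold tpart
      have hadj := (hcyc c hc).2
      rcases Nat.even_or_odd i.val with hi | hi
      · have b1 : (x i).1 = false := by
          rw [hp]; simp [Nat.even_iff.1 hi]
        have b2 : (x (i + 1)).1 = true := by
          rw [b1] at hne; simpa using hne
        rw [b1, b2]
        rcases h2 with h2 | h2 | h2
        · subst h2; rw [tpos_true]; exact hadj _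
        · rw [h2.2, tpos_false_succ]; exact (hadj _).symm
        · exact absurd hi (Nat.not_even_iff_odd.2 h2.1)
      · have b1 : (x i).1 = true := by
          rw [hp]; simp [Nat.odd_iff.1 hi]
        have b2 : (x (i + 1)).1 = false := by
          rw [b1] at hne; simpa using hne
        rw [b1, b2]
        rcases h2 with h2 | h2 | h2
        · subst h2; rw [tpos_true]; exact (hadj _).symm
        · exact absurd h2.1 (Nat.not_even_iff_odd.2 hi)
        · rw [h2.2, tpos_false_succ]; exact hadj _
    intro a b hab
    rw [torusGraph, SimpleGraph.fromRel_adj] at hab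
    rcases hab.2 with h | h
    · exact key a b h
    · exact (key b a h).symm

end TorusMain

/-- Let `k, ℓ ≥ 2` with `k` even, and let `G` be an `n`-vertex bipartite graph with a
non-empty `α`-rich collection of `2ℓ`-cycles, where
`α/ℓ² > 2^{20}(k/2)³(ℓ log n)⁴ n^{2ℓ/k}`.  Then `G` contains `T_{k,ℓ}`. -/
theorem torus_of_rich_cycles {n : ℕ} (k l : ℕ) (hk : 2 ≤ k) (hke : Even k)
    (hl : 2 ≤ l) (α : ℝ) (G : SimpleGraph (Fin n)) (hbip : G.Colorable 2)
    (Cs : Set (ZMod (2 * l) → Fin n)) (hne : Cs.Nonempty)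
    (hcyc : ∀ c ∈ Cs, IsCycleIn G c)
    (hrich : ∀ c ∈ Cs, ∀ i : ZMod (2 * l),
      α ≤ ({v | Function.update c i v ∈ Cs}.ncard : ℝ))
    (hα : 2 ^ 20 * ((k : ℝ) / 2) ^ 3 * ((l : ℝ) * Real.logb 2 n) ^ 4 *
        (n : ℝ) ^ ((2 * l : ℝ) / k) < α / (l : ℝ) ^ 2) :
    Contains (torusGraph k l) G := by
  obtain ⟨m, rfl⟩ := hke
  obtain ⟨r, rfl⟩ : ∃ r, m = r + 1 := ⟨m - 1, by omega⟩
  haveI : NeZero l := ⟨by omega⟩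
  obtain ⟨c, hc⟩ := hne
  have hn : 2 * l ≤ n := by
    have := Fintype.card_le_of_injective c (hcyc c hc).1
    simpa [ZMod.card] using this
  have hl1 : (2:ℝ) ≤ l := by exact_mod_cast hl
  have hn2 : (2:ℝ) ≤ n := by exact_mod_cast (by omega : 2 ≤ n)
  have hlog : 1 ≤ Real.logb 2 n := by
    rw [Real.le_logb_iff_rpow_le (by norm_num) (by linarith)]; simpa using hn2
  have hL : (1:ℝ) ≤ ((l : ℝ) * Real.logb 2 n) ^ 4 := one_le_pow₀ (by nlinarith)
  have hm : (((r + 1 + (r + 1) : ℕ) : ℝ)) = 2 * (r + 1) := by push_cast; ring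
  rw [hm] at hα
  set T : ℝ := (n : ℝ) ^ ((2 * l : ℝ) / (2 * (r + 1))) with hT
  have hTpos : 0 < T := Real.rpow_pos_of_pos (by linarith) _
  have hTm : T ^ (r + 1) = (n : ℝ) ^ l := by
    rw [hT, ← Real.rpow_natCast, ← Real.rpow_mul (by linarith), ← Real.rpow_natCast]
    congr 1
    push_cast
    field_simp
  have hα2 : 2 ^ 20 * (r + 1 : ℝ) ^ 3 * T < α / (l : ℝ) ^ 2 := by
    refine lt_of_le_of_lt ?_ hα
    have e : (2 * (r + 1 : ℝ) / 2) = r + 1 := by ring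
    rw [e]
    have : (0:ℝ) ≤ 2 ^ 20 * (r + 1 : ℝ) ^ 3 := by positivity
    calc 2 ^ 20 * (r + 1 : ℝ) ^ 3 * T = 2 ^ 20 * (r + 1 : ℝ) ^ 3 * 1 * T := by ring
      _ ≤ _ := by gcongr
  have hq : 0 < α / (l : ℝ) ^ 2 := lt_trans (by positivity) hα2
  have hl2 : (0:ℝ) < (l : ℝ) ^ 2 := by positivity
  have hαpos : 0 < α := by
    rcases div_pos_iff.1 hq with h | h
    · exact h.1
    · linarith [h.2]
  have hbeta : 4 * (r + 1 : ℝ) ^ 3 * ((l : ℝ) ^ 2 / α) * T ≤ 1 / 4 := by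
    rw [lt_div_iff₀ hl2] at hα2
    have : 4 * (r + 1 : ℝ) ^ 3 * ((l : ℝ) ^ 2 / α) * T =
      (4 * (r + 1 : ℝ) ^ 3 * (l : ℝ) ^ 2 * T) / α := by ring
    rw [this, div_le_iff₀ hαpos]
    have : 0 ≤ (r + 1 : ℝ) ^ 3 * T * (l : ℝ) ^ 2 := by positivity
    nlinarith
  have hN : (4 * (r + 1 : ℝ) ^ 3 * ((l : ℝ) ^ 2 / α)) ^ (r + 1) *
      (Fintype.card (Bool × (ZMod l → Fin n)) : ℝ) < 1 := by
    have hcard : (Fintype.card (Bool × (ZMod l → Fin n)) : ℝ) = 2 * T ^ (r + 1) := by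
      rw [hTm]; simp [ZMod.card]
    rw [hcard]
    calc _ = 2 * (4 * (r + 1 : ℝ) ^ 3 * ((l : ℝ) ^ 2 / α) * T) ^ (r + 1) := by
          rw [mul_pow _ T]; ring
      _ ≤ 2 * (1 / 4) ^ (r + 1) := by gcongr
      _ ≤ 2 * (1 / 4) := by
          gcongr
          exact pow_le_of_le_one (by norm_num) (by norm_num) (by omega)
      _ < 1 := by norm_num
  obtain ⟨x, hx, hR⟩ := conflict_free_graph (TAux Cs) TRel
    (fun a b h => ⟨h.1.symm, by obtain ⟨c, hc, h1, h2⟩ := h.2; exact ⟨c, hc, h2, h1⟩⟩)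
    (fun a b h => by obtain ⟨i, j, hij⟩ := h; exact ⟨j, i, hij.symm⟩)
    r ((l : ℝ) ^ 2 / α) (by positivity)
    ⟨(false, tpart false c), (true, tpart true c), by simp, c, hc, rfl, rfl⟩
    (taux_deg Cs α hαpos hrich) hN
  cases h0 : (x 0).1 with
  | false => exact torus_embed G Cs hcyc x hx hR h0
  | true =>
    refine torus_embed G Cs hcyc (fun i => x (i + 1)) (fun i => hx (i + 1))
      (fun i j hij => hR _ _ (fun h => hij (add_right_cancel h))) ?_
    have := (hx 0).1
    rw [h0] at this
    simpa using this
end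

section
/- For an even integer k ≥ 4 and integer ℓ ≥ 2, ex(n, T_{k,ℓ}) = O_{k,ℓ}(n^{3/2 + ℓ/k}(log n)²). -/
open SimpleGraph

section
open Matrix Finset

namespace TT

lemma spec {Ω : Type*} [Fintype Ω] [DecidableEq Ω] (S : Matrix Ω Ω ℝ) (hS : Sᵀ = S) :
    ∃ (U : Matrix Ω Ω ℝ) (lam : Ω → ℝ), U * Uᵀ = 1 ∧ Uᵀ * U = 1 ∧
      S = U * diagonal lam * Uᵀ := by
  have hH : S.IsHermitian := by
    unfold Matrix.IsHermitian
    rw [conjTranspose_eq_transpose_of_trivial]; exact hS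
  refine ⟨hH.eigenvectorUnitary, hH.eigenvalues, ?_, ?_, ?_⟩
  · have := Unitary.coe_mul_star_self hH.eigenvectorUnitary
    rwa [Unitary.coe_star, star_eq_conjTranspose, conjTranspose_eq_transpose_of_trivial] at this
  · have := Unitary.coe_star_mul_self hH.eigenvectorUnitary
    rwa [star_eq_conjTranspose, conjTranspose_eq_transpose_of_trivial] at this
  · have := hH.spectral_theorem
    rw [Unitary.conjStarAlgAut_apply, star_eq_conjTranspose,
      conjTranspose_eq_transpose_of_trivial] at this
    exact this

section
variable {Ω : Type*} [Fintype Ω] [DecidableEq Ω] {S U : Matrix Ω Ω ℝ} {lam : Ω → ℝ}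

lemma spec_pow (h2 : Uᵀ * U = 1) (h1 : U * Uᵀ = 1)
    (hS : S = U * diagonal lam * Uᵀ) (r : ℕ) :
    S ^ r = U * diagonal (fun i => lam i ^ r) * Uᵀ := by
  induction r with
  | zero => simp [h1]
  | succ r ih =>
    rw [pow_succ, ih, hS]
    calc U * diagonal (fun i => lam i ^ r) * Uᵀ * (U * diagonal lam * Uᵀ)
        = U * diagonal (fun i => lam i ^ r) * (Uᵀ * U) * diagonal lam * Uᵀ := by
          simp only [Matrix.mul_assoc]
      _ = _ := by
          rw [h2, Matrix.mul_one, Matrix.mul_assoc U, diagonal_mul_diagonal]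
          simp only [pow_succ]

lemma spec_trace (h2 : Uᵀ * U = 1) (h1 : U * Uᵀ = 1)
    (hS : S = U * diagonal lam * Uᵀ) (r : ℕ) :
    (S ^ r).trace = ∑ i, lam i ^ r := by
  rw [spec_pow h2 h1 hS, Matrix.trace_mul_comm, ← Matrix.mul_assoc, h2, Matrix.one_mul,
    trace_diagonal]

/-- quadratic forms -/
lemma spec_quad (h2 : Uᵀ * U = 1) (h1 : U * Uᵀ = 1)
    (hS : S = U * diagonal lam * Uᵀ) (r : ℕ) (f : Ω → ℝ) :
    f ⬝ᵥ (S ^ r *ᵥ f) = ∑ i, lam i ^ r * ((Uᵀ *ᵥ f) i) ^ 2 := by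
  rw [spec_pow h2 h1 hS, ← mulVec_mulVec, ← mulVec_mulVec, dotProduct_mulVec, ← mulVec_transpose]
  simp only [dotProduct, mulVec_diagonal]
  refine sum_congr rfl fun i _ => ?_
  ring

lemma spec_norm (h1 : U * Uᵀ = 1) (f : Ω → ℝ) :
    ∑ i, ((Uᵀ *ᵥ f) i) ^ 2 = ∑ x, f x ^ 2 := by
  have : (Uᵀ *ᵥ f) ⬝ᵥ (Uᵀ *ᵥ f) = f ⬝ᵥ f := by
    rw [dotProduct_mulVec, vecMul_transpose, mulVec_mulVec, h1, one_mulVec]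
  simpa [dotProduct, pow_two] using this

lemma rayleigh (h2 : Uᵀ * U = 1) (h1 : U * Uᵀ = 1)
    (hS : S = U * diagonal lam * Uᵀ) (f : Ω → ℝ) (c : ℝ) (hf : 0 < ∑ x, f x ^ 2)
    (hc : c * ∑ x, f x ^ 2 ≤ f ⬝ᵥ (S *ᵥ f)) : ∃ i, c ≤ lam i := by
  by_contra! hcon
  have hq := spec_quad h2 h1 hS 1 f
  rw [pow_one] at hq
  rw [hq, ← spec_norm h1 f, mul_sum] at hc
  rw [← spec_norm h1 f] at hf
  obtain ⟨i, _, hi⟩ := exists_ne_zero_of_sum_ne_zero hf.ne'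
  have : ∑ i, lam i ^ 1 * ((Uᵀ *ᵥ f) i) ^ 2 < ∑ i, c * ((Uᵀ *ᵥ f) i) ^ 2 := by
    apply sum_lt_sum
    · intro j _
      have := (hcon j).le
      rw [pow_one]
      gcongr
    · refine ⟨i, mem_univ _, ?_⟩
      have h0 : 0 < ((Uᵀ *ᵥ f) i) ^ 2 := lt_of_le_of_ne (sq_nonneg _) (Ne.symm hi)
      rw [pow_one]
      exact mul_lt_mul_of_pos_right (hcon i) h0
  linarith

lemma abs_quad (h2 : Uᵀ * U = 1) (h1 : U * Uᵀ = 1) (hsym : Sᵀ = S)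
    (hS : S = U * diagonal lam * Uᵀ) (g : Ω → ℝ) (ρ : ℝ) (hρ : 0 < ρ)
    (hg : ∑ x, ((S *ᵥ g) x) ^ 2 ≤ ρ ^ 2 * ∑ x, g x ^ 2) :
    ∑ i, |lam i| * ((Uᵀ *ᵥ g) i) ^ 2 ≤ ρ * ∑ x, g x ^ 2 := by
  have e1 : ∑ x, ((S *ᵥ g) x) ^ 2 = ∑ i, lam i ^ 2 * ((Uᵀ *ᵥ g) i) ^ 2 := by
    rw [← spec_quad h2 h1 hS 2 g, pow_two S, ← mulVec_mulVec, dotProduct_mulVec,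
      ← mulVec_transpose, hsym]
    simp [dotProduct, pow_two]
  rw [e1] at hg
  have e2 : ρ * ∑ i, |lam i| * ((Uᵀ *ᵥ g) i) ^ 2 ≤
      ∑ i, (lam i ^ 2 * ((Uᵀ *ᵥ g) i) ^ 2 + ρ ^ 2 * ((Uᵀ *ᵥ g) i) ^ 2) / 2 := by
    rw [mul_sum]
    refine sum_le_sum fun i _ => ?_
    have : ρ * |lam i| ≤ (lam i ^ 2 + ρ ^ 2) / 2 := by
      rw [← sq_abs (lam i)]
      nlinarith [sq_nonneg (ρ - |lam i|)]
    have h3 := mul_le_mul_of_nonneg_right this (sq_nonneg ((Uᵀ *ᵥ g) i))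
    linarith
  rw [← sum_div, sum_add_distrib, ← mul_sum, spec_norm h1] at e2
  have : ρ * ∑ i, |lam i| * ((Uᵀ *ᵥ g) i) ^ 2 ≤ ρ * (ρ * ∑ x, g x ^ 2) := by nlinarith
  exact le_of_mul_le_mul_left this hρ

lemma pow_swap (x y : ℝ) (hx : 0 ≤ x) (hy : 0 ≤ y) (a b : ℕ) :
    x ^ (a+1) * y ^ (b+1) + x ^ (b+1) * y ^ (a+1) ≤ x * y ^ (a+b+1) + x ^ (a+b+1) * y := by
  have key : 0 ≤ (x ^ a - y ^ a) * (x ^ b - y ^ b) := by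
    rcases le_total x y with h | h
    · exact mul_nonneg_of_nonpos_of_nonpos (sub_nonpos.2 (pow_le_pow_left₀ hx h a))
        (sub_nonpos.2 (pow_le_pow_left₀ hx h b))
    · exact mul_nonneg (sub_nonneg.2 (pow_le_pow_left₀ hy h a))
        (sub_nonneg.2 (pow_le_pow_left₀ hy h b))
  have := mul_nonneg (mul_nonneg hx hy) key
  ring_nf at this ⊢
  linarith

variable {Z : Type*} [Fintype Z] [DecidableEq Z]

/-- the compressed projector -/
noncomputable def pz (U : Matrix Ω Ω ℝ) (α : Ω → Z) (z : Z) (i j : Ω) : ℝ :=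
  ∑ x, U x i * (if α x = z then U x j else 0)

lemma pz_symm (α : Ω → Z) (z : Z) (i j : Ω) : pz U α z i j = pz U α z j i := by
  unfold pz
  refine sum_congr rfl fun x _ => ?_
  split_ifs <;> ring

lemma half_bound (h2 : Uᵀ * U = 1) (h1 : U * Uᵀ = 1) (hsym : Sᵀ = S)
    (hS : S = U * diagonal lam * Uᵀ) (ρ : ℝ) (hρ : 0 < ρ) (α : Ω → Z)
    (hα : ∀ z, ∀ g : Ω → ℝ, (∀ x, α x ≠ z → g x = 0) →
      ∑ x, ((S *ᵥ g) x) ^ 2 ≤ ρ ^ 2 * ∑ x, g x ^ 2) (a b : ℕ) :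
    ∑ z, ∑ i, ∑ j, |lam i| ^ (a+1) * |lam j| ^ (b+1) * pz U α z i j ^ 2 ≤
      ρ * ∑ i, |lam i| ^ (a+b+1) := by
  set T : ℝ := ∑ z, ∑ i, ∑ j, |lam i| ^ (a+1) * |lam j| ^ (b+1) * pz U α z i j ^ 2 with hT
  have hT' : T = ∑ z, ∑ i, ∑ j, |lam i| ^ (b+1) * |lam j| ^ (a+1) * pz U α z i j ^ 2 := by
    rw [hT]
    refine sum_congr rfl fun z _ => ?_
    rw [sum_comm]
    refine sum_congr rfl fun i _ => sum_congr rfl fun j _ => ?_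
    rw [pz_symm]; ring
  set R : ℝ := ∑ z, ∑ i, ∑ j, |lam i| * |lam j| ^ (a+b+1) * pz U α z i j ^ 2 with hR
  have hR' : R = ∑ z, ∑ i, ∑ j, |lam i| ^ (a+b+1) * |lam j| * pz U α z i j ^ 2 := by
    rw [hR]
    refine sum_congr rfl fun z _ => ?_
    rw [sum_comm]
    refine sum_congr rfl fun i _ => sum_congr rfl fun j _ => ?_
    rw [pz_symm]; ring
  have hTR : T + T ≤ R + R := by
    nth_rewrite 2 [hT']
    nth_rewrite 2 [hR']
    rw [hT, hR]
    simp only [← sum_add_distrib, ← add_mul]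
    refine sum_le_sum fun z _ => sum_le_sum fun i _ => sum_le_sum fun j _ => ?_
    refine mul_le_mul_of_nonneg_right ?_ (sq_nonneg _)
    exact pow_swap _ _ (abs_nonneg _) (abs_nonneg _) a b
  have hRb : R ≤ ρ * ∑ i, |lam i| ^ (a+b+1) := by
    have : R = ∑ j, |lam j| ^ (a+b+1) * ∑ z, ∑ i, |lam i| * pz U α z i j ^ 2 := by
      rw [hR]
      simp only [mul_sum]
      rw [sum_comm' (t' := univ) (s' := fun _ => univ) (by simp)]
      have : ∀ z, ∑ i, ∑ j, |lam i| * |lam j| ^ (a+b+1) * pz U α z i j ^ 2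
         = ∑ j, ∑ i, |lam j| ^ (a+b+1) * (|lam i| * pz U α z i j ^ 2) := by
        intro z
        rw [sum_comm]
        refine sum_congr rfl fun i _ => sum_congr rfl fun j _ => ?_
        ring
      rw [sum_comm]
      simp only [this]
      rw [sum_comm]
    rw [this, mul_sum]
    refine sum_le_sum fun j _ => ?_
    rw [mul_comm ρ]
    gcongr
    calc ∑ z, ∑ i, |lam i| * pz U α z i j ^ 2
        ≤ ∑ z, ρ * ∑ x, (if α x = z then U x j else 0) ^ 2 := by
          refine sum_le_sum fun z _ => ?_
          have := abs_quad h2 h1 hsym hS (fun x => if α x = z then U x j else 0) ρ hρ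
            (hα z _ (fun x hx => by simp [hx]))
          simpa [pz, mulVec, dotProduct] using this
      _ = ρ * ∑ x, (U x j) ^ 2 := by
          rw [← mul_sum, sum_comm]
          congr 1
          refine sum_congr rfl fun x _ => ?_
          simp [ite_pow]
      _ = ρ := by
          have := congrFun (congrFun h2 j) j
          simp [Matrix.mul_apply] at this
          simp [pow_two, this]
  linarith

lemma trace_expand (h2 : Uᵀ * U = 1) (h1 : U * Uᵀ = 1)
    (hS : S = U * diagonal lam * Uᵀ) (α β : Ω → Z) (z : Z) (r s : ℕ) :
    (diagonal (fun x => if α x = z then (1:ℝ) else 0) * S ^ r *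
      (diagonal (fun x => if β x = z then (1:ℝ) else 0) * S ^ s)).trace =
    ∑ i, ∑ j, lam i ^ r * lam j ^ s * (pz U α z i j * pz U β z i j) := by
  set P := diagonal (fun x => if α x = z then (1:ℝ) else 0)
  set Q := diagonal (fun x => if β x = z then (1:ℝ) else 0)
  have hP : ∀ i j, (Uᵀ * P * U) i j = pz U α z i j := by
    intro i j
    rw [Matrix.mul_apply]
    simp only [P, mul_diagonal, transpose_apply, pz]
    refine sum_congr rfl fun x _ => ?_
    split_ifs <;> ring
  have hQ : ∀ i j, (Uᵀ * Q * U) i j = pz U β z i j := by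
    intro i j
    rw [Matrix.mul_apply]
    simp only [Q, mul_diagonal, transpose_apply, pz]
    refine sum_congr rfl fun x _ => ?_
    split_ifs <;> ring
  have : (P * S ^ r * (Q * S ^ s)).trace =
      ((Uᵀ * P * U) * diagonal (fun i => lam i ^ r) * ((Uᵀ * Q * U) *
        diagonal (fun i => lam i ^ s))).trace := by
    rw [spec_pow h2 h1 hS, spec_pow h2 h1 hS]
    have : P * (U * diagonal (fun i => lam i ^ r) * Uᵀ) * (Q * (U * diagonal (fun i => lam i ^ s) * Uᵀ))
      = (P * U * diagonal (fun i => lam i ^ r) * Uᵀ * Q * U * diagonal (fun i => lam i ^ s)) * Uᵀ := by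
      simp only [Matrix.mul_assoc]
    rw [this, trace_mul_comm]
    simp only [Matrix.mul_assoc]
  rw [this]
  simp only [Matrix.trace, Matrix.mul_apply (M := Uᵀ * P * U * _), diag_apply, mul_diagonal, hP, hQ]
  rw [sum_comm]
  refine sum_congr rfl fun i _ => sum_congr rfl fun j _ => ?_
  rw [pz_symm α]
  ring

lemma bad_bound (h2 : Uᵀ * U = 1) (h1 : U * Uᵀ = 1) (hsym : Sᵀ = S)
    (hS : S = U * diagonal lam * Uᵀ) (ρ : ℝ) (hρ : 0 < ρ) (α β : Ω → Z)
    (hα : ∀ z, ∀ g : Ω → ℝ, (∀ x, α x ≠ z → g x = 0) →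
      ∑ x, ((S *ᵥ g) x) ^ 2 ≤ ρ ^ 2 * ∑ x, g x ^ 2)
    (hβ : ∀ z, ∀ g : Ω → ℝ, (∀ x, β x ≠ z → g x = 0) →
      ∑ x, ((S *ᵥ g) x) ^ 2 ≤ ρ ^ 2 * ∑ x, g x ^ 2) (a b : ℕ) :
    ∑ z, (diagonal (fun x => if α x = z then (1:ℝ) else 0) * S ^ (a+1) *
      (diagonal (fun x => if β x = z then (1:ℝ) else 0) * S ^ (b+1))).trace ≤
      ρ * ∑ i, |lam i| ^ (a+b+1) := by
  have A := half_bound h2 h1 hsym hS ρ hρ α hα a b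
  have B := half_bound h2 h1 hsym hS ρ hρ β hβ a b
  simp only [trace_expand h2 h1 hS]
  have : ∑ z, ∑ i, ∑ j, lam i ^ (a+1) * lam j ^ (b+1) * (pz U α z i j * pz U β z i j) ≤
    ∑ z, ∑ i, ∑ j, (|lam i| ^ (a+1) * |lam j| ^ (b+1) * pz U α z i j ^ 2 +
       |lam i| ^ (a+1) * |lam j| ^ (b+1) * pz U β z i j ^ 2) / 2 := by
    gcongr with z _ i _ j _
    calc _ ≤ |lam i ^ (a+1) * lam j ^ (b+1) * (pz U α z i j * pz U β z i j)| := le_abs_self _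
      _ = |lam i| ^ (a+1) * |lam j| ^ (b+1) * (|pz U α z i j| * |pz U β z i j|) := by
        simp [abs_mul, abs_pow]
      _ ≤ |lam i| ^ (a+1) * |lam j| ^ (b+1) * ((pz U α z i j ^ 2 + pz U β z i j ^ 2) / 2) := by
        gcongr
        rw [← sq_abs (pz U α z i j), ← sq_abs (pz U β z i j)]
        nlinarith [sq_nonneg (|pz U α z i j| - |pz U β z i j|)]
      _ = _ := by ring
  simp only [← sum_div, sum_add_distrib] at this
  linarith

/-- vertices in a thin set -/
lemma self_bound (h2 : Uᵀ * U = 1) (h1 : U * Uᵀ = 1) (hsym : Sᵀ = S)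
    (hS : S = U * diagonal lam * Uᵀ) (ρ : ℝ) (hρ : 0 < ρ) (p : Ω → Prop) [DecidablePred p]
    (hp : ∀ g : Ω → ℝ, (∀ x, ¬ p x → g x = 0) →
      ∑ x, ((S *ᵥ g) x) ^ 2 ≤ ρ ^ 2 * ∑ x, g x ^ 2) (a : ℕ) :
    (diagonal (fun x => if p x then (1:ℝ) else 0) * S ^ (a+1)).trace ≤
      ρ * ∑ i, |lam i| ^ a := by
  have e : (diagonal (fun x => if p x then (1:ℝ) else 0) * S ^ (a+1)).trace =
      ∑ j, lam j ^ (a+1) * ∑ x, (if p x then U x j else 0) ^ 2 := by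
    rw [spec_pow h2 h1 hS]
    simp only [Matrix.trace, diag_apply, diagonal_mul]
    simp only [Matrix.mul_apply (N := Uᵀ), mul_diagonal, transpose_apply, mul_sum]
    rw [sum_comm]
    refine sum_congr rfl fun j _ => sum_congr rfl fun x _ => ?_
    split_ifs <;> ring
  rw [e, mul_sum]
  refine sum_le_sum fun j _ => ?_
  have hq := abs_quad h2 h1 hsym hS (fun x => if p x then U x j else 0) ρ hρ
            (hp _ (fun x hx => by simp [hx]))
  have hU : ∑ x, (U x j) ^ 2 = 1 := by
    have := congrFun (congrFun h2 j) j
    simp [Matrix.mul_apply] at this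
    simp [pow_two, this]
  set m := ∑ x, (if p x then U x j else 0) ^ 2 with hm
  have hm0 : 0 ≤ m := sum_nonneg fun _ _ => sq_nonneg _
  have hm1 : m ≤ 1 := by
    rw [← hU]
    refine sum_le_sum fun x _ => ?_
    split_ifs
    · exact le_rfl
    · simpa using sq_nonneg (U x j)
  have hj : (Uᵀ *ᵥ (fun x => if p x then U x j else 0)) j = m := by
    simp only [mulVec, dotProduct, hm, transpose_apply]
    refine sum_congr rfl fun x _ => ?_
    split_ifs <;> ring
  have h3 : |lam j| * m ^ 2 ≤ ρ * m := by
    refine le_trans ?_ hq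
    have := single_le_sum (s := univ) (f := fun i => |lam i| *
      ((Uᵀ *ᵥ (fun x => if p x then U x j else 0)) i) ^ 2)
      (fun i _ => mul_nonneg (abs_nonneg _) (sq_nonneg _)) (mem_univ j)
    simpa only [hj] using this
  have h4 : |lam j| * m ≤ ρ := by
    rcases hm0.eq_or_lt with h | h
    · rw [← h]; simp [hρ.le]
    · refine le_of_mul_le_mul_right ?_ h
      linarith [h3, pow_two m, mul_assoc |lam j| m m]
  calc lam j ^ (a+1) * m ≤ |lam j ^ (a+1) * m| := le_abs_self _
    _ = |lam j| ^ a * (|lam j| * m) := by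
      rw [abs_mul, abs_pow, abs_of_nonneg hm0]; ring
    _ ≤ |lam j| ^ a * ρ := by gcongr
    _ = _ := mul_comm _ _

end

section
variable {Ω : Type*} [Fintype Ω] [DecidableEq Ω]

noncomputable def prodM (F : ℕ → Matrix Ω Ω ℝ) : ℕ → Matrix Ω Ω ℝ
  | 0 => 1
  | m+1 => F 0 * prodM (fun i => F (i+1)) m

lemma prodM_add (F : ℕ → Matrix Ω Ω ℝ) (a b : ℕ) :
    prodM F (a + b) = prodM F a * prodM (fun i => F (i + a)) b := by
  induction a generalizing F with
  | zero => simp [prodM]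
  | succ a ih =>
    rw [Nat.succ_add]
    simp only [prodM]
    rw [ih, Matrix.mul_assoc]
    simp only [add_assoc, add_comm 1 a]

lemma prodM_const (S : Matrix Ω Ω ℝ) (a : ℕ) : prodM (fun _ => S) a = S ^ a := by
  induction a with
  | zero => simp [prodM]
  | succ a ih => simp only [prodM]; rw [ih, pow_succ']

lemma prodM_congr (F F' : ℕ → Matrix Ω Ω ℝ) (a : ℕ) (h : ∀ i < a, F i = F' i) :
    prodM F a = prodM F' a := by
  induction a generalizing F F' with
  | zero => simp [prodM]
  | succ a ih =>
    simp only [prodM]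
    rw [h 0 (by omega), ih _ _ (fun i hi => h (i+1) (by omega))]

lemma path_sum (m : ℕ) (F : ℕ → Matrix Ω Ω ℝ) (g : Ω → Ω → ℝ) :
    ∑ z : Fin (m+1) → Ω, (∏ i : Fin m, F i (z i.castSucc) (z i.succ)) * g (z 0) (z (Fin.last m))
      = ∑ x, ∑ y, prodM F m x y * g x y := by
  induction m generalizing F g with
  | zero =>
    have : ∀ x, ∑ y, prodM F 0 x y * g x y = g x x := by
      intro x
      simp [prodM, Matrix.one_apply]
    simp only [this]
    rw [← (Equiv.funUnique (Fin 1) Ω).symm.sum_comp]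
    simp [uniqueElim_const]
  | succ m ih =>
    rw [← (Fin.consEquiv (fun _ : Fin (m+2) => Ω)).sum_comp, Fintype.sum_prod_type]
    simp only [Fin.consEquiv_apply, Fin.prod_univ_succ, Fin.castSucc_zero, Fin.cons_zero,
      Fin.cons_succ, ← Fin.succ_castSucc, ← Fin.succ_last, Fin.val_zero, Fin.val_succ]
    have key : ∀ x, ∑ z : Fin (m+1) → Ω, F 0 x (z 0) *
        (∏ i : Fin m, F (i+1) (z i.castSucc) (z i.succ)) * g x (z (Fin.last m)) =
        ∑ y, prodM F (m+1) x y * g x y := by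
      intro x
      have := ih (fun i => F (i+1)) (fun a b => F 0 x a * g x b)
      calc _ = ∑ z : Fin (m+1) → Ω, (∏ i : Fin m, F (i+1) (z i.castSucc) (z i.succ)) *
                (F 0 x (z 0) * g x (z (Fin.last m))) :=
            sum_congr rfl fun z _ => by ring
        _ = _ := this
        _ = _ := by
          rw [sum_comm]
          refine sum_congr rfl fun y _ => ?_
          simp only [prodM]
          rw [Matrix.mul_apply, sum_mul]
          refine sum_congr rfl fun w _ => ?_
          ring
    exact sum_congr rfl fun x _ => key x

lemma cyc (m : ℕ) (F : ℕ → Matrix Ω Ω ℝ) :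
    ∑ z : Fin (m+1) → Ω, ∏ i : Fin (m+1), F i (z i) (z (i+1)) = (prodM F (m+1)).trace := by
  have e : ∀ z : Fin (m+1) → Ω, ∏ i : Fin (m+1), F i (z i) (z (i+1)) =
      (∏ i : Fin m, F i (z i.castSucc) (z i.succ)) * F m (z (Fin.last m)) (z 0) := by
    intro z
    rw [Fin.prod_univ_castSucc]
    simp [Fin.coeSucc_eq_succ]
  simp only [e]
  rw [path_sum m F (fun x y => F m y x), prodM_add F m 1]
  simp only [prodM, Matrix.mul_one, zero_add, Matrix.trace, diag_apply]
  refine sum_congr rfl fun x _ => ?_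
  rw [Matrix.mul_apply]

/-- weight of a closed walk -/
noncomputable def wt (m : ℕ) (S : Matrix Ω Ω ℝ) (z : Fin (m+1) → Ω) : ℝ :=
  ∏ i : Fin (m+1), S (z i) (z (i+1))

lemma wt_sum (m : ℕ) (S : Matrix Ω Ω ℝ) : ∑ z, wt m S z = (S ^ (m+1)).trace := by
  rw [← prodM_const, ← cyc]; rfl

lemma wt_rot (m : ℕ) (S : Matrix Ω Ω ℝ) (z : Fin (m+1) → Ω) (c : Fin (m+1)) :
    wt m S (fun i => z (i + c)) = wt m S z := by
  unfold wt
  rw [← Equiv.prod_comp (Equiv.addRight c) (fun i => S (z i) (z (i+1)))]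
  refine prod_congr rfl fun i _ => ?_
  simp [add_right_comm]

lemma sum_rot (m : ℕ) (c : Fin (m+1)) (f : (Fin (m+1) → Ω) → ℝ) :
    ∑ z : Fin (m+1) → Ω, f (fun i => z (i + c)) = ∑ z, f z :=
  (Equiv.arrowCongr (Equiv.addRight c).symm (Equiv.refl Ω)).sum_comp f

lemma self_trace (m : ℕ) (S : Matrix Ω Ω ℝ) (p : Ω → Prop) [DecidablePred p] (c : Fin (m+1)) :
    ∑ z, wt m S z * (if p (z c) then 1 else 0) =
      (diagonal (fun x => if p x then (1:ℝ) else 0) * S ^ (m+1)).trace := by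
  rw [← sum_rot m (-c)]
  simp only [wt_rot, add_neg_cancel]
  have := cyc m (fun i => if i = 0 then diagonal (fun x => if p x then (1:ℝ) else 0) * S else S)
  rw [prodM, prodM_congr _ (fun _ => S) m (fun i _ => by simp), prodM_const] at this
  simp only [if_true, Matrix.mul_assoc, ← pow_succ'] at this
  rw [← this]
  refine sum_congr rfl fun z _ => ?_
  unfold wt
  rw [Fin.prod_univ_succ, Fin.prod_univ_succ]
  simp [diagonal_mul]

variable {Z : Type*} [Fintype Z] [DecidableEq Z]

lemma pair_trace0 (m : ℕ) (S : Matrix Ω Ω ℝ) (α β : Ω → Z) (a b : ℕ) (hab : a + b + 1 = m)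
    (r : Fin (m+1)) (hr : (r : ℕ) = a + 1) :
    ∑ z, wt m S z * (if α (z 0) = β (z r) then 1 else 0) =
     ∑ c, (diagonal (fun x => if α x = c then (1:ℝ) else 0) * S ^ (a+1) *
      (diagonal (fun x => if β x = c then (1:ℝ) else 0) * S ^ (b+1))).trace := by
  have e : ∀ z : Fin (m+1) → Ω, wt m S z * (if α (z 0) = β (z r) then 1 else 0) =
     ∑ c, wt m S z * ((if α (z 0) = c then 1 else 0) * (if β (z r) = c then 1 else 0)) := by
    intro z
    rw [← mul_sum]
    congr 1
    simp [eq_comm]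
  simp only [e]
  rw [sum_comm]
  refine sum_congr rfl fun c _ => ?_
  set P := diagonal (fun x => if α x = c then (1:ℝ) else 0)
  set Q := diagonal (fun x => if β x = c then (1:ℝ) else 0)
  have := cyc m (fun i => (if i = 0 then P else 1) * (if i = a + 1 then Q else 1) * S)
  have hm : prodM (fun i => (if i = 0 then P else 1) * (if i = a + 1 then Q else 1) * S) (m+1) =
      prodM (fun i => (if i = 0 then P else 1) * (if i = a + 1 then Q else 1) * S)
        ((a+1) + (b+1)) := by
    congr 1; omega
  rw [hm, prodM_add, prodM,
    prodM_congr _ (fun _ => S) a (fun i hi => by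
      rw [if_neg (by omega), if_neg (by omega)]; simp), prodM_const, prodM,
    prodM_congr _ (fun _ => S) b (fun i hi => by
      rw [if_neg (by omega), if_neg (by omega)]; simp), prodM_const] at this
  rw [if_pos rfl, if_neg (by omega), if_neg (by omega), if_pos (by omega), Matrix.mul_one,
    Matrix.one_mul, Matrix.mul_assoc P S (S ^ a), ← pow_succ', Matrix.mul_assoc Q S (S ^ b),
    ← pow_succ'] at this
  rw [← this]
  obtain rfl : m = a + b + 1 := hab.symm
  have key : ∀ z : Fin (a+b+1+1) → Ω, wt (a+b+1) S z *
      ((if α (z 0) = c then 1 else 0) * (if β (z r) = c then 1 else 0)) =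
      ∏ i : Fin (a+b+1+1), ((if (i:ℕ) = 0 then P else 1) * (if (i:ℕ) = a + 1 then Q else 1) * S)
        (z i) (z (i+1)) := by
    intro z
    have h1 : ∀ i : Fin (a+b+1+1), ((if (i:ℕ) = 0 then P else 1) *
        (if (i:ℕ) = a + 1 then Q else 1) * S) (z i) (z (i+1)) =
        S (z i) (z (i+1)) * ((if i = 0 then (if α (z i) = c then (1:ℝ) else 0) else 1) *
          (if i = r then (if β (z i) = c then (1:ℝ) else 0) else 1)) := by
      intro i
      have hi0 : ((i:ℕ) = 0) ↔ i = 0 := by rw [Fin.ext_iff]; rfl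
      have hir : ((i:ℕ) = a + 1) ↔ i = r := by rw [Fin.ext_iff, hr]
      simp only [hi0, hir]
      by_cases h0 : i = 0
      · by_cases h1 : i = r
        · simp only [if_pos h0, if_pos h1, P, Q, Matrix.mul_assoc, diagonal_mul]; ring
        · simp only [if_pos h0, if_neg h1, P, Matrix.one_mul, Matrix.mul_assoc, diagonal_mul]; ring
      · by_cases h1 : i = r
        · simp only [if_neg h0, if_pos h1, Q, Matrix.one_mul, diagonal_mul]; ring
        · simp only [if_neg h0, if_neg h1, Matrix.one_mul]; ring
    rw [prod_congr rfl fun i _ => h1 i, prod_mul_distrib, prod_mul_distrib]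
    unfold wt
    congr 1
    simp
  exact sum_congr rfl fun z _ => key z

lemma pair_le {S U : Matrix Ω Ω ℝ} {lam : Ω → ℝ} (h2 : Uᵀ * U = 1) (h1 : U * Uᵀ = 1)
    (hsym : Sᵀ = S)
    (hS : S = U * diagonal lam * Uᵀ) (ρ : ℝ) (hρ : 0 < ρ) (α β : Ω → Z)
    (hα : ∀ z, ∀ g : Ω → ℝ, (∀ x, α x ≠ z → g x = 0) →
      ∑ x, ((S *ᵥ g) x) ^ 2 ≤ ρ ^ 2 * ∑ x, g x ^ 2)
    (hβ : ∀ z, ∀ g : Ω → ℝ, (∀ x, β x ≠ z → g x = 0) →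
      ∑ x, ((S *ᵥ g) x) ^ 2 ≤ ρ ^ 2 * ∑ x, g x ^ 2) (m : ℕ) (c c' : Fin (m+1)) (hc : c ≠ c') :
    ∑ z, wt m S z * (if α (z c) = β (z c') then 1 else 0) ≤ ρ * ∑ i, |lam i| ^ m := by
  rw [← sum_rot m (-c)]
  simp only [wt_rot, add_neg_cancel]
  have hr : c' + -c ≠ 0 := by
    intro h
    apply hc
    rw [← sub_eq_add_neg, sub_eq_zero] at h
    exact h.symm
  generalize c' + -c = r at hr ⊢
  have hr0 : (r : ℕ) ≠ 0 := fun h => hr (Fin.ext (by simpa using h))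
  have hr1 := r.2
  rw [pair_trace0 m S α β (r-1) (m - r) (by omega) r (by omega)]
  refine (bad_bound h2 h1 hsym hS ρ hρ α β hα hβ _ _).trans ?_
  rw [show (r:ℕ) - 1 + (m - r) + 1 = m by omega]

end

section
variable {Ω : Type*} [Fintype Ω] [DecidableEq Ω]

open Classical in
/-- normalised adjacency matrix -/
noncomputable def nS (adj : Ω → Ω → Prop) (good : Ω → Prop) (r : Ω → ℝ) : Matrix Ω Ω ℝ :=
  Matrix.of fun x y => if adj x y ∧ good x ∧ good y then 1 / (r x * r y) else 0

open Classical in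
lemma schur (adj : Ω → Ω → Prop) (good : Ω → Prop) (r : Ω → ℝ)
    (hr : ∀ x, good x → 0 < r x) (p : ℝ) (hp : 0 < p) (pr : Ω → Prop)
    (H1 : ∀ x, good x → p * (#{y | adj x y ∧ pr y} : ℝ) ≤ r x ^ 2)
    (H2 : ∀ y, good y → (#{x | adj x y} : ℝ) ≤ r y ^ 2)
    (g : Ω → ℝ) (hg : ∀ x, ¬ pr x → g x = 0) :
    ∑ x, ((nS adj good r *ᵥ g) x) ^ 2 ≤ (1 / p) * ∑ x, g x ^ 2 := by
  set S := nS adj good r with hS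
  have hSnn : ∀ x y, 0 ≤ S x y := by
    intro x y
    simp only [hS, nS, of_apply]
    split_ifs with h
    · have := hr _ h.2.1; have := hr _ h.2.2; positivity
    · exact le_rfl
  have hrow : ∀ x, ((S *ᵥ g) x) ^ 2 ≤ (r x / p) * ∑ y, (if good y then S x y * g y ^ 2 / r y else 0) := by
    intro x
    by_cases hx : good x
    swap
    · have : ∀ y, S x y = 0 := fun y => by simp [hS, nS, hx]
      simp [mulVec, dotProduct, this]
    have hrx := hr x hx
    have h1 : ((S *ᵥ g) x) ^ 2 ≤ (∑ y, (if good y ∧ pr y then S x y * r y else 0)) *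
        ∑ y, (if good y then S x y * g y ^ 2 / r y else 0) := by
      simp only [mulVec, dotProduct]
      apply sum_sq_le_sum_mul_sum_of_sq_le_mul
      · intro y _
        split_ifs with h
        · exact mul_nonneg (hSnn _ _) (hr _ h.1).le
        · exact le_rfl
      · intro y _
        split_ifs with h
        · exact div_nonneg (mul_nonneg (hSnn _ _) (sq_nonneg _)) (hr _ h).le
        · exact le_rfl
      · intro y _
        apply le_of_eq
        by_cases hy : good y
        · have := (hr y hy).ne'
          by_cases hpr : pr y
          · simp only [hy, hpr, and_self, if_true]; field_simp
          · simp [hpr, hg y hpr]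
        · have : S x y = 0 := by simp [hS, nS, hy]
          simp [this]
    refine h1.trans (mul_le_mul_of_nonneg_right ?_ ?_)
    · have h2 : ∑ y, (if good y ∧ pr y then S x y * r y else 0) ≤
          ∑ y, (if adj x y ∧ pr y then 1 / r x else 0) := by
        refine sum_le_sum fun y _ => ?_
        by_cases hy : good y
        · have h5 := hr y hy
          have := h5.ne'
          by_cases hpr : pr y <;> by_cases ha : adj x y
          · simp [hy, hpr, ha, hS, nS, hx]; field_simp; exact le_rfl
          · simp [hy, hpr, ha, hS, nS, hx]
          · simp [hpr]
          · simp [hpr]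
        · simp only [hy, false_and, if_false]
          split_ifs
          · positivity
          · exact le_rfl
      refine h2.trans ?_
      rw [← sum_filter, sum_const, nsmul_eq_mul]
      have := H1 x hx
      rw [mul_one_div, div_le_div_iff₀ hrx hp]
      nlinarith
    · refine sum_nonneg fun y _ => ?_
      split_ifs with h
      · exact div_nonneg (mul_nonneg (hSnn _ _) (sq_nonneg _)) (hr _ h).le
      · exact le_rfl
  calc ∑ x, ((S *ᵥ g) x) ^ 2 ≤ ∑ x, (r x / p) * ∑ y, (if good y then S x y * g y ^ 2 / r y else 0) :=
        sum_le_sum fun x _ => hrow x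
    _ = ∑ y, ∑ x, (r x / p) * (if good y then S x y * g y ^ 2 / r y else 0) := by
        simp only [mul_sum]; rw [sum_comm]
    _ ≤ ∑ y, (1 / p) * g y ^ 2 := by
        refine sum_le_sum fun y _ => ?_
        by_cases hy : good y
        swap
        · simp only [hy, if_false, mul_zero, sum_const_zero]; positivity
        have hry := hr y hy
        have h3 : ∑ x, (r x / p) * (if good y then S x y * g y ^ 2 / r y else 0) ≤
            ∑ x, (if adj x y then (1/p) * (g y ^ 2 / r y ^ 2) else 0) := by
          refine sum_le_sum fun x _ => ?_
          have : 0 ≤ (1/p) * (g y ^ 2 / r y ^ 2) := by positivity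
          by_cases hx : good x
          · have := (hr x hx).ne'
            by_cases ha : adj x y
            · simp only [hS, nS, of_apply, ha, hx, hy, and_self, if_true]
              field_simp
              exact le_rfl
            · simp [hS, nS, ha]
          · have h0 : S x y = 0 := by simp [hS, nS, hx]
            simp only [h0, zero_mul, zero_div, ite_self, mul_zero]
            split_ifs
            · assumption
            · exact le_rfl
        refine h3.trans ?_
        rw [← sum_filter, sum_const, nsmul_eq_mul]
        have h4 := H2 y hy
        calc (#{x | adj x y} : ℝ) * (1 / p * (g y ^ 2 / r y ^ 2))
            ≤ r y ^ 2 * (1 / p * (g y ^ 2 / r y ^ 2)) := by gcongr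
          _ = _ := by field_simp
    _ = _ := by rw [mul_sum]

end

section
variable {V : Type*} [Fintype V] [DecidableEq V] (G : SimpleGraph V) [DecidableRel G.Adj]

/-- common neighbourhood -/
def T (x y : V) : Finset V := {v | G.Adj x v ∧ G.Adj y v}

lemma T_symm (x y : V) : T G x y = T G y x := by
  ext v; simp [T, and_comm]

/-- codegree -/
noncomputable def cd : Matrix V V ℝ := Matrix.of fun x y => ((T G x y).card : ℝ)

lemma cd_eq : cd G = G.adjMatrix ℝ * G.adjMatrix ℝ := by
  ext x y
  rw [Matrix.mul_apply]
  simp only [cd, of_apply, T, SimpleGraph.adjMatrix_apply, mul_ite, mul_one, mul_zero]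
  rw [card_filter]
  push_cast
  refine sum_congr rfl fun v _ => ?_
  by_cases h1 : G.Adj x v <;> by_cases h2 : G.Adj v y <;> simp [h1, h2, G.adj_comm y v]

lemma one_step (q : ℕ) (p : ℝ) (hp : 0 ≤ p) (j : Fin (q+1)) :
    ∑ u : Fin (q+1) → V, wt q (cd G) u * (if cd G (u j) (u (j+1)) < p then 1 else 0) ≤
      p * ∑ x, ∑ y, (cd G ^ q) x y := by
  classical
  rw [← sum_rot q (-j)]
  have hz : ∀ i : Fin (q+1), j + 1 + -j = 1 := fun i => by abel
  simp only [wt_rot, add_neg_cancel, hz j]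
  set B := cd G with hB
  set B' : Matrix V V ℝ := Matrix.of fun x y => if B x y < p then B x y else 0 with hB'
  have hBnn : ∀ x y, 0 ≤ B x y := fun x y => by simp [hB, cd]
  have hBq : ∀ m x y, 0 ≤ (B ^ m) x y := by
    intro m
    induction m with
    | zero => intro x y; rw [pow_zero, Matrix.one_apply]; split_ifs <;> norm_num
    | succ m ih =>
      intro x y
      rw [pow_succ, Matrix.mul_apply]
      exact sum_nonneg fun z _ => mul_nonneg (ih _ _) (hBnn _ _)
  have := cyc q (fun i => if i = 0 then B' else B)
  rw [prodM, prodM_congr _ (fun _ => B) q (fun i _ => by simp), prodM_const, if_pos rfl] at this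
  have e : ∀ u : Fin (q+1) → V, wt q B u * (if B (u 0) (u 1) < p then 1 else 0) =
      ∏ i : Fin (q+1), (if (i:ℕ) = 0 then B' else B) (u i) (u (i+1)) := by
    intro u
    unfold wt
    rw [Fin.prod_univ_succ, Fin.prod_univ_succ]
    simp [hB']
  rw [sum_congr rfl fun u _ => e u, this]
  simp only [Matrix.trace, diag_apply, Matrix.mul_apply]
  rw [sum_comm, mul_sum]
  refine sum_le_sum fun x _ => ?_
  rw [mul_sum]
  refine sum_le_sum fun y _ => ?_
  refine mul_le_mul_of_nonneg_right ?_ (hBq _ _ _)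
  simp only [hB', of_apply]
  split_ifs with h
  · exact h.le
  · exact hp

lemma few_bad (q : ℕ) (p d : ℝ) (hp : 0 ≤ p) (hd : 0 < d)
    (hn : 0 < Fintype.card V)
    (hdeg : d * Fintype.card V ≤ ∑ x, ∑ y, G.adjMatrix ℝ x y)
    (hpd : 4 * (q+1) * p * Fintype.card V ≤ d ^ 2) :
    0 < ∑ u : Fin (q+1) → V, wt q (cd G) u ∧
    ∑ u : Fin (q+1) → V, wt q (cd G) u * (if ∀ j, p ≤ cd G (u j) (u (j+1)) then 0 else 1) ≤
      (1/4) * ∑ u : Fin (q+1) → V, wt q (cd G) u := by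
  set A := G.adjMatrix ℝ with hA
  have hsym : Aᵀ = A := by simp [hA]
  obtain ⟨U, lam, h1, h2, hS⟩ := spec A hsym
  have hq := fun r => spec_quad h2 h1 hS r (fun _ => (1:ℝ))
  have hone : ∀ B : Matrix V V ℝ, (fun _ => (1:ℝ)) ⬝ᵥ (B *ᵥ fun _ => (1:ℝ)) = ∑ x, ∑ y, B x y := by
    intro B; simp [dotProduct, mulVec]
  have hnorm := spec_norm h1 (fun _ : V => (1:ℝ))
  simp only [one_pow, sum_const, card_univ, nsmul_eq_mul, mul_one] at hnorm
  obtain ⟨i0, hi0⟩ := rayleigh h2 h1 hS (fun _ => 1) d (by simpa using hn) (by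
    rw [hone]; simpa using hdeg)
  obtain ⟨i1, -, hi1⟩ := exists_max_image univ (fun i => |lam i|) ⟨i0, mem_univ _⟩
  set M := |lam i1| with hM
  have hdM : d ≤ M := hi0.trans ((le_abs_self _).trans (hi1 i0 (mem_univ _)))
  have hB : ∀ r, cd G ^ r = A ^ (2 * r) := by
    intro r; rw [cd_eq, ← pow_two, ← pow_mul]
  have hh : M ^ (2 * (q+1)) ≤ ∑ u : Fin (q+1) → V, wt q (cd G) u := by
    rw [wt_sum, hB, spec_trace h2 h1 hS]
    have := single_le_sum (s := univ) (f := fun i => lam i ^ (2 * (q+1)))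
      (fun i _ => by rw [pow_mul]; positivity) (mem_univ i1)
    refine le_trans ?_ this
    simp only [hM, pow_mul, sq_abs]; exact le_rfl
  have hM0 : 0 < M := hd.trans_le hdM
  have hwnn : ∀ u : Fin (q+1) → V, 0 ≤ wt q (cd G) u := fun u =>
    prod_nonneg fun i _ => by simp [cd]
  refine ⟨lt_of_lt_of_le (by positivity) hh, ?_⟩
  have hsum : ∑ x, ∑ y, (cd G ^ q) x y ≤ M ^ (2 * q) * Fintype.card V := by
    rw [← hone, hB, hq, ← hnorm, mul_sum]
    refine sum_le_sum fun i _ => ?_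
    refine mul_le_mul_of_nonneg_right ?_ (sq_nonneg _)
    rw [pow_mul, pow_mul]
    have : lam i ^ 2 ≤ M ^ 2 := by
      rw [← sq_abs (lam i)]
      exact pow_le_pow_left₀ (abs_nonneg _) (hi1 i (mem_univ _)) 2
    exact pow_le_pow_left₀ (sq_nonneg _) this q
  calc ∑ u : Fin (q+1) → V, wt q (cd G) u * (if ∀ j, p ≤ cd G (u j) (u (j+1)) then 0 else 1)
      ≤ ∑ u : Fin (q+1) → V, ∑ j, wt q (cd G) u * (if cd G (u j) (u (j+1)) < p then 1 else 0) := by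
        refine sum_le_sum fun u _ => ?_
        rw [← mul_sum]
        refine mul_le_mul_of_nonneg_left ?_ (hwnn u)
        have hnn : ∀ j ∈ univ, (0:ℝ) ≤ if cd G (u j) (u (j+1)) < p then 1 else 0 := by
          intro j _; split_ifs <;> norm_num
        split_ifs with h
        · exact sum_nonneg hnn
        · push Not at h
          obtain ⟨j, hj⟩ := h
          refine le_trans ?_ (single_le_sum hnn (mem_univ j))
          rw [if_pos hj]
    _ = ∑ j, ∑ u : Fin (q+1) → V, wt q (cd G) u * (if cd G (u j) (u (j+1)) < p then 1 else 0) :=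
        sum_comm
    _ ≤ ∑ j : Fin (q+1), p * (M ^ (2*q) * Fintype.card V) := by
        refine sum_le_sum fun j _ => (one_step G q p hp j).trans ?_
        gcongr
    _ = (1/4) * (4 * (q+1) * p * Fintype.card V) * M ^ (2*q) := by
        simp; ring
    _ ≤ (1/4) * M ^ 2 * M ^ (2*q) := by
        gcongr
        exact hpd.trans (pow_le_pow_left₀ hd.le hdM 2)
    _ = (1/4) * M ^ (2*(q+1)) := by ring
    _ ≤ _ := by gcongr

end

section
variable {V : Type*} [Fintype V] [DecidableEq V] (G : SimpleGraph V) [DecidableRel G.Adj] {q : ℕ}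

/-- shift -/
def sh (c : Bool) (j : Fin (q+1)) : Fin (q+1) := if c then j - 1 else j + 1

/-- adjacency of rows -/
def rAdj (x y : Bool × (Fin (q+1) → V)) : Prop :=
  y.1 = !x.1 ∧ ∀ j, y.2 j ∈ T G (x.2 j) (x.2 (sh x.1 j))

lemma rAdj_symm (x y : Bool × (Fin (q+1) → V)) (h : rAdj G x y) : rAdj G y x := by
  obtain ⟨c, u⟩ := x
  obtain ⟨c', v⟩ := y
  obtain ⟨h1, h2⟩ := h
  simp only at h1 h2
  subst h1
  refine ⟨by simp, fun j => ?_⟩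
  have a1 := h2 j
  have a2 := h2 (sh (!c) j)
  cases c <;> simp [T, sh] at a1 a2 ⊢
  · exact ⟨a1.1.symm, a2.2.symm⟩
  · exact ⟨a1.1.symm, a2.2.symm⟩

lemma prod_T (x : Bool × (Fin (q+1) → V)) :
    ∏ j, ((T G (x.2 j) (x.2 (sh x.1 j))).card : ℝ) = wt q (cd G) x.2 := by
  obtain ⟨c, u⟩ := x
  cases c
  · simp [wt, cd, sh]
  · rw [← Equiv.prod_comp (Equiv.addRight 1)]
    simp only [wt, cd, sh, of_apply, Equiv.coe_addRight, if_true, add_sub_cancel_right]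
    refine prod_congr rfl fun j _ => ?_
    rw [T_symm]

open Classical in
lemma card_nb (x : Bool × (Fin (q+1) → V)) :
    (#{y | rAdj G x y} : ℝ) = wt q (cd G) x.2 := by
  rw [← prod_T]
  rw [← Nat.cast_prod, ← Fintype.card_piFinset]
  congr 1
  apply card_nbij' (fun y => y.2) (fun f => (!x.1, f))
  · intro y hy
    have hy := (mem_filter.1 (mem_coe.1 hy)).2
    exact mem_coe.2 (Fintype.mem_piFinset.2 hy.2)
  · intro f hf
    have hf := Fintype.mem_piFinset.1 (mem_coe.1 hf)
    exact mem_coe.2 (mem_filter.2 ⟨mem_univ _, rfl, hf⟩)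
  · intro y hy
    have hy := (mem_filter.1 (mem_coe.1 hy)).2
    exact Prod.ext hy.1.symm rfl
  · intro f hf
    rfl

open Classical in
lemma card_thin (p : ℝ) (x : Bool × (Fin (q+1) → V)) (hx : ∀ j, p ≤ cd G (x.2 j) (x.2 (j+1)))
    (pr : Bool × (Fin (q+1) → V) → Prop) (b : Fin (q+1))
    (hpr : ∀ y y', pr y → pr y' → (∀ j, j ≠ b → y.2 j = y'.2 j) → y.2 b = y'.2 b) :
    p * (#{y | rAdj G x y ∧ pr y} : ℝ) ≤ wt q (cd G) x.2 := by
  rw [← prod_T, ← Nat.cast_prod, ← Fintype.card_piFinset]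
  have hT : p ≤ ((T G (x.2 b) (x.2 (sh x.1 b))).card : ℝ) := by
    unfold sh
    split_ifs
    · have := hx (b - 1)
      rw [sub_add_cancel, cd, of_apply, T_symm] at this
      exact this
    · have := hx b
      rwa [cd, of_apply] at this
  refine (mul_le_mul_of_nonneg_right hT (Nat.cast_nonneg _)).trans ?_
  rw [← Nat.cast_mul, ← card_product, Nat.cast_le]
  apply card_le_card_of_injOn (fun ty => Function.update ty.2.2 b ty.1)
  · rintro ⟨t, y⟩ hty
    obtain ⟨ht, hy⟩ := mem_product.1 (mem_coe.1 hty)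
    have hy := (mem_filter.1 hy).2
    refine mem_coe.2 (Fintype.mem_piFinset.2 ?_)
    intro j
    by_cases hj : j = b
    · subst hj; simpa using ht
    · simpa [hj] using hy.1.2 j
  · rintro ⟨t, y⟩ hty ⟨t', y'⟩ hty' he
    have hty := (mem_filter.1 (mem_product.1 (mem_coe.1 hty)).2).2
    have hty' := (mem_filter.1 (mem_product.1 (mem_coe.1 hty')).2).2
    simp only at hty hty' he
    have e1 : t = t' := by simpa using congrFun he b
    have e2 : ∀ j, j ≠ b → y.2 j = y'.2 j := by
      intro j hj
      simpa [hj] using congrFun he j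
    have e3 := hpr y y' hty.2 hty'.2 e2
    have e4 : y.2 = y'.2 := by
      funext j
      by_cases hj : j = b
      · subst hj; exact e3
      · exact e2 j hj
    have e5 : y.1 = y'.1 := hty.1.1.trans hty'.1.1.symm
    exact Prod.ext e1 (Prod.ext e5 e4)

lemma core (m : ℕ) (hm : Even (m+1)) (p d : ℝ) (hp : 0 < p) (hd : 0 < d)
    (hn : 0 < Fintype.card V)
    (hdeg : d * Fintype.card V ≤ ∑ x, ∑ y, G.adjMatrix ℝ x y)
    (hpd : 4 * (q+1) * p * Fintype.card V ≤ d ^ 2)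
    (hnum : 2 * (Fintype.card V : ℝ) ^ (q+1) *
      (2 * ((m+1) * (q+1)) ^ 2 * (1 / √p)) ^ (m+1) < (1/2) ^ (m+1)) :
    ∃ z : Fin (m+1) → Bool × (Fin (q+1) → V), (∀ i, rAdj G (z i) (z (i+1))) ∧
      ∀ s t : Fin (m+1) × Fin (q+1), s ≠ t → (z s.1).2 s.2 ≠ (z t.1).2 t.2 := by
  classical
  obtain ⟨hpos, hbad⟩ := few_bad G q p d hp.le hd hn hdeg hpd
  set h := ∑ u : Fin (q+1) → V, wt q (cd G) u with hh
  set ρ := 1 / √p with hρ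
  have hρ0 : 0 < ρ := by positivity
  have hρ2 : ρ ^ 2 = 1 / p := by
    rw [hρ, div_pow, Real.sq_sqrt hp.le, one_pow]
  let good : Bool × (Fin (q+1) → V) → Prop := fun x => ∀ j, p ≤ cd G (x.2 j) (x.2 (j+1))
  let r : Bool × (Fin (q+1) → V) → ℝ := fun x => √(wt q (cd G) x.2)
  have hwnn : ∀ u : Fin (q+1) → V, 0 ≤ wt q (cd G) u := fun u =>
    prod_nonneg fun i _ => by simp [cd]
  have hr2 : ∀ x, r x ^ 2 = wt q (cd G) x.2 := fun x => Real.sq_sqrt (hwnn _)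
  have hr : ∀ x, good x → 0 < r x := fun x hx =>
    Real.sqrt_pos.2 (prod_pos fun j _ => hp.trans_le (hx j))
  have hH2 : ∀ y, (#{x | rAdj G x y} : ℝ) = r y ^ 2 := by
    intro y
    rw [hr2, ← card_nb]
    congr 2
    ext x
    simp only [mem_filter, mem_univ, true_and]
    exact ⟨rAdj_symm G _ _, rAdj_symm G _ _⟩
  set S := nS (rAdj G) good r with hSdef
  have hsym : Sᵀ = S := by
    ext x y
    simp only [hSdef, nS, transpose_apply, of_apply]
    have : (rAdj G y x ∧ good y ∧ good x) ↔ (rAdj G x y ∧ good x ∧ good y) :=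
      ⟨fun h => ⟨rAdj_symm G _ _ h.1, h.2.2, h.2.1⟩, fun h => ⟨rAdj_symm G _ _ h.1, h.2.2, h.2.1⟩⟩
    by_cases hc : rAdj G x y ∧ good x ∧ good y
    · rw [if_pos (this.2 hc), if_pos hc, mul_comm]
    · rw [if_neg (fun h' => hc (this.1 h')), if_neg hc]
  have hthin : ∀ (pr : Bool × (Fin (q+1) → V) → Prop) (b : Fin (q+1)),
      (∀ y y', pr y → pr y' → (∀ j, j ≠ b → y.2 j = y'.2 j) → y.2 b = y'.2 b) →
      ∀ g : Bool × (Fin (q+1) → V) → ℝ, (∀ x, ¬ pr x → g x = 0) →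
      ∑ x, ((S *ᵥ g) x) ^ 2 ≤ ρ ^ 2 * ∑ x, g x ^ 2 := by
    intro pr b hpr g hg
    rw [hρ2]
    exact schur (rAdj G) good r hr p hp pr
      (fun x hx => by rw [hr2]; exact card_thin G p x hx pr b hpr)
      (fun y _ => (hH2 y).le) g hg
  obtain ⟨U, lam, h1, h2, hS⟩ := spec S hsym
  -- large eigenvalue
  have hray : ∃ i, 1/2 ≤ lam i := by
    have hnorm : ∑ x, r x ^ 2 = 2 * h := by
      simp only [hr2]
      rw [Fintype.sum_prod_type]
      simp [hh, two_mul]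
    refine rayleigh h2 h1 hS r (1/2) (by rw [hnorm]; positivity) ?_
    rw [hnorm]
    have e1 : r ⬝ᵥ (S *ᵥ r) = ∑ x, ∑ y, (if rAdj G x y ∧ good x ∧ good y then (1:ℝ) else 0) := by
      simp only [dotProduct, mulVec, mul_sum]
      refine sum_congr rfl fun x _ => sum_congr rfl fun y _ => ?_
      simp only [hSdef, nS, of_apply]
      split_ifs with hc
      · have := (hr x hc.2.1).ne'
        have := (hr y hc.2.2).ne'
        field_simp
      · ring
    have e2 : ∀ x y, (if rAdj G x y then (1:ℝ) else 0) - (if rAdj G x y then (if good x then 0 else 1) else 0)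
        - (if rAdj G x y then (if good y then 0 else 1) else 0) ≤
        (if rAdj G x y ∧ good x ∧ good y then (1:ℝ) else 0) := by
      intro x y
      by_cases a1 : rAdj G x y <;> by_cases a2 : good x <;> by_cases a3 : good y <;>
        simp [a1, a2, a3]
    have e3 := sum_le_sum (s := univ) fun x _ => sum_le_sum (s := univ) fun y _ => e2 x y
    simp only [sum_sub_distrib] at e3
    have e4 : ∀ (f : Bool × (Fin (q+1) → V) → ℝ),
        ∑ x, ∑ y, (if rAdj G x y then f x else 0) = ∑ x, wt q (cd G) x.2 * f x := by
      intro f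
      refine sum_congr rfl fun x _ => ?_
      rw [← sum_filter, sum_const, nsmul_eq_mul, card_nb]
    have e5 : ∀ (f : Bool × (Fin (q+1) → V) → ℝ),
        ∑ x, ∑ y, (if rAdj G x y then f y else 0) = ∑ x, wt q (cd G) x.2 * f x := by
      intro f
      rw [sum_comm]
      refine sum_congr rfl fun x _ => ?_
      rw [← sum_filter, sum_const, nsmul_eq_mul, hH2, hr2]
    have e6 : ∑ x : Bool × (Fin (q+1) → V), wt q (cd G) x.2 * (if good x then 0 else 1) ≤
        2 * (1/4 * h) := by
      rw [Fintype.sum_prod_type]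
      simp only [good, Fintype.sum_bool, two_mul]
      exact add_le_add hbad hbad
    have e7 : ∑ x : Bool × (Fin (q+1) → V), wt q (cd G) x.2 * 1 = 2 * h := by
      rw [← hnorm]; simp [hr2]
    rw [e4 (fun _ => 1), e4 (fun x => if good x then 0 else 1),
      e5 (fun x => if good x then 0 else 1), e7] at e3
    rw [e1]
    linarith
  by_contra! hcon
  set L : ℝ := ρ * ∑ i, |lam i| ^ m with hL
  have hL0 : 0 ≤ L := mul_nonneg hρ0.le (sum_nonneg fun i _ => by positivity)
  have hSnn : ∀ x y, 0 ≤ S x y := by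
    intro x y
    simp only [hSdef, nS, of_apply]
    split_ifs with hc
    · have := hr _ hc.2.1; have := hr _ hc.2.2; positivity
    · exact le_rfl
  have hwt : ∀ z, 0 ≤ wt m S z := fun z => prod_nonneg fun i _ => hSnn _ _
  -- bound for every conflict
  have hconf : ∀ s t : Fin (m+1) × Fin (q+1), ∑ z, wt m S z *
      (if s ≠ t ∧ (z s.1).2 s.2 = (z t.1).2 t.2 then 1 else 0) ≤ L := by
    intro s t
    by_cases hst : s = t
    · simpa [hst] using hL0
    simp only [ne_eq, hst, not_false_eq_true, true_and]
    by_cases hst1 : s.1 = t.1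
    · have hst2 : s.2 ≠ t.2 := fun h' => hst (Prod.ext hst1 h')
      have := self_trace m S (fun x => x.2 s.2 = x.2 t.2) s.1
      simp only [← hst1]
      rw [this]
      refine self_bound h2 h1 hsym hS ρ hρ0 (fun x => x.2 s.2 = x.2 t.2)
        (hthin _ s.2 ?_) m
      intro y y' hy hy' hj
      rw [hy, hy', hj t.2 hst2.symm]
    · refine pair_le h2 h1 hsym hS ρ hρ0 (fun x => x.2 s.2) (fun x => x.2 t.2)
        (fun c => ?_) (fun c => ?_) m s.1 t.1 hst1
      · intro g hg
        refine hthin (fun x => x.2 s.2 = c) s.2 ?_ g hg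
        intro y y' hy hy' _
        exact hy.trans hy'.symm
      · intro g hg
        refine hthin (fun x => x.2 t.2 = c) t.2 ?_ g hg
        intro y y' hy hy' _
        exact hy.trans hy'.symm
  have htot : ∑ z, wt m S z ≤ ((m+1) * (q+1)) ^ 2 * L := by
    calc ∑ z, wt m S z ≤ ∑ z, ∑ s : Fin (m+1) × Fin (q+1), ∑ t : Fin (m+1) × Fin (q+1), wt m S z *
          (if s ≠ t ∧ (z s.1).2 s.2 = (z t.1).2 t.2 then 1 else 0) := by
          refine sum_le_sum fun z _ => ?_
          have hnn : ∀ s t : Fin (m+1) × Fin (q+1), 0 ≤ wt m S z *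
              (if s ≠ t ∧ (z s.1).2 s.2 = (z t.1).2 t.2 then (1:ℝ) else 0) := by
            intro s t
            refine mul_nonneg (hwt z) ?_
            split_ifs <;> norm_num
          by_cases hz : ∀ i, rAdj G (z i) (z (i+1))
          · obtain ⟨s, t, hne, heq⟩ := hcon z hz
            refine le_trans ?_ (single_le_sum (fun s _ => sum_nonneg fun t _ => hnn s t) (mem_univ s))
            refine le_trans ?_ (single_le_sum (fun t _ => hnn s t) (mem_univ t))
            simp [hne, heq]
          · push Not at hz
            obtain ⟨i, hi⟩ := hz
            have : wt m S z = 0 := prod_eq_zero (mem_univ i) (by simp [hSdef, nS, hi])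
            rw [this]
            simp
      _ = ∑ s : Fin (m+1) × Fin (q+1), ∑ t : Fin (m+1) × Fin (q+1), ∑ z, wt m S z *
          (if s ≠ t ∧ (z s.1).2 s.2 = (z t.1).2 t.2 then 1 else 0) := by
          rw [sum_comm]
          refine sum_congr rfl fun s _ => sum_comm
      _ ≤ ∑ s : Fin (m+1) × Fin (q+1), ∑ t : Fin (m+1) × Fin (q+1), L :=
          sum_le_sum fun s _ => sum_le_sum fun t _ => hconf s t
      _ = _ := by simp; ring
  rw [wt_sum, spec_trace h2 h1 hS] at htot
  set K : ℝ := ((m+1) * (q+1)) ^ 2 with hK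
  set τ : ℝ := 2 * K * ρ with hτ
  have hτ0 : 0 ≤ τ := by positivity
  have hpt : ∀ x : ℝ, 0 ≤ x → K * ρ * x ^ m ≤ (1/2) * x ^ (m+1) + (1/2) * τ ^ (m+1) := by
    intro x hx
    have : K * ρ = τ / 2 := by rw [hτ]; ring
    rw [this]
    rcases le_total τ x with hc | hc
    · have a1 : τ * x ^ m ≤ x ^ (m+1) := by rw [pow_succ']; gcongr
      have : 0 ≤ τ ^ (m+1) := by positivity
      linarith
    · have a1 : τ * x ^ m ≤ τ ^ (m+1) := by rw [pow_succ']; gcongr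
      have : 0 ≤ x ^ (m+1) := by positivity
      linarith
  have hb : K * L ≤ (1/2) * ∑ i, lam i ^ (m+1) +
      (1/2) * (2 * (Fintype.card V : ℝ) ^ (q+1) * τ ^ (m+1)) := by
    have : K * L = ∑ i, K * ρ * |lam i| ^ m := by rw [hL, ← mul_sum]; ring
    rw [this]
    refine (sum_le_sum fun i _ => hpt _ (abs_nonneg (lam i))).trans ?_
    rw [sum_add_distrib, ← mul_sum]
    simp only [hm.pow_abs]
    simp only [sum_const, card_univ, nsmul_eq_mul, Fintype.card_prod, Fintype.card_bool,
      Fintype.card_pi, prod_const, Fintype.card_fin]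
    push_cast
    linarith
  obtain ⟨i, hi⟩ := hray
  have hlow : (1/2 : ℝ) ^ (m+1) ≤ ∑ i, lam i ^ (m+1) := by
    refine le_trans (pow_le_pow_left₀ (by norm_num) hi _) ?_
    exact single_le_sum (f := fun i => lam i ^ (m+1)) (fun i _ => hm.pow_nonneg _) (mem_univ i)
  linarith

end

end TT

end

namespace TT

lemma numer (m q : ℕ) (hm : 1 ≤ m) (N d : ℝ) (hN : 2 ≤ N)
    (hd : 2 * (8 * (((m:ℝ)+1) * (q+1)) ^ 2 * (q+1)) * N ^ ((1:ℝ)/2 + ((q:ℝ)+1)/((m:ℝ)+1)) ≤ d) :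
    2 * N ^ (q+1) *
      (2 * (((m:ℝ)+1) * (q+1)) ^ 2 * (1 / √(d ^ 2 / (4 * (q+1) * N)))) ^ (m+1)
      < (1/2) ^ (m+1) := by
  have hN0 : 0 < N := by linarith
  set a : ℝ := N ^ (((q:ℝ)+1)/((m:ℝ)+1)) with ha
  set s : ℝ := N ^ ((1:ℝ)/2) with hs
  set K : ℝ := (((m:ℝ)+1) * (q+1)) ^ 2 with hK
  have hK0 : 0 < K := by positivity
  have ha0 : 0 < a := by positivity
  have hs0 : 0 < s := by positivity
  have hss : s * s = N := by
    rw [hs, ← Real.rpow_add hN0]; norm_num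
  have hak : a ^ (m+1) = N ^ (q+1) := by
    rw [ha, ← Real.rpow_natCast, ← Real.rpow_mul hN0.le, ← Real.rpow_natCast]
    congr 1
    push_cast
    field_simp
  rw [Real.rpow_add hN0] at hd
  have hl1 : (1:ℝ) ≤ (q:ℝ)+1 := by linarith [Nat.cast_nonneg (α := ℝ) q]
  have hl0 : (0:ℝ) < (q:ℝ)+1 := by linarith
  have hroot : 8 * K * a ≤ √(d ^ 2 / (4 * (q+1) * N)) := by
    apply Real.le_sqrt_of_sq_le
    rw [le_div_iff₀ (by positivity)]
    have h1 : (2 * (8 * K * ((q:ℝ)+1)) * (s * a)) ^ 2 ≤ d ^ 2 :=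
      pow_le_pow_left₀ (by positivity) hd 2
    refine le_trans ?_ h1
    have : (2 * (8 * K * ((q:ℝ)+1)) * (s * a)) ^ 2
      = (8 * K * a) ^ 2 * (4 * ((q:ℝ)+1) * N) * ((q:ℝ)+1) := by
      rw [← hss]; ring
    rw [this]
    exact le_mul_of_one_le_right (by positivity) hl1
  have htau : 2 * K * (1 / √(d ^ 2 / (4 * (q+1) * N))) ≤ 1 / (4 * a) := by
    calc _ ≤ 2 * K * (1 / (8 * K * a)) := by gcongr
      _ = _ := by field_simp; norm_num
  have hpow := pow_le_pow_left₀ (by positivity) htau (m+1)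
  calc _ ≤ 2 * N ^ (q+1) * (1 / (4 * a)) ^ (m+1) := by gcongr
    _ = 2 * (1/2) ^ (m+1) * (1/2) ^ (m+1) := by
      rw [div_pow, mul_pow, hak, one_pow]
      have : (4:ℝ) ^ (m+1) = 2 ^ (m+1) * 2 ^ (m+1) := by rw [← mul_pow]; norm_num
      rw [this, div_pow, one_pow]
      field_simp
    _ < (1/2) ^ (m+1) := by
      have h2 : (1/2:ℝ) ^ (m+1) ≤ (1/2) ^ 2 :=
        pow_le_pow_of_le_one (by norm_num) (by norm_num) (by omega)
      have h3 : (0:ℝ) < (1/2) ^ (m+1) := by positivity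
      nlinarith

section
variable {V : Type*} [Fintype V] [DecidableEq V] (G : SimpleGraph V) [DecidableRel G.Adj] {q : ℕ}

lemma contains_of (m : ℕ) (z : Fin (m+1) → Bool × (Fin (q+1) → V))
    (hz : ∀ i, rAdj G (z i) (z (i+1)))
    (hc : ∀ s t : Fin (m+1) × Fin (q+1), s ≠ t → (z s.1).2 s.2 ≠ (z t.1).2 t.2)
    (h0 : (z 0).1 = false) : Contains (torusGraph (m+1) (q+1)) G := by
  have hpar : ∀ a : ℕ, ∀ h : a < m+1, (z ⟨a, h⟩).1 = decide (Odd a) := by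
    intro a
    induction a with
    | zero => intro h; simpa using h0
    | succ a ih =>
      intro h
      have h1 := (hz ⟨a, by omega⟩).1
      have h2 : (⟨a, by omega⟩ : Fin (m+1)) + 1 = ⟨a+1, h⟩ := by
        apply Fin.ext
        rw [Fin.val_add_one_of_lt']
        simpa using h
      rw [h2, ih (by omega)] at h1
      rw [h1]
      by_cases ho : Odd a <;> simp [ho, Nat.odd_add_one]
  have key : ∀ a b : Fin (m+1) × Fin (q+1), (a.1.val + 1) % (m+1) = b.1.val →
      (a.2 = b.2 ∨ (Even a.1.val ∧ a.2 = b.2 + 1) ∨ (Odd a.1.val ∧ b.2 = a.2 + 1)) →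
      G.Adj ((z a.1).2 a.2) ((z b.1).2 b.2) := by
    rintro ⟨a, j⟩ ⟨b, j'⟩ hab hor
    dsimp only at hab hor ⊢
    have hb : b = a + 1 := by
      apply Fin.ext
      rw [← hab, Fin.val_add]
      simp [Nat.add_mod]
    subst hb
    obtain ⟨-, h⟩ := hz a
    have hj := h j'
    simp only [T, Finset.mem_filter, Finset.mem_univ, true_and] at hj
    have hp := hpar a.val a.isLt
    rcases hor with h1 | ⟨he, h1⟩ | ⟨ho, h1⟩
    · rw [h1]; exact hj.1
    · have : (z a).1 = false := by
        rw [show z a = z ⟨a.val, a.isLt⟩ from rfl, hp]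
        simpa using he
      rw [h1]
      have h2 := hj.2
      rw [this] at h2
      simpa [sh] using h2
    · have : (z a).1 = true := by
        rw [show z a = z ⟨a.val, a.isLt⟩ from rfl, hp]
        simpa using ho
      have h2 := hj.2
      rw [this] at h2
      have h3 : j = j' - 1 := by rw [h1]; simp
      rw [h3]
      simpa [sh] using h2
  refine ⟨fun s => (z s.1).2 s.2, ?_, ?_⟩
  · intro s t hst
    by_contra hne
    exact hc s t hne hst
  · intro a b hab
    rw [torusGraph, SimpleGraph.fromRel_adj] at hab
    rcases hab.2 with h | h
    · exact key a b h.1 h.2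
    · exact (key b a h.1 h.2).symm

lemma contains_of' (m : ℕ) (z : Fin (m+1) → Bool × (Fin (q+1) → V))
    (hz : ∀ i, rAdj G (z i) (z (i+1)))
    (hc : ∀ s t : Fin (m+1) × Fin (q+1), s ≠ t → (z s.1).2 s.2 ≠ (z t.1).2 t.2) :
    Contains (torusGraph (m+1) (q+1)) G := by
  cases h0 : (z 0).1 with
  | false => exact contains_of G m z hz hc h0
  | true =>
    refine contains_of G m (fun i => z (i+1)) (fun i => hz (i+1)) ?_ ?_
    · intro s t hst
      refine hc (s.1 + 1, s.2) (t.1 + 1, t.2) ?_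
      intro h
      apply hst
      rw [Prod.ext_iff] at h ⊢
      exact ⟨add_right_cancel h.1, h.2⟩
    · have := (hz 0).1
      rw [h0] at this
      simpa using this

end

end TT

/-- For even `k ≥ 4` and `ℓ ≥ 2`, `ex(n, T_{k,ℓ}) = O_{k,ℓ}(n^{3/2+ℓ/k}(log n)²)`. -/
theorem turan_torus (k l : ℕ) (hk : 4 ≤ k) (hke : Even k) (hl : 2 ≤ l) :
    ∃ C : ℝ, 0 < C ∧ ∀ n : ℕ, 2 ≤ n → ∀ G : SimpleGraph (Fin n),
      ¬ Contains (torusGraph k l) G →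
      (G.edgeSet.ncard : ℝ) ≤
        C * (n : ℝ) ^ ((3 : ℝ) / 2 + (l : ℝ) / k) * (Real.logb 2 n) ^ 2 := by
  obtain ⟨m, rfl⟩ : ∃ m, k = m + 1 := ⟨k - 1, by omega⟩
  obtain ⟨q, rfl⟩ : ∃ q, l = q + 1 := ⟨l - 1, by omega⟩
  refine ⟨8 * (((m:ℝ)+1) * (q+1)) ^ 2 * (q+1), by positivity, ?_⟩
  intro n hn G hG
  classical
  by_contra hcon
  rw [not_le] at hcon
  apply hG
  have hN : (2:ℝ) ≤ n := by exact_mod_cast hn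
  have hN0 : (0:ℝ) < n := by linarith
  set C : ℝ := 8 * (((m:ℝ)+1) * (q+1)) ^ 2 * (q+1) with hC
  have hC0 : 0 < C := by positivity
  have hlog : 1 ≤ Real.logb 2 n := by
    rw [Real.le_logb_iff_rpow_le (by norm_num) hN0]; simpa using hN
  have hlog2 : 1 ≤ (Real.logb 2 n) ^ 2 := one_le_pow₀ hlog
  set e : ℝ := (G.edgeSet.ncard : ℝ) with he
  have h1 : C * (n : ℝ) ^ ((3 : ℝ) / 2 + ((q + 1 : ℕ) : ℝ) / ((m + 1 : ℕ) : ℝ)) < e :=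
    lt_of_le_of_lt (le_mul_of_one_le_right (by positivity) hlog2) hcon
  have hexp : (n : ℝ) ^ ((3 : ℝ) / 2 + ((q + 1 : ℕ) : ℝ) / ((m + 1 : ℕ) : ℝ))
      = (n : ℝ) ^ ((1 : ℝ) / 2 + ((q : ℝ) + 1) / ((m : ℝ) + 1)) * n := by
    rw [← Real.rpow_add_one hN0.ne']
    congr 1
    push_cast
    ring
  have hd : 2 * C * (n : ℝ) ^ ((1 : ℝ) / 2 + ((q : ℝ) + 1) / ((m : ℝ) + 1)) ≤ 2 * e / n := by
    rw [le_div_iff₀ hN0]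
    rw [hexp] at h1
    nlinarith
  have hd0 : 0 < 2 * e / n := lt_of_lt_of_le (by positivity) hd
  have hsum : ∑ x, ∑ y, G.adjMatrix ℝ x y = 2 * e := by
    have h2 := G.sum_degrees_eq_twice_card_edges
    have h3 : ∀ x, ∑ y, G.adjMatrix ℝ x y = (G.degree x : ℝ) := by
      intro x
      simp [SimpleGraph.adjMatrix_apply, ← SimpleGraph.card_neighborFinset_eq_degree,
        SimpleGraph.neighborFinset_eq_filter]
    simp_rw [h3]
    rw [← Nat.cast_sum, h2, he, ← SimpleGraph.coe_edgeFinset, Set.ncard_coe_finset]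
    push_cast
    rfl
  obtain ⟨z, hz, hc⟩ := TT.core G (q := q) m hke ((2 * e / n) ^ 2 / (4 * (q+1) * n)) (2 * e / n)
    (by positivity) hd0 (by simp; omega)
    (by rw [hsum, Fintype.card_fin]; exact le_of_eq (by field_simp))
    (by rw [Fintype.card_fin]; exact le_of_eq (by field_simp))
    (by rw [Fintype.card_fin]; exact TT.numer m q (by omega) n _ hN hd)
  exact TT.contains_of' G m z hz hc
end

section
/- Let ℓ ≥ 2. There exists C₀ = C₀(K, ℓ) such that if G is an n-vertex bipartite (C_{2ℓ}□K₂)-free graph with average degree d ≥ C₀n^{1/2} and maximum degree at most Kd, then for every edge uv ∈ E(G), the number of 4-cycles uvwz in G with codegree d(u, w) > C₀d^{1/2} is at most C₀d. -/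
open SimpleGraph

/-- The `2ℓ`-prism `C_{2ℓ} □ K₂`. -/
def prism (l : ℕ) : SimpleGraph (Fin (2 * l) × Fin 2) :=
  cycleGraph (2 * l) □ (⊤ : SimpleGraph (Fin 2))

/-- Number of common neighbours of `u` and `v` in `G`. -/
noncomputable def codeg {V : Type*} (G : SimpleGraph V) (u v : V) : ℕ :=
  (G.neighborSet u ∩ G.neighborSet v).ncard

open Finset in
/-- codegree of `x`, `x'` in the bipartite edge set `E` -/
def cdE {α β : Type*} [Fintype β] [DecidableEq α] [DecidableEq β]
    (E : Finset (α × β)) (x x' : α) : ℕ :=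
  (univ.filter fun y => (x, y) ∈ E ∧ (x', y) ∈ E).card

open Finset in
def richE {α β : Type*} [Fintype α] [Fintype β] [DecidableEq α] [DecidableEq β]
    (t : ℕ) (E : Finset (α × β)) (e : α × β) : Finset α :=
  univ.filter fun x' => (x', e.2) ∈ E ∧ t < cdE E e.1 x'

open Finset in
def phiE {α β : Type*} [Fintype α] [Fintype β] [DecidableEq α] [DecidableEq β]
    (t : ℕ) (E : Finset (α × β)) : ℕ :=
  ∑ a : α, ∑ b : α, (cdE E a b - t)

section
set_option linter.unusedSectionVars false
variable {α β : Type*} [Fintype α] [Fintype β] [DecidableEq α] [DecidableEq β]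
open Finset

lemma cdE_comm (E : Finset (α × β)) (a b : α) : cdE E a b = cdE E b a := by
  unfold cdE; congr 1; ext y; simp [and_comm]

lemma cdE_erase_eq (E : Finset (α × β)) (e : α × β) (a b : α)
    (h : ¬ (a = e.1 ∧ (b, e.2) ∈ E)) (h' : ¬ (b = e.1 ∧ (a, e.2) ∈ E)) :
    cdE E a b = cdE (E.erase e) a b := by
  unfold cdE; congr 1; ext y
  obtain ⟨x, z⟩ := e
  simp only [mem_filter, mem_univ, true_and, mem_erase, ne_eq, Prod.mk.injEq] at *
  constructor
  · rintro ⟨h1, h2⟩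
    refine ⟨⟨?_, h1⟩, ⟨?_, h2⟩⟩
    · rintro ⟨rfl, rfl⟩; exact h ⟨rfl, h2⟩
    · rintro ⟨rfl, rfl⟩; exact h' ⟨rfl, h1⟩
  · rintro ⟨h1, h2⟩; exact ⟨h1.2, h2.2⟩

lemma cdE_erase_le (E : Finset (α × β)) (e : α × β) (a b : α) :
    cdE E a b ≤ cdE (E.erase e) a b + 1 := by
  unfold cdE
  refine le_trans (card_le_card (t := insert e.2 (univ.filter fun y => (a, y) ∈ E.erase e ∧ (b, y) ∈ E.erase e)) ?_) (card_insert_le _ _)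
  intro y hy
  obtain ⟨x, z⟩ := e
  simp only [mem_filter, mem_univ, true_and, mem_erase, ne_eq, Prod.mk.injEq, mem_insert] at *
  tauto

lemma phiE_erase (t : ℕ) (E : Finset (α × β)) (e : α × β) :
    phiE t E ≤ phiE t (E.erase e) + 2 * (richE t E e).card := by
  have key : ∀ a b : α, cdE E a b - t ≤ (cdE (E.erase e) a b - t)
      + (if a = e.1 then (if b ∈ richE t E e then 1 else 0) else 0)
      + (if b = e.1 then (if a ∈ richE t E e then 1 else 0) else 0) := by
    intro a b
    have h1 := cdE_erase_le E e a b
    by_cases h : a = e.1 ∧ (b, e.2) ∈ E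
    · by_cases hr : t < cdE E a b
      · have : b ∈ richE t E e := by
          simp only [richE, mem_filter, mem_univ, true_and]
          exact ⟨h.2, h.1 ▸ hr⟩
        rw [if_pos h.1, if_pos this]; omega
      · omega
    · by_cases h' : b = e.1 ∧ (a, e.2) ∈ E
      · by_cases hr : t < cdE E a b
        · have : a ∈ richE t E e := by
            simp only [richE, mem_filter, mem_univ, true_and]
            rw [cdE_comm] at hr
            exact ⟨h'.2, h'.1 ▸ hr⟩
          rw [if_pos h'.1, if_pos this]; omega
        · omega
      · rw [cdE_erase_eq E e a b h h']; omega
  unfold phiE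
  refine le_trans (sum_le_sum fun a _ => sum_le_sum fun b _ => key a b) ?_
  simp only [sum_add_distrib]
  have e1 : (∑ a : α, ∑ b : α, (if a = e.1 then (if b ∈ richE t E e then 1 else 0) else 0)) = (richE t E e).card := by
    rw [sum_comm]; simp
  have e2 : (∑ a : α, ∑ b : α, (if b = e.1 then (if a ∈ richE t E e then 1 else 0) else 0)) = (richE t E e).card := by
    simp
  rw [e1, e2]; omega

lemma exists_core (t : ℕ) : ∀ (m : ℕ) (E : Finset (α × β)), E.card = m → 2 * t * E.card < phiE t E →
    ∃ F ⊆ E, F.Nonempty ∧ ∀ e ∈ F, t < (richE t F e).card := by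
  intro m
  induction m with
  | zero =>
    intro E hE h
    rw [card_eq_zero] at hE
    subst hE
    simp [phiE, cdE] at h
  | succ m ih =>
    intro E hE h
    by_cases hg : ∀ e ∈ E, t < (richE t E e).card
    · exact ⟨E, subset_rfl, card_pos.1 (by omega), hg⟩
    · push Not at hg
      obtain ⟨e, he, hle⟩ := hg
      have hc := card_erase_of_mem he
      have hp := phiE_erase t E e
      obtain ⟨F, hF, h1, h2⟩ := ih (E.erase e) (by omega) (by
        rw [hc]
        rw [hE] at h ⊢
        have : 2 * t * (m+1) = 2 * t * m + 2 * t := by ring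
        simp only [Nat.add_sub_cancel]
        omega)
      exact ⟨F, hF.trans (erase_subset _ _), h1, h2⟩

lemma exists_ladder (t : ℕ) (F : Finset (α × β)) (hF : F.Nonempty)
    (hr : ∀ e ∈ F, t < (richE t F e).card) : ∀ k ≤ t, ∃ f : ℕ → α × β,
      (∀ i, i ≤ k → f i ∈ F) ∧ (∀ i < k, ((f i).1, (f (i+1)).2) ∈ F ∧ ((f (i+1)).1, (f i).2) ∈ F) ∧
      (∀ i ≤ k, ∀ j < i, (f i).1 ≠ (f j).1 ∧ (f i).2 ≠ (f j).2) := by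
  intro k
  induction k with
  | zero =>
    intro _
    obtain ⟨e, he⟩ := hF
    exact ⟨fun _ => e, fun _ _ => he, by omega, by omega⟩
  | succ k ih =>
    intro hk
    obtain ⟨f, h1, h2, h3⟩ := ih (by omega)
    have hk1 := hr _ (h1 k le_rfl)
    obtain ⟨x', hx', hxn⟩ := exists_mem_notMem_of_card_lt_card
      (s := (range (k+1)).image fun i => (f i).1) (t := richE t F (f k))
      (lt_of_le_of_lt card_image_le (by rw [card_range]; omega))
    simp only [richE, mem_filter, mem_univ, true_and] at hx'
    obtain ⟨y', hy', hyn⟩ := exists_mem_notMem_of_card_lt_card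
      (s := (range (k+1)).image fun i => (f i).2) (t := univ.filter fun y => ((f k).1, y) ∈ F ∧ (x', y) ∈ F)
      (lt_of_le_of_lt card_image_le (by have := hx'.2; unfold cdE at this; rw [card_range]; omega))
    simp only [mem_filter, mem_univ, true_and] at hy'
    simp only [mem_image, mem_range, not_exists, not_and] at hxn hyn
    refine ⟨fun i => if i ≤ k then f i else (x', y'), ?_, ?_, ?_⟩
    · intro i hi
      dsimp only
      split_ifs with h
      · exact h1 i h
      · exact hy'.2
    · intro i hi
      by_cases h : i < k
      · simp only [if_pos h.le, if_pos (Nat.succ_le_of_lt h)]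
        exact h2 i h
      · have : i = k := by omega
        subst this
        simp only [le_refl, if_true, Nat.not_succ_le_self, if_false]
        exact ⟨hy'.1, hx'.1⟩
    · intro i hi j hj
      by_cases h : i ≤ k
      · simp only [if_pos h, if_pos (hj.le.trans h)]
        exact h3 i h j hj
      · have hjk : j ≤ k := by omega
        simp only [if_neg h, if_pos hjk]
        exact ⟨fun hh => hxn j (by omega) hh.symm, fun hh => hyn j (by omega) hh.symm⟩

lemma phiE_lower (t : ℕ) (E : Finset (α × β)) (X : Finset α) (Y : Finset β)
    (hE : E ⊆ X ×ˢ Y) : E.card ^ 2 ≤ Y.card * (phiE t E + t * X.card ^ 2) := by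
  have hcard : E.card = ∑ y ∈ Y, (X.filter fun x => (x, y) ∈ E).card := by
    rw [card_eq_sum_card_fiberwise (f := Prod.snd) (t := Y) (fun e he => (mem_product.1 (hE he)).2)]
    refine sum_congr rfl fun y _ => ?_
    refine card_bij' (fun e _ => e.1) (fun x _ => (x, y)) ?_ ?_ ?_ ?_
    · rintro ⟨a, b⟩ h
      simp only [mem_filter] at h ⊢
      obtain ⟨h, rfl⟩ := h
      exact ⟨(mem_product.1 (hE h)).1, h⟩
    · intro x h
      simp only [mem_filter] at h ⊢
      exact ⟨h.2, trivial⟩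
    · rintro ⟨a, b⟩ h
      simp only [mem_filter] at h
      simp [h.2]
    · intro x h; rfl
  have hsq : (∑ y ∈ Y, (X.filter fun x => (x, y) ∈ E).card ^ 2) ≤ ∑ a ∈ X, ∑ b ∈ X, cdE E a b := by
    have : ∀ y, (X.filter fun x => (x, y) ∈ E).card ^ 2
        = ∑ a ∈ X, ∑ b ∈ X, if (a, y) ∈ E ∧ (b, y) ∈ E then 1 else 0 := by
      intro y
      rw [sq, card_filter, sum_mul_sum]
      refine sum_congr rfl fun a _ => sum_congr rfl fun b _ => ?_
      by_cases h1 : (a, y) ∈ E <;> by_cases h2 : (b, y) ∈ E <;> simp [h1, h2]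
    simp only [this]
    rw [sum_comm]
    refine sum_le_sum fun a _ => ?_
    rw [sum_comm]
    refine sum_le_sum fun b _ => ?_
    unfold cdE
    rw [card_filter]
    exact sum_le_sum_of_subset (subset_univ _)
  have h3 : ∑ a ∈ X, ∑ b ∈ X, cdE E a b ≤ phiE t E + t * X.card ^ 2 := by
    calc ∑ a ∈ X, ∑ b ∈ X, cdE E a b ≤ ∑ a ∈ X, ∑ b ∈ X, ((cdE E a b - t) + t) :=
          sum_le_sum fun a _ => sum_le_sum fun b _ => by omega
      _ = ∑ a ∈ X, ∑ b ∈ X, (cdE E a b - t) + t * X.card ^ 2 := by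
          simp only [sum_add_distrib, sum_const, smul_eq_mul]; ring
      _ ≤ phiE t E + t * X.card ^ 2 := by
          gcongr
          unfold phiE
          refine le_trans (sum_le_sum fun a _ => sum_le_sum_of_subset (subset_univ X)) (sum_le_sum_of_subset (subset_univ X))
  calc E.card ^ 2 ≤ Y.card * ∑ y ∈ Y, (X.filter fun x => (x, y) ∈ E).card ^ 2 := by
        rw [hcard]; exact sq_sum_le_card_mul_sum_sq
    _ ≤ _ := Nat.mul_le_mul_left _ (hsq.trans h3)

end

/-- A cyclic ladder yields a prism. -/
lemma prism_of_ladder {V : Type*} (G : SimpleGraph V) (l : ℕ) (hl : 2 ≤ l) (c : V → Prop)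
    (x y : ℕ → V) (hx : ∀ i < 2 * l, c (x i)) (hy : ∀ i < 2 * l, ¬ c (y i))
    (hxi : ∀ i < 2 * l, ∀ j < i, x i ≠ x j) (hyi : ∀ i < 2 * l, ∀ j < i, y i ≠ y j)
    (h0 : ∀ i < 2 * l, G.Adj (x i) (y i))
    (h1 : ∀ i < 2 * l, ∀ j < 2 * l, (j = i + 1 ∨ (i = 2 * l - 1 ∧ j = 0)) →
      G.Adj (x i) (y j) ∧ G.Adj (y i) (x j)) : Contains (prism l) G := by
  refine ⟨fun p => if Even (p.1.val + p.2.val) then x p.1.val else y p.1.val, ?_, ?_⟩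
  · rintro ⟨⟨i, hi⟩, j⟩ ⟨⟨i', hi'⟩, j'⟩ h
    dsimp only at h
    have par : i = i' → (Even (i + j.val) ↔ Even (i' + j'.val)) → j = j' := by
      rintro rfl hp
      have a1 := j.2
      have a2 := j'.2
      rw [Nat.even_iff, Nat.even_iff] at hp
      apply Fin.ext; omega
    have fin : i = i' → (Even (i + j.val) ↔ Even (i' + j'.val)) →
        ((⟨i, hi⟩, j) : Fin (2*l) × Fin 2) = (⟨i', hi'⟩, j') := by
      intro h hp
      have := par h hp
      subst h; subst this; rfl
    split_ifs at h with e1 e2 e2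
    · refine fin ?_ (by tauto)
      rcases lt_trichotomy i i' with q | q | q
      · exact absurd h.symm (hxi _ hi' _ q)
      · exact q
      · exact absurd h (hxi _ hi _ q)
    · exact absurd (h ▸ hx i hi) (hy i' hi')
    · exact absurd (h ▸ hx i' hi') (hy i hi)
    · refine fin ?_ (by tauto)
      rcases lt_trichotomy i i' with q | q | q
      · exact absurd h.symm (hyi _ hi' _ q)
      · exact q
      · exact absurd h (hyi _ hi _ q)
  · rintro ⟨⟨i, hi⟩, j⟩ ⟨⟨i', hi'⟩, j'⟩ h
    rw [prism, boxProd_adj] at h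
    dsimp only at h ⊢
    have a1 := j.2
    have a2 := j'.2
    rcases h with ⟨h, rfl⟩ | ⟨h, h'⟩
    · have hc : (i' = i + 1 ∨ (i = 2 * l - 1 ∧ i' = 0)) ∨ (i = i' + 1 ∨ (i' = 2 * l - 1 ∧ i = 0)) := by
        rw [cycleGraph_adj'] at h
        simp only [Fin.sub_def] at h
        have m1 : ∀ a b : ℕ, a < 2*l → b < 2*l → (2*l - b + a) % (2*l) = 1 → (a = b + 1 ∨ (b = 2*l-1 ∧ a = 0)) := by
          intro a b ha hb hm
          by_cases hab : b ≤ a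
          · rw [show 2*l - b + a = (a - b) + 2*l by omega, Nat.add_mod_right, Nat.mod_eq_of_lt (by omega)] at hm
            omega
          · rw [Nat.mod_eq_of_lt (by omega)] at hm
            omega
        rcases h with h | h
        · exact Or.inr (m1 _ _ hi hi' h)
        · exact Or.inl (m1 _ _ hi' hi h)
      have pp : Even (i + j.val) ↔ ¬ Even (i' + j.val) := by
        rw [Nat.even_iff, Nat.even_iff]; omega
      rcases hc with hc | hc
      · have := h1 i hi i' hi' hc
        by_cases e : Even (i' + j.val)
        · rw [if_neg (by tauto), if_pos e]; exact this.2
        · rw [if_pos (by tauto), if_neg e]; exact this.1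
      · have := h1 i' hi' i hi hc
        by_cases e : Even (i' + j.val)
        · rw [if_neg (by tauto), if_pos e]; exact this.1.symm
        · rw [if_pos (by tauto), if_neg e]; exact this.2.symm
    · have h' : i = i' := congrArg Fin.val h'
      subst h'
      have hne : j.val ≠ j'.val := fun q => h.ne (Fin.ext q)
      have pp : Even (i + j.val) ↔ ¬ Even (i + j'.val) := by
        rw [Nat.even_iff, Nat.even_iff]; omega
      by_cases e : Even (i + j'.val)
      · rw [if_neg (by tauto), if_pos e]; exact (h0 i hi).symm
      · rw [if_pos (by tauto), if_neg e]; exact h0 i hi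

lemma numerics_aux (t K d C e xx yy : ℝ) (ht : 4 ≤ t) (hK : 0 < K) (hd : 1 ≤ d)
    (hC : C = 8 * t * (K + 1)) (hxx : 0 ≤ xx) (hcon : C * d < e) (hY : yy ≤ K * d)
    (hXe : xx * (C * Real.sqrt d / 2) ≤ e)
    (hlow : e ^ 2 ≤ yy * (2 * t * e + t * xx ^ 2)) : False := by
  have ht0 : 0 < t := by linarith
  have hd0 : 0 < d := by linarith
  have hC0 : 0 < C := by rw [hC]; positivity
  have htK : 0 < t * K := by positivity
  have hCt : 8 * (t * K) ≤ C := by rw [hC]; linarith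
  have hC1 : 1 ≤ C := by rw [hC]; linarith
  have he0 : 0 < e := lt_trans (by positivity) hcon
  have hlow2 : e ^ 2 ≤ K * d * (2 * t * e + t * xx ^ 2) :=
    hlow.trans (mul_le_mul_of_nonneg_right hY (by positivity))
  have b1 : K * d * (2 * t * e) < e ^ 2 / 2 := by
    have h1 : 8 * (t * K) * d < e := lt_of_le_of_lt (mul_le_mul_of_nonneg_right hCt hd0.le) hcon
    have h2 := mul_lt_mul_of_pos_right h1 he0
    have h3 : 0 < t * K * d * e := by positivity
    linarith
  have s1 : (xx * (C * Real.sqrt d / 2)) ^ 2 ≤ e ^ 2 :=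
    pow_le_pow_left₀ (by positivity) hXe 2
  have s2 : (xx * (C * Real.sqrt d / 2)) ^ 2 = xx ^ 2 * d * (C ^ 2 / 4) := by
    have := Real.sq_sqrt hd0.le
    calc _ = xx ^ 2 * (Real.sqrt d ^ 2) * (C ^ 2 / 4) := by ring
      _ = _ := by rw [this]
  have s3 : 2 * (t * K) ≤ C ^ 2 / 4 := by nlinarith
  have s4 : xx ^ 2 * d * (2 * (t * K)) ≤ xx ^ 2 * d * (C ^ 2 / 4) :=
    mul_le_mul_of_nonneg_left s3 (by positivity)
  rw [s2] at s1
  linarith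

/-- For `ℓ ≥ 2` and any `K` there is `C₀ = C₀(K,ℓ)` such that: if `G` is an `n`-vertex
bipartite `(C_{2ℓ}□K₂)`-free graph with average degree `d ≥ C₀·n^{1/2}` and maximum
degree at most `Kd`, then for every edge `uv` of `G` the number of 4-cycles `uvwz` with
`d(u,w) > C₀·d^{1/2}` is at most `C₀·d`. -/
theorem large_codegree_rare (l : ℕ) (hl : 2 ≤ l) (K : ℝ) (hK : 0 < K) :
    ∃ C₀ : ℝ, 0 < C₀ ∧
      ∀ (n : ℕ) (G : SimpleGraph (Fin n)), G.Colorable 2 →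
        ¬ Contains (prism l) G →
        C₀ * Real.sqrt n ≤ 2 * (G.edgeSet.ncard : ℝ) / n →
        (∀ v, ((G.neighborSet v).ncard : ℝ) ≤ K * (2 * (G.edgeSet.ncard : ℝ) / n)) →
        ∀ u v, G.Adj u v →
          (({p : Fin n × Fin n |
              G.Adj v p.1 ∧ G.Adj p.1 p.2 ∧ G.Adj p.2 u ∧
              p.1 ≠ u ∧ p.1 ≠ v ∧ p.2 ≠ u ∧ p.2 ≠ v ∧
              C₀ * Real.sqrt (2 * (G.edgeSet.ncard : ℝ) / n) <
                (codeg G u p.1 : ℝ)}).ncard : ℝ) ≤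
            C₀ * (2 * (G.edgeSet.ncard : ℝ) / n) := by
  classical
  set t : ℕ := 2 * l with ht
  have htR : (4:ℝ) ≤ (t:ℝ) := by exact_mod_cast (by omega : 4 ≤ t)
  refine ⟨8 * t * (K + 1), by positivity, ?_⟩
  intro n G hcol hfree hd hmax u v huv
  set d : ℝ := 2 * (G.edgeSet.ncard : ℝ) / n with hdd
  set C : ℝ := 8 * t * (K + 1) with hC
  by_contra hcon
  push Not at hcon
  set S : Set (Fin n × Fin n) := {p : Fin n × Fin n |
              G.Adj v p.1 ∧ G.Adj p.1 p.2 ∧ G.Adj p.2 u ∧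
              p.1 ≠ u ∧ p.1 ≠ v ∧ p.2 ≠ u ∧ p.2 ≠ v ∧
              C * Real.sqrt d < (codeg G u p.1 : ℝ)} with hS
  set E : Finset (Fin n × Fin n) := S.toFinset with hE
  have memE : ∀ p, p ∈ E ↔ p ∈ S := fun p => by rw [hE, Set.mem_toFinset]
  have hEc : S.ncard = E.card := Set.ncard_eq_toFinset_card' S
  rw [hEc] at hcon
  have hC32 : 32 ≤ C := by rw [hC]; nlinarith [mul_pos (by linarith : (0:ℝ) < t) hK]
  have hn : (1:ℝ) ≤ n := by
    have := u.pos
    exact_mod_cast this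
  have hd1 : 1 ≤ d := by
    have : 1 ≤ Real.sqrt n := Real.one_le_sqrt.2 hn
    nlinarith
  have hsd : 1 ≤ Real.sqrt d := Real.one_le_sqrt.2 hd1
  have hsd2 : Real.sqrt d ^ 2 = d := Real.sq_sqrt (by linarith)
  set X := E.image Prod.fst with hX
  set Y := E.image Prod.snd with hY
  have hEXY : E ⊆ X ×ˢ Y := by
    intro p hp
    exact Finset.mem_product.2 ⟨Finset.mem_image_of_mem _ hp, Finset.mem_image_of_mem _ hp⟩
  have hYc : (Y.card : ℝ) ≤ K * d := by
    refine le_trans ?_ (hmax u)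
    have : Y.card ≤ (G.neighborSet u).ncard := by
      rw [← Set.ncard_coe_finset]
      refine Set.ncard_le_ncard ?_ (Set.toFinite _)
      intro y hy
      obtain ⟨p, hp, rfl⟩ := Finset.mem_image.1 (Finset.mem_coe.1 hy)
      exact ((memE p).1 hp).2.2.1.symm
    exact_mod_cast this
  have hdeg : ∀ x ∈ X, C * Real.sqrt d / 2 ≤ ((E.filter fun p => p.1 = x).card : ℝ) := by
    intro x hx
    obtain ⟨p, hp, rfl⟩ := Finset.mem_image.1 hx
    have hpS := (memE p).1 hp
    obtain ⟨q1, q2, q3, q4, q5, q6, q7, q8⟩ := hpS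
    have hle : codeg G u p.1 ≤ (E.filter fun q => q.1 = p.1).card + 1 := by
      have hsub : (G.neighborSet u ∩ G.neighborSet p.1) ⊆
          ((insert v ((E.filter fun q => q.1 = p.1).image Prod.snd) : Finset (Fin n)) : Set (Fin n)) := by
        rintro z ⟨hz1, hz2⟩
        rw [Finset.mem_coe, Finset.mem_insert]
        by_cases hzv : z = v
        · exact Or.inl hzv
        · refine Or.inr (Finset.mem_image.2 ⟨(p.1, z), ?_, rfl⟩)
          rw [Finset.mem_filter, memE]
          exact ⟨⟨q1, hz2, hz1.symm, q4, q5, hz1.ne', hzv, q8⟩, rfl⟩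
      refine le_trans (Set.ncard_le_ncard hsub (Finset.finite_toSet _)) ?_
      rw [Set.ncard_coe_finset]
      exact (Finset.card_insert_le _ _).trans (Nat.add_le_add_right Finset.card_image_le 1)
    have hle' : (codeg G u p.1 : ℝ) ≤ ((E.filter fun q => q.1 = p.1).card : ℝ) + 1 := by exact_mod_cast hle
    nlinarith
  have hXe : (X.card : ℝ) * (C * Real.sqrt d / 2) ≤ E.card := by
    have h1 : E.card = ∑ x ∈ X, (E.filter fun p => p.1 = x).card :=
      Finset.card_eq_sum_card_fiberwise (fun e he => Finset.mem_image_of_mem _ he)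
    rw [h1]
    push_cast
    rw [← nsmul_eq_mul]
    exact Finset.card_nsmul_le_sum _ _ _ hdeg
  have hlow := phiE_lower t E X Y hEXY
  have hphi : 2 * t * E.card < phiE t E := by
    by_contra hnot
    push Not at hnot
    have hlow' : (E.card : ℝ) ^ 2 ≤ Y.card * (2 * t * E.card + t * X.card ^ 2) := by
      have : E.card ^ 2 ≤ Y.card * (2 * t * E.card + t * X.card ^ 2) :=
        hlow.trans (Nat.mul_le_mul_left _ (Nat.add_le_add_right hnot _))
      exact_mod_cast this
    exact numerics_aux t K d C E.card X.card Y.card htR hK hd1 hC (Nat.cast_nonneg _) hcon hYc hXe hlow'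
  obtain ⟨F, hFE, hFne, hrich⟩ := exists_core t _ E rfl hphi
  obtain ⟨f, f1, f2, f3⟩ := exists_ladder t F hFne hrich (t - 2) (by omega)
  have hFS : ∀ p ∈ F, p ∈ S := fun p hp => (memE p).1 (hFE hp)
  obtain ⟨col⟩ := hcol
  have hneu : ∀ a b, G.Adj a b → (col a = col u ↔ ¬ col b = col u) := by
    intro a b hab
    have h := col.valid hab
    generalize col a = A at h ⊢
    generalize col b = B at h ⊢
    generalize col u = U at h ⊢
    revert h; revert A B U; decide
  have hcx : ∀ p ∈ F, col p.1 = col u := by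
    intro p hp
    have h1 := hneu _ _ (hFS p hp).1
    have h2 := hneu _ _ huv
    tauto
  have hcy : ∀ p ∈ F, ¬ col p.2 = col u := fun p hp => (hneu _ _ (hFS p hp).2.1).1 (hcx p hp)
  have hcv : ¬ col v = col u := (hneu _ _ huv).1 rfl
  apply hfree
  have fF : ∀ i, i < t → ¬ i = t - 1 → f i ∈ F := fun i h1 h2 => f1 i (by omega)
  refine prism_of_ladder G l hl (fun w => col w = col u)
    (fun i => if i = t - 1 then u else (f i).1) (fun i => if i = t - 1 then v else (f i).2) ?_ ?_ ?_ ?_ ?_ ?_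
  · intro i hi
    try dsimp only
    split_ifs with h
    · rfl
    · exact hcx _ (fF i hi h)
  · intro i hi
    try dsimp only
    split_ifs with h
    · exact hcv
    · exact hcy _ (fF i hi h)
  · intro i hi j hj
    try dsimp only
    rw [if_neg (show ¬ j = t - 1 by omega)]
    split_ifs with h
    · exact (hFS _ (fF j (by omega) (by omega))).2.2.2.1.symm
    · exact (f3 i (by omega) j hj).1
  · intro i hi j hj
    try dsimp only
    rw [if_neg (show ¬ j = t - 1 by omega)]
    split_ifs with h
    · exact (hFS _ (fF j (by omega) (by omega))).2.2.2.2.2.2.1.symm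
    · exact (f3 i (by omega) j hj).2
  · intro i hi
    try dsimp only
    split_ifs with h
    · exact huv
    · exact (hFS _ (fF i hi h)).2.1
  · intro i hi j hj hij
    try dsimp only
    by_cases h : i = t - 1
    · have hj0 : ¬ j = t - 1 := by omega
      rw [if_pos h, if_neg hj0, if_pos h, if_neg hj0]
      have := hFS _ (fF j hj hj0)
      exact ⟨this.2.2.1.symm, this.1⟩
    · have hj1 : j = i + 1 := by omega
      rw [if_neg h, if_neg h]
      by_cases h' : j = t - 1
      · rw [if_pos h', if_pos h']
        have := hFS _ (fF i hi h)
        exact ⟨this.1.symm, this.2.2.1⟩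
      · rw [if_neg h', if_neg h']
        subst hj1
        have := f2 i (by omega)
        exact ⟨(hFS _ this.1).2.1, (hFS _ this.2).2.1.symm⟩
end
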